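/- arXiv:1006.1363 — 2 statements merged into one kernel-verified Lean document; each statement's English description precedes it below -/
import Mathlib

section
/- Let G be a finite group with normal subgroups N ≤ M. Suppose 𝒞 = (𝒳,𝒦) is a G-invariant supercharacter theory of M and 𝒟 = (𝒴,𝓛) is a supercharacter theory of G/N such that (a) N is 𝒞-normal, (b) M/N is 𝒟-normal, and (c) 𝒞^{M/N} = 𝒟_{M/N}. Then there exists a unique supercharacter theory ℰ of G such that ℰ_M = 𝒞, ℰ^{G/N} = 𝒟, and every superclass of ℰ outside M is a union of N-cosets; explicitly, ℰ = ( 𝒴 ∪ {X^G : X ∈ 𝒳, X ⊄ Irr(M/N)} , 𝒦 ∪ {L̃ : L ∈ 𝓛, L ⊄ M/N} ), where L̃ is the preimage in G of L ⊆ G/N. -/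
open scoped Classical

noncomputable section

/-- The set of irreducible complex characters of `G`. -/
def Irr (G : Type) [Group G] : Set (G → ℂ) :=
  {χ | ∃ V : FDRep ℂ G, CategoryTheory.Simple V ∧ FDRep.character V = χ}

/-- `σ_X = ∑_{ψ ∈ X} ψ(1)·ψ`. -/
def sigmaChar {G : Type} [Group G] (X : Set (G → ℂ)) : G → ℂ :=
  fun g => ∑ᶠ ψ ∈ X, ψ 1 * ψ g

/-- `P` is a set partition of the set `S`. -/
def IsPartitionOf {α : Type*} (S : Set α) (P : Set (Set α)) : Prop :=
  ∅ ∉ P ∧ (∀ p ∈ P, p ⊆ S) ∧ ∀ a ∈ S, ∃! p, p ∈ P ∧ a ∈ p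

/-- `(𝒳, 𝒦)` is a supercharacter theory of the finite group `G`. -/
def IsSCT (G : Type) [Group G] [Finite G]
    (𝒳 : Set (Set (G → ℂ))) (𝒦 : Set (Set G)) : Prop :=
  IsPartitionOf (Irr G) 𝒳 ∧ IsPartitionOf Set.univ 𝒦 ∧ 𝒳.ncard = 𝒦.ncard ∧
    ({1} : Set G) ∈ 𝒦 ∧
    ∀ X ∈ 𝒳, ∀ K ∈ 𝒦, ∀ g ∈ K, ∀ h ∈ K, sigmaChar X g = sigmaChar X h

/-- `K̂ = ∑_{g ∈ K} g ∈ ℂ[G]`. -/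
def ghat {G : Type} [Group G] (K : Set G) : MonoidAlgebra ℂ G :=
  ∑ᶠ g ∈ K, MonoidAlgebra.single g (1 : ℂ)

/-- The central idempotent `e_χ = (χ(1)/|G|) ∑_g conj(χ g)·g` attached to a character. -/
def eIdem (G : Type) [Group G] (χ : G → ℂ) : MonoidAlgebra ℂ G :=
  (χ 1 / (Nat.card G : ℂ)) •
    ∑ᶠ g : G, (starRingEnd ℂ) (χ g) • MonoidAlgebra.single g (1 : ℂ)

/-- `f_X = ∑_{ψ ∈ X} e_ψ`. -/
def fIdem (G : Type) [Group G] (X : Set (G → ℂ)) : MonoidAlgebra ℂ G :=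
  ∑ᶠ χ ∈ X, eIdem G χ

/-- Partition order: every part of `P` lies in some part of `Q`. -/
def PartLE {α : Type*} (P Q : Set (Set α)) : Prop := ∀ p ∈ P, ∃ q ∈ Q, p ⊆ q

/-- The join of two partitions of the same set: parts are connected components of
the relation "lying in a common part of `P` or of `Q`". -/
def PartJoin {α : Type*} (P Q : Set (Set α)) : Set (Set α) :=
  {C | ∃ a ∈ ⋃₀ P, C = {b | Relation.ReflTransGen
      (fun x y => (∃ p ∈ P, x ∈ p ∧ y ∈ p) ∨ ∃ q ∈ Q, x ∈ q ∧ y ∈ q) a b}}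

/-- Inner product of complex-valued functions on a finite group. -/
def cInner (H : Type) [Group H] (α β : H → ℂ) : ℂ :=
  (Nat.card H : ℂ)⁻¹ * ∑ᶠ h : H, α h * (starRingEnd ℂ) (β h)

/-- Restriction of a function on `G` to a subgroup. -/
def resChar {G : Type} [Group G] (H : Subgroup G) (χ : G → ℂ) : ↥H → ℂ := fun h => χ ↑h

/-- Extension by zero of a function on a subgroup. -/
def zeroExtend {G : Type} [Group G] (H : Subgroup G) (φ : ↥H → ℂ) : G → ℂ :=
  fun g => if h : g ∈ H then φ ⟨g, h⟩ else 0

/-- The induced class function `φ^G`. -/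
def indChar {G : Type} [Group G] (H : Subgroup G) (φ : ↥H → ℂ) : G → ℂ :=
  fun g => (Nat.card ↥H : ℂ)⁻¹ * ∑ᶠ x : G, zeroExtend H φ (x⁻¹ * g * x)

/-- The superclass of `x` with respect to a partition `𝒦` of `G`. -/
def sclass {G : Type} [Group G] (𝒦 : Set (Set G)) (x : G) : Set G := ⋃₀ {K ∈ 𝒦 | x ∈ K}

/-- Superinduction: `φ^{(G)}(x) = [G:H]·(1/|[x]|)·∑_{y ∈ [x]} φ⁰(y)`. -/
def superInd {G : Type} [Group G] (𝒦 : Set (Set G)) (H : Subgroup G) (φ : ↥H → ℂ) : G → ℂ :=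
  fun x => (H.index : ℂ) * (((sclass 𝒦 x).ncard : ℂ))⁻¹ * ∑ᶠ y ∈ sclass 𝒦 x, zeroExtend H φ y

/-- A subgroup is `𝒞`-normal when it is a union of superclasses. -/
def CNormal {G : Type} [Group G] (𝒦 : Set (Set G)) (N : Subgroup G) : Prop :=
  ∃ T ⊆ 𝒦, (N : Set G) = ⋃₀ T

/-- `Irr(G/N)` viewed inside `Irr(G)`: irreducible characters with `N` in their kernel. -/
def IrrOver {G : Type} [Group G] (N : Subgroup G) : Set (G → ℂ) :=
  {χ ∈ Irr G | ∀ n ∈ N, χ n = χ 1}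

/-- The set of irreducible constituents of the restriction of `θ` to `N`. -/
def constituentsOn {G : Type} [Group G] (N : Subgroup G) (θ : G → ℂ) : Set (↥N → ℂ) :=
  {ψ ∈ Irr ↥N | cInner ↥N (resChar N θ) ψ ≠ 0}

/-- `Irr(G|ψ)`: irreducible characters of `G` lying over `ψ ∈ Irr(N)`. -/
def irrOverChar {G : Type} [Group G] (N : Subgroup G) (ψ : ↥N → ℂ) : Set (G → ℂ) :=
  {χ ∈ Irr G | cInner ↥N (resChar N χ) ψ ≠ 0}

/-- `X^G = ⋃_{ψ ∈ X} Irr(G|ψ)` for `X ⊆ Irr(N)`. -/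
def indSet {G : Type} [Group G] (N : Subgroup G) (X : Set (↥N → ℂ)) : Set (G → ℂ) :=
  ⋃ ψ ∈ X, irrOverChar N ψ

/-- Conjugation of a normal subgroup by a group element. -/
def conjSub {G : Type} [Group G] {N : Subgroup G} (hN : N.Normal) (g : G) (n : ↥N) : ↥N :=
  ⟨g * ↑n * g⁻¹, hN.conj_mem ↑n n.2 g⟩

/-- The conjugation action of `g ∈ G` on class functions of a normal subgroup `N`. -/
def charConj {G : Type} [Group G] {N : Subgroup G} (hN : N.Normal) (g : G)
    (ψ : ↥N → ℂ) : ↥N → ℂ :=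
  fun n => ψ (conjSub hN g⁻¹ n)

/-- Inflation of a set of characters of `G/N` to characters of `G`. -/
def inflateSet {G : Type} [Group G] (N : Subgroup G) [N.Normal]
    (Y : Set (G ⧸ N → ℂ)) : Set (G → ℂ) :=
  (fun η => η ∘ (QuotientGroup.mk : G → G ⧸ N)) '' Y

/-- Deflation of a set of characters of `G` (with `N` in their kernels) to characters
of `G/N`. -/
def deflate {G : Type} [Group G] (N : Subgroup G) [N.Normal]
    (X : Set (G → ℂ)) : Set (G ⧸ N → ℂ) :=
  (fun χ => fun q : G ⧸ N => χ (Quotient.out q)) '' X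

/-- The natural map `M → MN/N ≤ G/N`. -/
def projMN {G : Type} [Group G] (M N : Subgroup G) [N.Normal] (m : ↥M) :
    ↥(M.map (QuotientGroup.mk' N)) :=
  ⟨QuotientGroup.mk' N ↑m, Subgroup.mem_map_of_mem _ m.2⟩

end

/-- The defining property of the wedge product `𝒞 ∆ 𝒟` for `N ≤ M ⊴ G`,
`𝒞 = (𝒳,𝒦) ∈ Sup(M)`, `𝒟 = (𝒴,𝓛) ∈ Sup(G/N)`: `E` is a supercharacter theory of `G`
with `E_M = 𝒞`, `E^{G/N} = 𝒟` (via the identification of `Irr(G/N)` with the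
irreducible characters of `G` containing `N` in their kernel), and every superclass of
`E` outside `M` is a union of `N`-cosets. -/
def WedgeProperty (G : Type) [Group G] [Finite G] (N M : Subgroup G) [N.Normal]
    (𝒳 : Set (Set (↥M → ℂ))) (𝒦 : Set (Set ↥M))
    (𝒴 : Set (Set (G ⧸ N → ℂ))) (𝓛 : Set (Set (G ⧸ N)))
    (E : Set (Set (G → ℂ)) × Set (Set G)) : Prop :=
  IsSCT G E.1 E.2 ∧
  -- E_M = 𝒞:
  (fun W => constituentsOn M (sigmaChar W)) '' E.1 = 𝒳 ∧
  (fun J => (Subtype.val ⁻¹' J : Set ↥M)) '' {J ∈ E.2 | J ⊆ (M : Set G)} = 𝒦 ∧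
  -- E^{G/N} = 𝒟:
  {W ∈ E.1 | W ⊆ IrrOver N} = inflateSet N '' 𝒴 ∧
  (fun J => ((QuotientGroup.mk : G → G ⧸ N) '' J)) '' E.2 = 𝓛 ∧
  -- every superclass outside M is a union of N-cosets:
  ∀ J ∈ E.2, ¬ J ⊆ (M : Set G) → ∀ g ∈ J, ∀ n ∈ N, g * n ∈ J

/-- The explicit wedge-product formula
`𝒞 ∆ 𝒟 = (𝒴 ∪ {X^G : X ∈ 𝒳, X ⊄ Irr(M/N)}, 𝒦 ∪ {L̃ : L ∈ 𝓛, L ⊄ M/N})`. -/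
def wedgeFormula (G : Type) [Group G] (N M : Subgroup G) [N.Normal]
    (𝒳 : Set (Set (↥M → ℂ))) (𝒦 : Set (Set ↥M))
    (𝒴 : Set (Set (G ⧸ N → ℂ))) (𝓛 : Set (Set (G ⧸ N))) :
    Set (Set (G → ℂ)) × Set (Set G) :=
  (inflateSet N '' 𝒴 ∪
      (fun X => indSet M X) '' {X ∈ 𝒳 | ¬ X ⊆ IrrOver (N.subgroupOf M)},
    (fun K => (Subtype.val '' K : Set G)) '' 𝒦 ∪
      (fun L => ((QuotientGroup.mk : G → G ⧸ N) ⁻¹' L)) ''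
        {L ∈ 𝓛 | ¬ L ⊆ (M.map (QuotientGroup.mk' N) : Set (G ⧸ N))})

/-- The hypotheses of the wedge-product construction: `𝒞 = (𝒳,𝒦)` is a `G`-invariant
supercharacter theory of `M`, `𝒟 = (𝒴,𝓛)` is a supercharacter theory of `G/N`,
(a) `N` is `𝒞`-normal, (b) `M/N` is `𝒟`-normal, and (c) `𝒞^{M/N} = 𝒟_{M/N}`
(both coordinates, compared inside `G/N` via the natural projection `M → M/N`). -/
def WedgeHyps (G : Type) [Group G] [Finite G] (N M : Subgroup G) [N.Normal]
    [hMn : M.Normal]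
    (𝒳 : Set (Set (↥M → ℂ))) (𝒦 : Set (Set ↥M))
    (𝒴 : Set (Set (G ⧸ N → ℂ))) (𝓛 : Set (Set (G ⧸ N))) : Prop :=
  IsSCT ↥M 𝒳 𝒦 ∧
  (∀ g : G, ∀ K ∈ 𝒦, conjSub hMn g '' K = K) ∧
  IsSCT (G ⧸ N) 𝒴 𝓛 ∧
  CNormal 𝒦 (N.subgroupOf M) ∧
  CNormal 𝓛 (M.map (QuotientGroup.mk' N)) ∧
  -- 𝒞^{M/N} = 𝒟_{M/N}, character partitions:
  {X ∈ 𝒳 | X ⊆ IrrOver (N.subgroupOf M)} =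
    (fun Y => (fun ψ => ψ ∘ projMN M N) ''
      constituentsOn (M.map (QuotientGroup.mk' N)) (sigmaChar Y)) '' 𝒴 ∧
  -- 𝒞^{M/N} = 𝒟_{M/N}, superclass partitions:
  (fun K => (fun m : ↥M => ((↑m : G) : G ⧸ N)) '' K) '' 𝒦 =
    {L ∈ 𝓛 | L ⊆ (M.map (QuotientGroup.mk' N) : Set (G ⧸ N))}

section CharacterTheory

open Module Representation

/-- A representation of a finite group is recognised as irreducible by having only scalar
intertwining endomorphisms. -/
theorem mem_Irr_iff {H : Type} [Group H] [Finite H] {χ : H → ℂ} :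
    χ ∈ Irr H ↔ ∃ V : FDRep ℂ H, finrank ℂ (IntertwiningMap V.ρ V.ρ) = 1 ∧
      Representation.character V.ρ = χ := by
  have := Fintype.ofFinite H
  have : Invertible (Nat.card H : ℂ) := invertibleOfNonzero (NeZero.ne _)
  have key : ∀ V : FDRep ℂ H, CategoryTheory.Simple V ↔
      finrank ℂ (IntertwiningMap V.ρ V.ρ) = 1 := fun V => by
    rw [FDRep.simple_iff_end_is_rank_one, ← Nat.cast_inj (R := ℂ),
      ← FDRep.scalar_product_char_eq_finrank_equivariant, ← Nat.cast_inj (R := ℂ),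
      ← card_inv_mul_sum_char_mul_char_eq_finrank]
    rfl
  exact ⟨fun ⟨V, hV, h⟩ => ⟨V, (key V).1 hV, h⟩, fun ⟨V, hV, h⟩ => ⟨V, (key V).2 hV, h⟩⟩

theorem character_mem_Irr {H : Type} [Group H] [Finite H] {V : Type} [AddCommGroup V] [Module ℂ V]
    [FiniteDimensional ℂ V] (ρ : Representation ℂ H V)
    (h : finrank ℂ (IntertwiningMap ρ ρ) = 1) : ρ.character ∈ Irr H :=
  mem_Irr_iff.2 ⟨FDRep.of ρ, h, rfl⟩

/-- Schur's lemma. -/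
theorem eq_smul_id_of_commutes {H : Type} [Group H] {V : Type} [AddCommGroup V] [Module ℂ V]
    [FiniteDimensional ℂ V] (ρ : Representation ℂ H V)
    (h : finrank ℂ (IntertwiningMap ρ ρ) = 1) (T : V →ₗ[ℂ] V)
    (hT : ∀ g, T ∘ₗ ρ g = ρ g ∘ₗ T) : ∃ c : ℂ, T = c • LinearMap.id := by
  have hne : IntertwiningMap.id ρ ≠ 0 := by
    intro h0
    have hz : ∀ v : V, v = 0 := fun v => congrArg (fun f : IntertwiningMap ρ ρ => f v) h0
    have : Subsingleton (IntertwiningMap ρ ρ) :=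
      ⟨fun a b => IntertwiningMap.ext (LinearMap.ext fun v =>
        (hz (a.toLinearMap v)).trans (hz (b.toLinearMap v)).symm)⟩
    rw [finrank_zero_of_subsingleton] at h
    exact zero_ne_one h
  obtain ⟨c, hc⟩ := (finrank_eq_one_iff_of_nonzero' _ hne).1 h ⟨T, hT⟩
  refine ⟨c, LinearMap.ext fun v => ?_⟩
  exact (congrArg (fun f : IntertwiningMap ρ ρ => f v) hc).symm

theorem trace_inv_eq_conj {V : Type} [AddCommGroup V] [Module ℂ V] [FiniteDimensional ℂ V]
    (A B : Module.End ℂ V) (hAB : B * A = 1) (n : ℕ) (hn : n ≠ 0) (hA : A ^ n = 1) :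
    LinearMap.trace ℂ V B = (starRingEnd ℂ) (LinearMap.trace ℂ V A) := by
  have hss : A.IsSemisimple := by
    refine Module.End.isSemisimple_of_squarefree_aeval_eq_zero
      (p := (Polynomial.X ^ n - 1 : Polynomial ℂ)) ?_ (by simp [hA])
    exact (Polynomial.separable_X_pow_sub_C (1 : ℂ) (by exact_mod_cast hn) one_ne_zero).squarefree
  have hint : DirectSum.IsInternal A.eigenspace :=
    DirectSum.isInternal_submodule_of_iSupIndep_of_iSup_eq_top
    A.eigenspaces_iSupIndep hss.iSup_eigenspace_eq_top
  have hfin : (Function.support fun μ => A.eigenspace μ) = ({μ | A.eigenspace μ ≠ ⊥} : Set ℂ) := rfl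
  have hfin' : ({μ | A.eigenspace μ ≠ ⊥} : Set ℂ).Finite :=
    WellFoundedGT.finite_ne_bot_of_iSupIndep A.eigenspaces_iSupIndep
  have hBA : ∀ μ, ∀ v ∈ A.eigenspace μ, v ≠ 0 → μ ^ n = 1 := by
    intro μ v hv hv0
    have h1 : (A ^ n) v = μ ^ n • v := by
      have := Module.End.HasEigenvector.pow_apply ⟨hv, hv0⟩ n
      exact this
    rw [hA, Module.End.one_apply] at h1
    have : (μ ^ n - 1) • v = 0 := by rw [sub_smul, ← h1, one_smul, sub_self]
    exact sub_eq_zero.1 ((smul_eq_zero.1 this).resolve_right hv0)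
  have hBv : ∀ μ, ∀ v ∈ A.eigenspace μ, B v = (starRingEnd ℂ) μ • v := by
    intro μ v hv
    by_cases hv0 : v = 0
    · simp [hv0]
    have h1 := hBA μ v hv hv0
    have hnorm : ‖μ‖ = 1 := Complex.norm_eq_one_of_pow_eq_one h1 hn
    have hc : (starRingEnd ℂ) μ * μ = 1 := by
      rw [mul_comm, Complex.mul_conj, Complex.normSq_eq_norm_sq, hnorm]; simp
    have h2 : B (A v) = v := by
      rw [← Module.End.mul_apply, hAB, Module.End.one_apply]
    rw [Module.End.mem_eigenspace_iff.1 hv, map_smul] at h2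
    calc B v = ((starRingEnd ℂ) μ * μ) • B v := by rw [hc, one_smul]
      _ = _ := by rw [mul_smul, h2]
  have hmA : ∀ μ, Set.MapsTo A (A.eigenspace μ) (A.eigenspace μ) := fun μ v hv => by
    have := Module.End.mem_eigenspace_iff.1 hv
    rw [SetLike.mem_coe, this]
    exact Submodule.smul_mem _ _ hv
  have hmB : ∀ μ, Set.MapsTo B (A.eigenspace μ) (A.eigenspace μ) := fun μ v hv => by
    rw [SetLike.mem_coe, hBv μ v hv]
    exact Submodule.smul_mem _ _ hv
  rw [LinearMap.trace_eq_sum_trace_restrict' hint hfin' hmA,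
    LinearMap.trace_eq_sum_trace_restrict' hint hfin' hmB, map_sum]
  refine Finset.sum_congr rfl fun μ _ => ?_
  have e1 : A.restrict (hmA μ) = μ • LinearMap.id := LinearMap.ext fun v => Subtype.ext
    (Module.End.mem_eigenspace_iff.1 v.2)
  have e2 : B.restrict (hmB μ) = (starRingEnd ℂ) μ • LinearMap.id :=
    LinearMap.ext fun v => Subtype.ext (hBv μ v.1 v.2)
  rw [e1, e2]
  simp

theorem character_inv_eq_conj {H : Type} [Group H] [Finite H] {V : Type} [AddCommGroup V]
    [Module ℂ V] [FiniteDimensional ℂ V] (ρ : Representation ℂ H V) (g : H) :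
    ρ.character g⁻¹ = (starRingEnd ℂ) (ρ.character g) := by
  refine trace_inv_eq_conj (ρ g) (ρ g⁻¹) ?_ (Nat.card H) Nat.card_pos.ne' ?_
  · rw [← map_mul, inv_mul_cancel, map_one]
  · rw [← map_pow, pow_card_eq_one', map_one]

theorem cInner_eq_sum {H : Type} [Group H] [Fintype H] (α β : H → ℂ) :
    cInner H α β = (Nat.card H : ℂ)⁻¹ * ∑ h : H, α h * (starRingEnd ℂ) (β h) := by
  rw [cInner, finsum_eq_sum_of_fintype]

theorem cInner_character {H : Type} [Group H] [Finite H] {V W : Type} [AddCommGroup V]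
    [Module ℂ V] [FiniteDimensional ℂ V] [AddCommGroup W]
    [Module ℂ W] [FiniteDimensional ℂ W] (ρ : Representation ℂ H V) (σ : Representation ℂ H W) :
    cInner H ρ.character σ.character = finrank ℂ (IntertwiningMap σ ρ) := by
  have := Fintype.ofFinite H
  have : Invertible (Nat.card H : ℂ) := invertibleOfNonzero (NeZero.ne _)
  rw [cInner_eq_sum, ← card_inv_mul_sum_char_mul_char_eq_finrank]
  simp_rw [character_inv_eq_conj]

theorem cInner_Irr {H : Type} [Group H] [Finite H] {χ ψ : H → ℂ} (hχ : χ ∈ Irr H)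
    (hψ : ψ ∈ Irr H) : cInner H χ ψ = if χ = ψ then 1 else 0 := by
  have := Fintype.ofFinite H
  have : Invertible (Nat.card H : ℂ) := invertibleOfNonzero (NeZero.ne _)
  obtain ⟨V, hV, rfl⟩ := hχ
  obtain ⟨W, hW, rfl⟩ := hψ
  have key : ∀ (V W : FDRep ℂ H), cInner H V.character W.character =
      (Nat.card H : ℂ)⁻¹ * ∑ g : H, V.character g * W.character g⁻¹ := fun V W => by
    rw [cInner_eq_sum]
    congr! 3 with g
    exact (character_inv_eq_conj W.ρ g).symm
  by_cases h : V.character = W.character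
  · rw [if_pos h, ← h, key, FDRep.char_orthonormal, if_pos ⟨CategoryTheory.Iso.refl V⟩]
  · rw [if_neg h, key, FDRep.char_orthonormal, if_neg]
    exact fun ⟨i⟩ => h (FDRep.char_iso i)

theorem Irr_one_ne_zero {H : Type} [Group H] [Finite H] {χ : H → ℂ} (hχ : χ ∈ Irr H) :
    χ 1 ≠ 0 := by
  obtain ⟨V, hV, rfl⟩ := mem_Irr_iff.1 hχ
  rw [Representation.char_one, Nat.cast_ne_zero]
  intro h0
  have : Subsingleton V := finrank_zero_iff.1 h0
  have : Subsingleton (IntertwiningMap V.ρ V.ρ) :=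
    ⟨fun a b => IntertwiningMap.ext (LinearMap.ext fun v => Subsingleton.elim _ _)⟩
  rw [finrank_zero_of_subsingleton] at hV
  exact zero_ne_one hV

theorem Irr_conj {H : Type} [Group H] [Finite H] {χ : H → ℂ} (hχ : χ ∈ Irr H) (g h : H) :
    χ (h * g * h⁻¹) = χ g := by
  obtain ⟨V, hV, rfl⟩ := hχ
  exact FDRep.char_conj V g h

theorem Irr_inv {H : Type} [Group H] [Finite H] {χ : H → ℂ} (hχ : χ ∈ Irr H) (g : H) :
    χ g⁻¹ = (starRingEnd ℂ) (χ g) := by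
  obtain ⟨V, hV, rfl⟩ := hχ
  exact character_inv_eq_conj V.ρ g

theorem Irr_one_conj {H : Type} [Group H] [Finite H] {χ : H → ℂ} (hχ : χ ∈ Irr H) :
    (starRingEnd ℂ) (χ 1) = χ 1 := by
  rw [← Irr_inv hχ, inv_one]
/-- A class function acts on an irreducible representation by a scalar. -/
theorem exists_sum_smul_eq_smul_id {H : Type} [Group H] [Fintype H] {V : Type} [AddCommGroup V]
    [Module ℂ V] [FiniteDimensional ℂ V] (ρ : Representation ℂ H V)
    (h : finrank ℂ (IntertwiningMap ρ ρ) = 1) (f : H → ℂ)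
    (hf : ∀ g x, f (x * g * x⁻¹) = f g) :
    ∃ c : ℂ, ∑ g, f g • ρ g = c • LinearMap.id ∧ c * ρ.character 1 = ∑ g, f g * ρ.character g := by
  obtain ⟨c, hc⟩ := eq_smul_id_of_commutes ρ h (∑ g, f g • ρ g) (fun x => by
    simp only [← Module.End.mul_eq_comp, Finset.sum_mul, Finset.mul_sum, smul_mul_assoc,
      mul_smul_comm, ← map_mul]
    refine Fintype.sum_equiv (MulAut.conj x⁻¹).toEquiv _ _ fun g => ?_
    simp only [MulEquiv.toEquiv_eq_coe, EquivLike.coe_coe, MulAut.conj_apply]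
    rw [hf]
    congr 2
    group)
  refine ⟨c, hc, ?_⟩
  have := congrArg (LinearMap.trace ℂ V) hc
  simp only [map_sum, map_smul, smul_eq_mul, LinearMap.trace_id] at this
  rw [Representation.char_one, ← this]
  rfl

/-- Irreducible characters are complete among class functions. -/
theorem eq_zero_of_sum_mul_Irr {H : Type} [Group H] [Fintype H] (f : H → ℂ)
    (hf : ∀ g x, f (x * g * x⁻¹) = f g) (h0 : ∀ χ ∈ Irr H, ∑ g, f g * χ g = 0) : f = 0 := by
  let z : MonoidAlgebra ℂ H := ∑ g, f g • MonoidAlgebra.of ℂ H g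
  have hz : ∀ a : MonoidAlgebra ℂ H, z * a = 0 := by
    intro a
    have ha : a ∈ sSup {S : Submodule (MonoidAlgebra ℂ H) (MonoidAlgebra ℂ H) |
        IsSimpleModule (MonoidAlgebra ℂ H) S} := by
      rw [IsSemisimpleModule.sSup_simples_eq_top (MonoidAlgebra ℂ H) (MonoidAlgebra ℂ H)]
      trivial
    rw [sSup_eq_iSup'] at ha
    refine Submodule.iSup_induction _ (motive := fun a => z * a = 0) ha ?_ (mul_zero _)
      fun a b ha hb => by rw [mul_add, ha, hb, add_zero]
    rintro ⟨S, hS⟩ s hs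
    have hS' : IsSimpleModule (MonoidAlgebra ℂ H) S := hS
    let ρ : Representation ℂ H S := Representation.ofModule' S
    have hfin : FiniteDimensional ℂ S := Module.Finite.trans (MonoidAlgebra ℂ H) S
    have hrank : finrank ℂ (IntertwiningMap ρ ρ) = 1 := by
      have hnt := IsSimpleModule.nontrivial (MonoidAlgebra ℂ H) S
      refine finrank_eq_one (IntertwiningMap.id ρ) (fun h0 => ?_) fun T => ?_
      · obtain ⟨v, hv⟩ := exists_ne (0 : S)
        exact hv (congrArg (fun f : IntertwiningMap ρ ρ => f v) h0)
      · obtain ⟨c, hc⟩ := (IsSimpleModule.algebraMap_end_bijective_of_isAlgClosed ℂ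
          (A := MonoidAlgebra ℂ H) (V := S)).2
          (MonoidAlgebra.equivariantOfLinearOfComm T.toLinearMap fun g v =>
            LinearMap.congr_fun (T.isIntertwining' g) v)
        refine ⟨c, IntertwiningMap.ext (LinearMap.ext fun v => ?_)⟩
        exact LinearMap.congr_fun hc v
    obtain ⟨c, hc, hc1⟩ := exists_sum_smul_eq_smul_id ρ hrank f hf
    have hmem := character_mem_Irr ρ hrank
    rw [h0 _ hmem] at hc1
    rw [(mul_eq_zero.1 hc1).resolve_right (Irr_one_ne_zero hmem), zero_smul] at hc
    have hzs : z • (⟨s, hs⟩ : S) = 0 := by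
      have := LinearMap.congr_fun hc ⟨s, hs⟩
      rw [LinearMap.zero_apply, LinearMap.sum_apply] at this
      simp only [z, Finset.sum_smul, smul_assoc]
      exact this
    exact congrArg Subtype.val hzs
  have hz1 : z = 0 := by rw [← mul_one z, hz]
  funext g
  have := congrArg (fun a : (MonoidAlgebra ℂ H) => a.coeff g) hz1
  simpa [z, MonoidAlgebra.of_apply, MonoidAlgebra.coeff_sum, Finsupp.single_apply] using this

/-- The inner product of class functions as a linear map in its first argument. -/
noncomputable def cInnerLeft {H : Type} [Group H] [Finite H] (β : H → ℂ) : (H → ℂ) →ₗ[ℂ] ℂ where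
  toFun α := cInner H α β
  map_add' α α' := by
    have := Fintype.ofFinite H
    simp only [cInner_eq_sum, Pi.add_apply, add_mul, Finset.sum_add_distrib, mul_add]
  map_smul' c α := by
    have := Fintype.ofFinite H
    simp only [cInner_eq_sum, Pi.smul_apply, smul_eq_mul, mul_assoc, ← Finset.mul_sum,
      RingHom.id_apply]
    ring

theorem cInnerLeft_apply {H : Type} [Group H] [Finite H] (α β : H → ℂ) :
    cInnerLeft β α = cInner H α β := rfl

theorem conj_cInner {H : Type} [Group H] [Finite H] (α β : H → ℂ) :
    (starRingEnd ℂ) (cInner H α β) = cInner H β α := by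
  have := Fintype.ofFinite H
  simp only [cInner_eq_sum, map_mul, map_inv₀, map_natCast, map_sum, Complex.conj_conj, mul_comm]

theorem cInner_ne_zero_comm {H : Type} [Group H] [Finite H] {α β : H → ℂ} :
    cInner H α β ≠ 0 ↔ cInner H β α ≠ 0 := by
  rw [← conj_cInner, map_ne_zero]

theorem eq_of_cInner_Irr_eq {H : Type} [Group H] [Finite H] {f f' : H → ℂ}
    (hf : ∀ g x, f (x * g * x⁻¹) = f g) (hf' : ∀ g x, f' (x * g * x⁻¹) = f' g)
    (h : ∀ χ ∈ Irr H, cInner H f χ = cInner H f' χ) : f = f' := by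
  have := Fintype.ofFinite H
  have key : (fun g : H => (f - f') g⁻¹) = 0 := by
    refine eq_zero_of_sum_mul_Irr _ (fun g x => ?_) fun χ hχ => ?_
    · have : (x * g * x⁻¹)⁻¹ = x * g⁻¹ * x⁻¹ := by group
      simp only [this, Pi.sub_apply, hf, hf']
    · have h1 := sub_eq_zero.2 (h χ hχ)
      rw [← cInnerLeft_apply, ← cInnerLeft_apply, ← map_sub, cInnerLeft_apply, cInner_eq_sum] at h1
      rw [← (mul_eq_zero.1 h1).resolve_left (inv_ne_zero (NeZero.ne _))]
      refine Fintype.sum_equiv (Equiv.inv H) _ _ fun g => ?_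
      rw [Equiv.inv_apply, ← Irr_inv hχ, inv_inv]
  rw [← sub_eq_zero]
  funext g
  simpa using congrFun key g⁻¹

theorem linearIndependent_Irr (H : Type) [Group H] [Finite H] :
    LinearIndependent ℂ (Subtype.val : Irr H → H → ℂ) := by
  rw [linearIndependent_iff']
  intro s c hc i hi
  have := congrArg (cInnerLeft i.1) hc
  rw [map_sum, map_zero, Finset.sum_eq_single i] at this
  · simpa [cInnerLeft_apply, cInner_Irr i.2 i.2] using this
  · intro j _ hj
    simp [cInnerLeft_apply, cInner_Irr j.2 i.2, Subtype.coe_injective.ne hj]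
  · exact fun h => (h hi).elim

theorem finite_Irr (H : Type) [Group H] [Finite H] : (Irr H).Finite :=
  (linearIndependent_Irr H).setFinite

theorem sigmaChar_eq_sum {H : Type} [Group H] [Finite H] {X : Set (H → ℂ)} (hX : X ⊆ Irr H) :
    sigmaChar X = ∑ ψ ∈ ((finite_Irr H).subset hX).toFinset, ψ 1 • ψ := by
  funext g
  rw [sigmaChar, finsum_mem_eq_finite_toFinset_sum _ ((finite_Irr H).subset hX)]
  simp

theorem cInner_sigmaChar {H : Type} [Group H] [Finite H] {X : Set (H → ℂ)} (hX : X ⊆ Irr H)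
    {χ : H → ℂ} (hχ : χ ∈ Irr H) :
    cInner H (sigmaChar X) χ = if χ ∈ X then χ 1 else 0 := by
  rw [sigmaChar_eq_sum hX, ← cInnerLeft_apply, map_sum]
  have : ∀ ψ ∈ ((finite_Irr H).subset hX).toFinset, cInnerLeft χ (ψ 1 • ψ) =
      if ψ = χ then χ 1 else 0 := by
    intro ψ hψ
    rw [map_smul, cInnerLeft_apply, cInner_Irr (hX (by simpa using hψ)) hχ]
    split_ifs with h <;> simp [h]
  rw [Finset.sum_congr rfl this, Finset.sum_ite_eq']
  simp

theorem sigmaChar_conj {H : Type} [Group H] [Finite H] {X : Set (H → ℂ)} (hX : X ⊆ Irr H)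
    (g x : H) : sigmaChar X (x * g * x⁻¹) = sigmaChar X g := by
  rw [sigmaChar_eq_sum hX]
  simp only [Finset.sum_apply, Pi.smul_apply]
  refine Finset.sum_congr rfl fun ψ hψ => ?_
  rw [Irr_conj (hX (by simpa using hψ) : ψ ∈ Irr H)]

theorem sigmaChar_one_ne_zero {H : Type} [Group H] [Finite H] {X : Set (H → ℂ)} (hX : X ⊆ Irr H)
    (hne : X.Nonempty) : sigmaChar X 1 ≠ 0 := by
  obtain ⟨χ₀, h₀⟩ := hne
  have hpos : ∀ χ ∈ Irr H, ∃ n : ℕ, χ 1 = n := by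
    rintro χ ⟨V, -, rfl⟩
    exact ⟨_, FDRep.char_one V⟩
  choose! d hd using hpos
  rw [sigmaChar_eq_sum hX, Finset.sum_apply]
  have : ∀ ψ ∈ ((finite_Irr H).subset hX).toFinset, (ψ 1 • ψ) 1 = ((d ψ * d ψ : ℕ) : ℂ) := by
    intro ψ hψ
    simp [hd ψ (hX (by simpa using hψ))]
  rw [Finset.sum_congr rfl this, ← Nat.cast_sum, Nat.cast_ne_zero]
  intro h0
  have h1 := (Finset.sum_eq_zero_iff.1 h0) χ₀ (by simpa using h₀)
  have h2 := Irr_one_ne_zero (hX h₀)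
  rw [hd _ (hX h₀), Nat.cast_ne_zero] at h2
  exact h2 (mul_self_eq_zero.1 h1)

end CharacterTheory

section Partitions

open Module

theorem IsPartitionOf.eq_of_mem {α : Type*} {S : Set α} {P : Set (Set α)} (h : IsPartitionOf S P)
    {p q : Set α} (hp : p ∈ P) (hq : q ∈ P) {a : α} (hap : a ∈ p) (haq : a ∈ q) : p = q :=
  (h.2.2 a (h.2.1 p hp hap)).unique ⟨hp, hap⟩ ⟨hq, haq⟩

theorem IsPartitionOf.exists_mem {α : Type*} {S : Set α} {P : Set (Set α)} (h : IsPartitionOf S P)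
    {a : α} (ha : a ∈ S) : ∃ p ∈ P, a ∈ p :=
  (h.2.2 a ha).exists

theorem IsPartitionOf.nonempty {α : Type*} {S : Set α} {P : Set (Set α)} (h : IsPartitionOf S P)
    {p : Set α} (hp : p ∈ P) : p.Nonempty :=
  Set.nonempty_iff_ne_empty.2 fun h0 => h.1 (h0 ▸ hp)

/-- Two partitions of the same set agree as soon as each refines the other. -/
theorem IsPartitionOf.eq_of_partLE {α : Type*} {S : Set α} {P Q : Set (Set α)}
    (hP : IsPartitionOf S P) (hQ : IsPartitionOf S Q) (h : PartLE P Q) (h' : PartLE Q P) :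
    P = Q := by
  have key : ∀ {P Q : Set (Set α)}, IsPartitionOf S P → PartLE P Q → PartLE Q P → P ⊆ Q := by
    intro P Q hP h h' p hp
    obtain ⟨q, hq, hpq⟩ := h p hp
    obtain ⟨p', hp', hqp⟩ := h' q hq
    obtain ⟨a, ha⟩ := hP.nonempty hp
    obtain rfl := hP.eq_of_mem hp hp' ha (hqp (hpq ha))
    rwa [hpq.antisymm hqp]
  exact (key hP h h').antisymm (key hQ h' h)

/-- The functions that are constant on every part of `P`. -/
def constOn {H : Type} (P : Set (Set H)) : Submodule ℂ (H → ℂ) where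
  carrier := {f | ∀ K ∈ P, ∀ g ∈ K, ∀ h ∈ K, f g = f h}
  zero_mem' _ _ _ _ _ _ := rfl
  add_mem' ha hb K hK g hg h hh := by
    rw [Pi.add_apply, Pi.add_apply, ha K hK g hg h hh, hb K hK g hg h hh]
  smul_mem' c f hf K hK g hg h hh := by
    rw [Pi.smul_apply, Pi.smul_apply, hf K hK g hg h hh]

theorem finrank_constOn {H : Type} [Finite H] {P : Set (Set H)} (hP : IsPartitionOf Set.univ P) :
    finrank ℂ (constOn P) = P.ncard := by
  have := Fintype.ofFinite P
  choose part hpart hmem using fun g : H => hP.exists_mem (Set.mem_univ g)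
  let π : H → P := fun g => ⟨part g, hpart g⟩
  have hπ : ∀ K : P, ∀ g ∈ K.1, π g = K := fun K g hg =>
    Subtype.ext (hP.eq_of_mem (hpart g) K.2 (hmem g) hg)
  have hsurj : Function.Surjective π := fun K => by
    obtain ⟨g, hg⟩ := hP.nonempty K.2
    exact ⟨g, hπ K g hg⟩
  have hr : constOn P = LinearMap.range (LinearMap.funLeft ℂ ℂ π) := by
    refine le_antisymm (fun f hf => ?_) ?_
    · refine ⟨fun K => f (hP.nonempty K.2).choose, funext fun g => ?_⟩
      exact hf _ (hpart g) _ (hP.nonempty (hpart g)).choose_spec _ (hmem g)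
    · rintro _ ⟨c, rfl⟩ K hK g hg h hh
      rw [LinearMap.funLeft_apply, LinearMap.funLeft_apply, hπ ⟨K, hK⟩ g hg, hπ ⟨K, hK⟩ h hh]
  rw [hr, LinearMap.finrank_range_of_inj (LinearMap.funLeft_injective_of_surjective ℂ ℂ π hsurj),
    finrank_fintype_fun_eq_card, ← Nat.card_eq_fintype_card, Nat.card_coe_set_eq]

/-- `D` is a family of disjoint nonempty sets of irreducible characters. -/
structure IsIrrFamily {H : Type} [Group H] (D : Set (Set (H → ℂ))) : Prop where
  subset : ∀ X ∈ D, X ⊆ Irr H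
  nonempty : ∀ X ∈ D, X.Nonempty
  eq_of_mem : ∀ X ∈ D, ∀ Y ∈ D, ∀ χ, χ ∈ X → χ ∈ Y → X = Y

theorem IsPartitionOf.isIrrFamily {H : Type} [Group H] {D D' : Set (Set (H → ℂ))}
    (h : IsPartitionOf (Irr H) D) (hD : D' ⊆ D) : IsIrrFamily D' where
  subset X hX := h.2.1 X (hD hX)
  nonempty _ hX := h.nonempty (hD hX)
  eq_of_mem _ hX _ hY _ := h.eq_of_mem (hD hX) (hD hY)

theorem IsIrrFamily.finite {H : Type} [Group H] [Finite H] {D : Set (Set (H → ℂ))}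
    (hD : IsIrrFamily D) : D.Finite :=
  (finite_Irr H).finite_subsets.subset hD.subset

theorem IsIrrFamily.finrank_span {H : Type} [Group H] [Finite H] {D : Set (Set (H → ℂ))}
    (hD : IsIrrFamily D) : finrank ℂ (Submodule.span ℂ (sigmaChar '' D)) = D.ncard := by
  have := hD.finite.to_subtype
  have := Fintype.ofFinite D
  have hli : LinearIndependent ℂ (fun X : D => sigmaChar X.1) := by
    rw [linearIndependent_iff']
    intro s c hc X hX
    obtain ⟨χ, hχ⟩ := hD.nonempty X X.2
    have hχI := hD.subset X X.2 hχ
    have := congrArg (cInnerLeft χ) hc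
    rw [map_sum, map_zero, Finset.sum_eq_single X] at this
    · rw [map_smul, cInnerLeft_apply, cInner_sigmaChar (hD.subset X X.2) hχI, if_pos hχ] at this
      exact (smul_eq_zero.1 this).resolve_right (Irr_one_ne_zero hχI)
    · intro Y _ hY
      rw [map_smul, cInnerLeft_apply, cInner_sigmaChar (hD.subset Y Y.2) hχI, if_neg, smul_zero]
      exact fun h => hY (Subtype.ext (hD.eq_of_mem Y Y.2 X X.2 χ h hχ))
    · exact fun h => (h hX).elim
  have h1 := finrank_span_eq_card hli
  rw [← Nat.card_eq_fintype_card, Nat.card_coe_set_eq] at h1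
  rw [← h1, Set.image_eq_range]

theorem IsIrrFamily.conj_of_mem_span {H : Type} [Group H] [Finite H] {D : Set (Set (H → ℂ))}
    (hD : IsIrrFamily D) {f : H → ℂ} (hf : f ∈ Submodule.span ℂ (sigmaChar '' D)) (g x : H) :
    f (x * g * x⁻¹) = f g := by
  induction hf using Submodule.span_induction with
  | mem f hf =>
    obtain ⟨X, hX, rfl⟩ := hf
    exact sigmaChar_conj (hD.subset X hX) g x
  | zero => rfl
  | add a b _ _ ha hb => rw [Pi.add_apply, Pi.add_apply, ha, hb]
  | smul c a _ ha => rw [Pi.smul_apply, Pi.smul_apply, ha]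

theorem IsIrrFamily.cInner_of_mem_span {H : Type} [Group H] [Finite H] {D : Set (Set (H → ℂ))}
    (hD : IsIrrFamily D) {f : H → ℂ} (hf : f ∈ Submodule.span ℂ (sigmaChar '' D))
    {X : Set (H → ℂ)} (hX : X ∈ D) {χ χ' : H → ℂ} (hχ : χ ∈ X) (hχ' : χ' ∈ X) :
    χ' 1 * cInner H f χ = χ 1 * cInner H f χ' := by
  induction hf using Submodule.span_induction with
  | mem f hf =>
    obtain ⟨Y, hY, rfl⟩ := hf
    have hiff : χ ∈ Y ↔ χ' ∈ Y := by
      constructor <;> intro h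
      · rwa [← hD.eq_of_mem X hX Y hY _ hχ h]
      · rwa [← hD.eq_of_mem X hX Y hY _ hχ' h]
    rw [cInner_sigmaChar (hD.subset Y hY) (hD.subset X hX hχ),
      cInner_sigmaChar (hD.subset Y hY) (hD.subset X hX hχ')]
    simp only [hiff]
    split_ifs <;> ring
  | zero => rw [← cInnerLeft_apply, ← cInnerLeft_apply, map_zero, map_zero]; ring
  | add a b _ _ ha hb =>
    rw [← cInnerLeft_apply, ← cInnerLeft_apply, map_add, map_add, mul_add, mul_add]
    exact congrArg₂ _ ha hb
  | smul c a _ ha =>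
    rw [← cInnerLeft_apply, ← cInnerLeft_apply, map_smul, map_smul, smul_eq_mul, smul_eq_mul,
      mul_left_comm, mul_left_comm (χ 1)]
    exact congrArg _ ha

theorem IsIrrFamily.mem_span {H : Type} [Group H] [Finite H] {D : Set (Set (H → ℂ))}
    (hD : IsIrrFamily D) {f : H → ℂ} (hf : ∀ g x, f (x * g * x⁻¹) = f g)
    (h : ∀ X ∈ D, ∀ χ ∈ X, ∀ χ' ∈ X, χ' 1 * cInner H f χ = χ 1 * cInner H f χ')
    (h0 : ∀ χ ∈ Irr H, χ ∉ ⋃₀ D → cInner H f χ = 0) :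
    f ∈ Submodule.span ℂ (sigmaChar '' D) := by
  choose! r hr using hD.nonempty
  let F : H → ℂ := ∑ X ∈ hD.finite.toFinset, (cInner H f (r X) / r X 1) • sigmaChar X
  have hF : F ∈ Submodule.span ℂ (sigmaChar '' D) :=
    Submodule.sum_mem _ fun X hX => Submodule.smul_mem _ _
      (Submodule.subset_span ⟨X, by simpa using hX, rfl⟩)
  rw [eq_of_cInner_Irr_eq hf (hD.conj_of_mem_span hF) ?_]
  · exact hF
  intro χ hχ
  rw [← cInnerLeft_apply F, map_sum]
  have hterm : ∀ X ∈ D, cInnerLeft χ ((cInner H f (r X) / r X 1) • sigmaChar X) =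
      if χ ∈ X then cInner H f χ else 0 := by
    intro X hX
    rw [map_smul, cInnerLeft_apply, cInner_sigmaChar (hD.subset X hX) hχ]
    split_ifs with hχX
    · have := h X hX χ hχX (r X) (hr X hX)
      have h1 := Irr_one_ne_zero (hD.subset X hX (hr X hX))
      rw [smul_eq_mul]
      field_simp
      rw [mul_comm, ← this]
    · simp
  by_cases hχD : χ ∈ ⋃₀ D
  · obtain ⟨X, hX, hχX⟩ := hχD
    rw [Finset.sum_eq_single X, hterm X hX, if_pos hχX]
    · intro Y hY hne
      rw [hterm Y (by simpa using hY), if_neg]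
      exact fun h => hne (hD.eq_of_mem Y (by simpa using hY) X hX χ h hχX)
    · exact fun h => (h (by simpa using hX)).elim
  · rw [h0 χ hχ hχD, Finset.sum_eq_zero]
    intro Y hY
    rw [hterm Y (by simpa using hY), if_neg]
    exact fun h => hχD ⟨Y, by simpa using hY, h⟩

theorem IsSCT.constOn_eq_span {H : Type} [Group H] [Finite H] {𝒳 : Set (Set (H → ℂ))}
    {𝒦 : Set (Set H)} (h : IsSCT H 𝒳 𝒦) :
    constOn 𝒦 = Submodule.span ℂ (sigmaChar '' 𝒳) := by
  have hD := h.1.isIrrFamily le_rfl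
  refine (Submodule.eq_of_le_of_finrank_eq ?_ ?_).symm
  · rw [Submodule.span_le]
    rintro _ ⟨X, hX, rfl⟩
    exact fun K hK => h.2.2.2.2 X hX K hK
  · rw [hD.finrank_span, finrank_constOn h.2.1, h.2.2.1]

/-- The partition of the irreducible characters is determined by the superclasses. -/
theorem IsSCT.characters_unique {H : Type} [Group H] [Finite H] {𝒳 𝒳' : Set (Set (H → ℂ))}
    {𝒦 : Set (Set H)} (h : IsSCT H 𝒳 𝒦) (h' : IsSCT H 𝒳' 𝒦) : 𝒳 = 𝒳' := by
  have key : ∀ {𝒳 𝒳' : Set (Set (H → ℂ))}, IsSCT H 𝒳 𝒦 → IsSCT H 𝒳' 𝒦 → PartLE 𝒳 𝒳' := by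
    intro 𝒳 𝒳' h h' X hX
    obtain ⟨χ, hχ⟩ := h.1.nonempty hX
    have hχI := h.1.2.1 X hX hχ
    obtain ⟨X', hX', hχX'⟩ := h'.1.exists_mem hχI
    refine ⟨X', hX', fun χ' hχ' => ?_⟩
    have hχI' := h.1.2.1 X hX hχ'
    have hmem : sigmaChar X' ∈ Submodule.span ℂ (sigmaChar '' 𝒳) := by
      rw [← h.constOn_eq_span, h'.constOn_eq_span]
      exact Submodule.subset_span ⟨X', hX', rfl⟩
    have := (h.1.isIrrFamily le_rfl).cInner_of_mem_span hmem hX hχ hχ'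
    rw [cInner_sigmaChar (h'.1.2.1 X' hX') hχI, cInner_sigmaChar (h'.1.2.1 X' hX') hχI',
      if_pos hχX'] at this
    by_contra hn
    rw [if_neg hn, mul_zero] at this
    exact mul_ne_zero (Irr_one_ne_zero hχI') (Irr_one_ne_zero hχI) this
  exact h.1.eq_of_partLE h'.1 (key h h') (key h' h)

end Partitions

section NormalSubgroups

open Module Representation

theorem cInner_comp {H Q : Type} [Group H] [Finite H] [Group Q] [Finite Q] (π : H →* Q)
    (hπ : Function.Surjective π) (α β : Q → ℂ) :
    cInner H (α ∘ π) (β ∘ π) = cInner Q α β := by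
  have := Fintype.ofFinite H
  have := Fintype.ofFinite Q
  obtain ⟨k, hk⟩ : ∃ k : ℕ, ∀ q : Q, (Finset.univ.filter fun h => π h = q).card = k :=
    ⟨_, fun q => MonoidHom.card_fiber_eq_of_mem_range π (hπ q) (hπ 1)⟩
  have hsum : ∀ F : Q → ℂ, ∑ h, F (π h) = k * ∑ q, F q := by
    intro F
    rw [← Finset.sum_fiberwise' Finset.univ π F, Finset.mul_sum]
    simp [hk]
  have hcard : (Nat.card H : ℂ) = k * Nat.card Q := by
    simpa [Nat.card_eq_fintype_card] using hsum fun _ => 1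
  have hk0 : (k : ℂ) ≠ 0 := fun h0 => by
    rw [h0, zero_mul] at hcard
    exact NeZero.ne _ hcard
  rw [cInner_eq_sum, cInner_eq_sum, hcard]
  have := hsum fun q => α q * (starRingEnd ℂ) (β q)
  simp only [Function.comp_apply, this]
  field_simp

theorem comp_mem_Irr {H Q : Type} [Group H] [Finite H] [Group Q] [Finite Q] (π : H →* Q)
    (hπ : Function.Surjective π) {η : Q → ℂ} (hη : η ∈ Irr Q) : η ∘ π ∈ Irr H := by
  have h1 := cInner_Irr hη hη
  obtain ⟨V, -, rfl⟩ := hη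
  let ρ : Representation ℂ H V := MonoidHom.comp V.ρ π
  have hρ : ρ.character = V.character ∘ π := rfl
  rw [← hρ]
  refine character_mem_Irr ρ ?_
  rw [← Nat.cast_inj (R := ℂ), ← cInner_character, hρ, cInner_comp π hπ, h1]
  simp

/-- On an irreducible representation a normal subgroup either acts trivially or has zero
average. -/
theorem normal_acts_trivially_or_sum_eq_zero {H : Type} [Group H] [Finite H] (N : Subgroup H)
    [N.Normal] [Fintype N] (V : FDRep ℂ H) (hV : finrank ℂ (IntertwiningMap V.ρ V.ρ) = 1) :
    (∀ n ∈ N, V.ρ n = 1) ∨ ∀ m : H, ∑ n : N, Representation.character V.ρ (m * n) = 0 := by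
  obtain ⟨c, hc⟩ := eq_smul_id_of_commutes V.ρ hV (∑ n : N, V.ρ n) (fun x => by
    simp only [← Module.End.mul_eq_comp, Finset.sum_mul, Finset.mul_sum, ← map_mul]
    refine Fintype.sum_equiv (MulAut.conjNormal x⁻¹ : MulAut N).toEquiv _ _ fun n => ?_
    simp only [MulEquiv.toEquiv_eq_coe, EquivLike.coe_coe, MulAut.conjNormal_apply]
    congr 1
    group)
  by_cases h0 : c = 0
  · right
    intro m
    have h1 : ∑ n : N, V.ρ (m * n) = 0 := by
      simp only [map_mul, ← Finset.mul_sum, hc, h0, zero_smul, mul_zero]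
    have := congrArg (LinearMap.trace ℂ V) h1
    rwa [map_sum, map_zero] at this
  · left
    intro n hn
    have h1 : V.ρ n * ∑ n : N, V.ρ n = ∑ n : N, V.ρ n := by
      simp only [Finset.mul_sum, ← map_mul]
      exact Fintype.sum_equiv (Equiv.mulLeft (⟨n, hn⟩ : N)) _ _ fun k => rfl
    rw [hc, mul_smul_comm] at h1
    have h2 := smul_right_injective _ h0 h1
    exact h2

theorem exists_rep_of_mem_IrrOver {H : Type} [Group H] [Finite H] {N : Subgroup H} [N.Normal]
    {χ : H → ℂ} (hχ : χ ∈ IrrOver N) :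
    ∃ V : FDRep ℂ H, Representation.character V.ρ = χ ∧ ∀ n ∈ N, V.ρ n = 1 := by
  have := Fintype.ofFinite N
  obtain ⟨V, hV, rfl⟩ := mem_Irr_iff.1 hχ.1
  refine ⟨V, rfl, (normal_acts_trivially_or_sum_eq_zero N V hV).resolve_right fun h => ?_⟩
  have h1 := h 1
  simp only [one_mul] at h1
  rw [Finset.sum_congr rfl fun n _ => hχ.2 n.1 n.2, Finset.sum_const, nsmul_eq_mul] at h1
  refine (mul_ne_zero ?_ (Irr_one_ne_zero hχ.1)) h1
  simp [Finset.card_univ, Fintype.card_ne_zero]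

theorem mul_right_of_mem_IrrOver {H : Type} [Group H] [Finite H] {N : Subgroup H} [N.Normal]
    {χ : H → ℂ} (hχ : χ ∈ IrrOver N) (m : H) {n : H} (hn : n ∈ N) : χ (m * n) = χ m := by
  obtain ⟨V, rfl, h⟩ := exists_rep_of_mem_IrrOver hχ
  rw [Representation.character, map_mul, h n hn, mul_one]
  rfl

theorem sum_coset_eq_zero {H : Type} [Group H] [Finite H] {N : Subgroup H} [N.Normal] [Fintype N]
    {χ : H → ℂ} (hχ : χ ∈ Irr H) (hχN : χ ∉ IrrOver N) (m : H) : ∑ n : N, χ (m * n) = 0 := by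
  have hχ' := hχ
  obtain ⟨V, hV, rfl⟩ := mem_Irr_iff.1 hχ
  refine (normal_acts_trivially_or_sum_eq_zero N V hV).resolve_left (fun h => hχN ⟨hχ', ?_⟩) m
  intro n hn
  rw [Representation.character, Representation.character, h n hn, V.ρ.map_one]

theorem cInner_eq_zero_of_sum_coset {H : Type} [Group H] [Finite H] (N : Subgroup H) [Fintype N]
    {f F : H → ℂ} (hf : ∀ m, ∀ n ∈ N, f (m * n) = f m) (hF : ∀ m, ∑ n : N, F (m * n) = 0) :
    cInner H f F = 0 := by
  have := Fintype.ofFinite H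
  have h1 : ∀ n : N, ∑ m, f m * (starRingEnd ℂ) (F m) =
      ∑ m, f m * (starRingEnd ℂ) (F (m * n)) := fun n => by
    rw [← Equiv.sum_comp (Equiv.mulRight (n : H))]
    simp [hf _ n n.2]
  have h2 : ∑ n : N, ∑ m, f m * (starRingEnd ℂ) (F m) = 0 := by
    rw [Finset.sum_congr rfl fun n _ => h1 n, Finset.sum_comm]
    simp only [← Finset.mul_sum, ← map_sum, hF, map_zero, mul_zero, Finset.sum_const_zero]
  rw [Finset.sum_const, smul_eq_zero] at h2
  rw [cInner_eq_sum, h2.resolve_left (by simp [Finset.card_univ, Fintype.card_ne_zero]), mul_zero]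

theorem mem_IrrOver_of_cInner_ne_zero {H : Type} [Group H] [Finite H] {N : Subgroup H} [N.Normal]
    {f χ : H → ℂ} (hf : ∀ m, ∀ n ∈ N, f (m * n) = f m) (hχ : χ ∈ Irr H)
    (h : cInner H f χ ≠ 0) : χ ∈ IrrOver N := by
  have := Fintype.ofFinite N
  by_contra hn
  exact h (cInner_eq_zero_of_sum_coset N hf (sum_coset_eq_zero hχ hn))

theorem exists_factor_of_surjective {H Q A : Type} [Group H] [Group Q] [Monoid A] (π : H →* Q)
    (hπ : Function.Surjective π) (ρ : H →* A) (hρ : ∀ h, π h = 1 → ρ h = 1) :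
    ∃ σ : Q →* A, ∀ h, σ (π h) = ρ h := by
  have hwell : ∀ x y, π x = π y → ρ x = ρ y := fun x y hxy => by
    rw [← mul_inv_cancel_left y x, map_mul, hρ (y⁻¹ * x) (by simp [hxy]), mul_one]
  have hinv : ∀ h, ρ (Function.surjInv hπ (π h)) = ρ h := fun h =>
    hwell _ _ (Function.surjInv_eq hπ _)
  refine ⟨⟨⟨fun q => ρ (Function.surjInv hπ q), ?_⟩, fun p q => ?_⟩, hinv⟩
  · exact hρ _ (Function.surjInv_eq hπ _)
  · rw [← map_mul]
    exact hwell _ _ (by simp [Function.surjInv_eq hπ])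

/-- Irreducible characters with the kernel of `π` in their kernel are those inflated along `π`. -/
theorem IrrOver_eq_image {H Q : Type} [Group H] [Finite H] [Group Q] [Finite Q] (π : H →* Q)
    (hπ : Function.Surjective π) {N : Subgroup H} [N.Normal] (hN : ∀ h, π h = 1 ↔ h ∈ N) :
    IrrOver N = (fun η : Q → ℂ => η ∘ π) '' Irr Q := by
  ext χ
  constructor
  · intro hχ
    have h1 := cInner_Irr hχ.1 hχ.1
    obtain ⟨V, rfl, hV⟩ := exists_rep_of_mem_IrrOver hχ
    obtain ⟨σ, hσ⟩ : ∃ σ : Representation ℂ Q V, ∀ h, σ (π h) = V.ρ h :=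
      exists_factor_of_surjective π hπ V.ρ fun n hn => hV n ((hN n).1 hn)
    have hc : Representation.character V.ρ = σ.character ∘ π := funext fun h => by
      rw [Function.comp_apply, Representation.character, Representation.character, hσ]
    refine ⟨σ.character, character_mem_Irr σ ?_, hc.symm⟩
    rw [← Nat.cast_inj (R := ℂ), ← cInner_character, ← cInner_comp π hπ, ← hc, h1]
    simp
  · rintro ⟨η, hη, rfl⟩
    refine ⟨comp_mem_Irr π hπ hη, fun n hn => ?_⟩
    change η (π n) = η (π 1)
    rw [(hN n).2 hn, map_one]

/-- If `σ_X` is invariant under conjugation by `G`, then an irreducible character of `G` lying over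
one member of `X` has all its constituents in `X`. -/
theorem mem_of_common_irrOverChar {G : Type} [Group G] [Finite G] {M : Subgroup G} [hM : M.Normal]
    {X : Set (M → ℂ)} (hX : X ⊆ Irr M)
    (hinv : ∀ (g : G) (m : M), sigmaChar X (conjSub hM g m) = sigmaChar X m)
    {χ : G → ℂ} {ψ ψ' : M → ℂ} (hψI : ψ ∈ Irr M) (hψI' : ψ' ∈ Irr M)
    (hψ : χ ∈ irrOverChar M ψ) (hψ' : χ ∈ irrOverChar M ψ') (hψX : ψ ∈ X) : ψ' ∈ X := by
  have := Fintype.ofFinite M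
  obtain ⟨V, hV, rfl⟩ := mem_Irr_iff.1 hψ.1
  let ρ : Representation ℂ M V := MonoidHom.comp V.ρ M.subtype
  let f : M → ℂ := fun m => (starRingEnd ℂ) (sigmaChar X m)
  obtain ⟨c, hc⟩ := eq_smul_id_of_commutes V.ρ hV (∑ m, f m • ρ m) (fun x => by
    simp only [← Module.End.mul_eq_comp, Finset.sum_mul, Finset.mul_sum, smul_mul_assoc,
      mul_smul_comm]
    refine Fintype.sum_equiv (MulAut.conjNormal x⁻¹ : MulAut M).toEquiv _ _ fun m => ?_
    have h1 : f ((MulAut.conjNormal x⁻¹ : MulAut M) m) = f m :=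
      congrArg (starRingEnd ℂ) (hinv x⁻¹ m)
    simp only [MulEquiv.toEquiv_eq_coe, EquivLike.coe_coe]
    rw [h1]
    congr 1
    change V.ρ m * V.ρ x = V.ρ x * V.ρ ((MulAut.conjNormal x⁻¹ : MulAut M) m)
    rw [MulAut.conjNormal_apply, ← map_mul, ← map_mul]
    congr 1
    group)
  have key : ∀ φ ∈ Irr M, Representation.character V.ρ ∈ irrOverChar M φ →
      c = if φ ∈ X then (Nat.card M : ℂ) else 0 := by
    intro φ hφ hlies
    have hφ1 := Irr_one_ne_zero hφ
    have hsum : ∑ m, f m * φ m = (if φ ∈ X then (Nat.card M : ℂ) else 0) * φ 1 := by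
      have h1 := cInner_sigmaChar hX hφ
      rw [← conj_cInner, cInner_eq_sum, ← Complex.conj_conj (∑ m, f m * φ m)] at *
      have h2 : ∑ m, f m * φ m = ∑ m, φ m * (starRingEnd ℂ) (sigmaChar X m) :=
        Finset.sum_congr rfl fun m _ => mul_comm _ _
      have h3 := congrArg (starRingEnd ℂ) h1
      rw [Complex.conj_conj] at h3
      rw [Complex.conj_conj, h2]
      rw [inv_mul_eq_iff_eq_mul₀ (NeZero.ne _)] at h3
      rw [h3]
      split_ifs
      · rw [Irr_one_conj hφ]
      · simp
    have hne := hlies.2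
    obtain ⟨W, hW, rfl⟩ := mem_Irr_iff.1 hφ
    have hres : resChar M (Representation.character V.ρ) = ρ.character := rfl
    rw [hres, cInner_character, Nat.cast_ne_zero, ← Nat.pos_iff_ne_zero,
      finrank_pos_iff_exists_ne_zero] at hne
    obtain ⟨T, hT⟩ := hne
    obtain ⟨d, hd, hd1⟩ := exists_sum_smul_eq_smul_id W.ρ hW f fun g x =>
      congrArg (starRingEnd ℂ) (sigmaChar_conj hX g x)
    rw [hsum] at hd1
    rw [← mul_right_cancel₀ hφ1 hd1]
    obtain ⟨w, hw⟩ : ∃ w, T.toLinearMap w ≠ 0 := by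
      by_contra! h
      exact hT (IntertwiningMap.ext (LinearMap.ext h))
    have h1 := LinearMap.congr_fun hc (T.toLinearMap w)
    have h2 := congrArg T.toLinearMap (LinearMap.congr_fun hd w)
    simp only [LinearMap.sum_apply, LinearMap.smul_apply, LinearMap.id_apply, map_sum,
      map_smul] at h1 h2
    have h3 : ∀ m, T.toLinearMap (W.ρ m w) = ρ m (T.toLinearMap w) := fun m =>
      LinearMap.congr_fun (T.isIntertwining' m) w
    simp only [h3] at h2
    exact smul_left_injective ℂ hw (h1.symm.trans h2)
  have h1 := key ψ hψI hψ
  have h2 := key ψ' hψI' hψ'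
  by_contra hn
  rw [if_pos hψX] at h1
  rw [if_neg hn, h1] at h2
  exact NeZero.ne _ h2

theorem cInner_sigmaChar_resChar_eq_sum {G : Type} [Group G] [Finite G] (M : Subgroup G)
    {X : Set (M → ℂ)} (hX : X ⊆ Irr M) (χ : G → ℂ) :
    cInner M (sigmaChar X) (resChar M χ) =
      ∑ ψ ∈ (finite_Irr M).toFinset, if ψ ∈ X then ψ 1 * cInner M ψ (resChar M χ) else 0 := by
  rw [sigmaChar_eq_sum hX, ← cInnerLeft_apply, map_sum, ← Finset.sum_filter]
  refine Finset.sum_congr ?_ fun ψ _ => by rw [map_smul, cInnerLeft_apply, smul_eq_mul]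
  ext ψ
  simpa using fun h => hX h

/-- The regular character. -/
theorem sigmaChar_Irr (H : Type) [Group H] [Finite H] :
    sigmaChar (Irr H) = fun h => if h = 1 then (Nat.card H : ℂ) else 0 := by
  have := Fintype.ofFinite H
  refine eq_of_cInner_Irr_eq (sigmaChar_conj le_rfl) (fun g x => by simp) fun χ hχ => ?_
  rw [cInner_sigmaChar le_rfl hχ, if_pos hχ, cInner_eq_sum]
  simp only [ite_mul, zero_mul, Finset.sum_ite_eq', Finset.mem_univ, if_true]
  rw [Irr_one_conj hχ, inv_mul_cancel_left₀ (NeZero.ne _)]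

theorem cInner_sigmaChar_resChar {G : Type} [Group G] [Finite G] {M : Subgroup G} [hM : M.Normal]
    {X : Set (M → ℂ)} (hX : X ⊆ Irr M)
    (hinv : ∀ (g : G) (m : M), sigmaChar X (conjSub hM g m) = sigmaChar X m)
    {χ : G → ℂ} (hχ : χ ∈ Irr G) :
    cInner M (sigmaChar X) (resChar M χ) = if χ ∈ indSet M X then χ 1 else 0 := by
  have := Fintype.ofFinite M
  split_ifs with h
  · have hreg : cInner M (sigmaChar (Irr M)) (resChar M χ) = χ 1 := by
      rw [sigmaChar_Irr, cInner_eq_sum]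
      simp only [ite_mul, zero_mul, Finset.sum_ite_eq', Finset.mem_univ, if_true]
      rw [inv_mul_cancel_left₀ (NeZero.ne _)]
      exact Irr_one_conj (H := G) hχ
    rw [← hreg, cInner_sigmaChar_resChar_eq_sum M hX, cInner_sigmaChar_resChar_eq_sum M le_rfl]
    refine Finset.sum_congr rfl fun ψ hψ => ?_
    have hψI : ψ ∈ Irr M := by simpa using hψ
    rw [if_pos hψI]
    split_ifs with hψX
    · rfl
    · obtain ⟨φ, hφX, hφ⟩ := Set.mem_iUnion₂.1 h
      by_contra hne
      have h1 : cInner M ψ (resChar M χ) ≠ 0 := fun h0 => hne (by rw [h0, mul_zero])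
      exact hψX (mem_of_common_irrOverChar hX hinv (hX hφX) hψI hφ
        ⟨hχ, cInner_ne_zero_comm.1 h1⟩ hφX)
  · rw [cInner_sigmaChar_resChar_eq_sum M hX]
    refine Finset.sum_eq_zero fun ψ hψ => ?_
    split_ifs with hψX
    · by_contra hne
      have h1 : cInner M ψ (resChar M χ) ≠ 0 := fun h0 => hne (by rw [h0, mul_zero])
      exact h (Set.mem_iUnion₂.2 ⟨ψ, hψX, hχ, cInner_ne_zero_comm.1 h1⟩)
    · rfl

theorem cInner_zeroExtend {G : Type} [Group G] [Finite G] (M : Subgroup G) (f : M → ℂ)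
    (χ : G → ℂ) :
    (Nat.card G : ℂ) * cInner G (zeroExtend M f) χ = Nat.card M * cInner M f (resChar M χ) := by
  have := Fintype.ofFinite G
  have := Fintype.ofFinite M
  rw [cInner_eq_sum, cInner_eq_sum, mul_inv_cancel_left₀ (NeZero.ne _),
    mul_inv_cancel_left₀ (NeZero.ne _)]
  have h1 : ∀ g ∉ M, zeroExtend M f g * (starRingEnd ℂ) (χ g) = 0 := fun g hg => by
    rw [zeroExtend, dif_neg hg, zero_mul]
  rw [← Finset.sum_subset (Finset.subset_univ (Finset.univ.filter (· ∈ M)))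
    fun g _ hg => h1 g (by simpa using hg),
    Finset.sum_subtype (p := (· ∈ M)) _ (by simp)]
  refine Finset.sum_congr rfl fun m _ => ?_
  rw [zeroExtend, dif_pos m.2]
  rfl

/-- `σ_{X^G}` is the character induced from `σ_X`. -/
theorem sigmaChar_indSet {G : Type} [Group G] [Finite G] {M : Subgroup G} [hM : M.Normal]
    {X : Set (M → ℂ)} (hX : X ⊆ Irr M)
    (hinv : ∀ (g : G) (m : M), sigmaChar X (conjSub hM g m) = sigmaChar X m) :
    sigmaChar (indSet M X) = (M.index : ℂ) • zeroExtend M (sigmaChar X) := by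
  have hsub : indSet M X ⊆ Irr G := Set.iUnion₂_subset fun ψ _ χ hχ => hχ.1
  refine eq_of_cInner_Irr_eq (sigmaChar_conj hsub) (fun g x => ?_) fun χ hχ => ?_
  · rw [Pi.smul_apply, Pi.smul_apply]
    congr 1
    by_cases hg : g ∈ M
    · have hg' : x * g * x⁻¹ ∈ M := hM.conj_mem g hg x
      rw [zeroExtend, zeroExtend, dif_pos hg, dif_pos hg']
      exact hinv x ⟨g, hg⟩
    · have hg' : x * g * x⁻¹ ∉ M := fun h => hg (by
        have := hM.conj_mem _ h x⁻¹
        simpa [mul_assoc] using this)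
      rw [zeroExtend, zeroExtend, dif_neg hg, dif_neg hg']
  · rw [cInner_sigmaChar hsub hχ, ← cInner_sigmaChar_resChar hX hinv hχ, ← cInnerLeft_apply (_ • _),
      map_smul, cInnerLeft_apply, smul_eq_mul]
    have h1 := cInner_zeroExtend M (sigmaChar X) χ
    have h2 : (M.index : ℂ) * Nat.card M = Nat.card G := by exact_mod_cast M.index_mul_card
    rw [← h2, mul_comm (M.index : ℂ), mul_assoc] at h1
    exact (mul_left_cancel₀ (NeZero.ne _) h1).symm

end NormalSubgroups

section WedgeProduct

theorem CNormal.subset_of_mem {H : Type} [Group H] {𝒦 : Set (Set H)} {N : Subgroup H}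
    (hN : CNormal 𝒦 N) (h𝒦 : IsPartitionOf Set.univ 𝒦) {K : Set H} (hK : K ∈ 𝒦) {x : H}
    (hxK : x ∈ K) (hxN : x ∈ N) : K ⊆ N := by
  obtain ⟨T, hT, hNT⟩ := hN
  obtain ⟨K', hK', hx⟩ : x ∈ ⋃₀ T := hNT ▸ hxN
  rw [h𝒦.eq_of_mem hK (hT hK') hxK hx, hNT]
  exact Set.subset_sUnion_of_mem hK'

theorem sigmaChar_image_comp {H Q : Type} [Group H] [Group Q] (π : H →* Q)
    (hπ : Function.Surjective π) (Y : Set (Q → ℂ)) :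
    sigmaChar ((fun η : Q → ℂ => η ∘ π) '' Y) = sigmaChar Y ∘ π := by
  funext h
  rw [sigmaChar, finsum_mem_image hπ.injective_comp_right.injOn]
  simp only [Function.comp_apply, map_one]
  rfl

/-- In a supercharacter theory for which `N` is normal, a part of characters meeting `Irr(H/N)`
is contained in it. -/
theorem IsSCT.subset_IrrOver {H : Type} [Group H] [Finite H] {𝒳 : Set (Set (H → ℂ))}
    {𝒦 : Set (Set H)} (h : IsSCT H 𝒳 𝒦) {N : Subgroup H} [N.Normal] (hN : CNormal 𝒦 N)
    {X : Set (H → ℂ)} (hX : X ∈ 𝒳) {χ : H → ℂ} (hχ : χ ∈ X) (hχN : χ ∈ IrrOver N) :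
    X ⊆ IrrOver N := by
  have := Fintype.ofFinite H
  let f : H → ℂ := fun x => if x ∈ N then 1 else 0
  have hf : f ∈ constOn 𝒦 := fun K hK x hx y hy => by
    have : x ∈ N ↔ y ∈ N :=
      ⟨fun hxN => hN.subset_of_mem h.2.1 hK hx hxN hy,
        fun hyN => hN.subset_of_mem h.2.1 hK hy hyN hx⟩
    simp only [f, this]
  rw [h.constOn_eq_span] at hf
  have hfχ : cInner H f χ ≠ 0 := by
    rw [cInner_eq_sum]
    refine mul_ne_zero (inv_ne_zero (NeZero.ne _)) ?_
    have h1 : ∀ x, f x * (starRingEnd ℂ) (χ x) = if x ∈ N then χ 1 else 0 := fun x => by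
      simp only [f]
      split_ifs with hx
      · rw [one_mul, hχN.2 x hx, Irr_one_conj hχN.1]
      · rw [zero_mul]
    rw [Finset.sum_congr rfl fun x _ => h1 x, ← Finset.sum_filter, Finset.sum_const, nsmul_eq_mul]
    refine mul_ne_zero (Nat.cast_ne_zero.2 (Finset.card_pos.2 ⟨1, ?_⟩).ne') (Irr_one_ne_zero hχN.1)
    simp [N.one_mem]
  intro χ' hχ'
  have hχ'I := h.1.2.1 X hX hχ'
  refine mem_IrrOver_of_cInner_ne_zero (f := f) (fun m n hn => ?_) hχ'I fun h0 => ?_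
  · simp only [f, N.mul_mem_cancel_right hn]
  · have h2 := (h.1.isIrrFamily le_rfl).cInner_of_mem_span hf hX hχ hχ'
    rw [h0, mul_zero] at h2
    exact mul_ne_zero (Irr_one_ne_zero hχ'I) hfχ h2

theorem sigmaChar_mul_right {H : Type} [Group H] [Finite H] {N : Subgroup H} [N.Normal]
    {X : Set (H → ℂ)} (hX : X ⊆ IrrOver N) (m : H) {n : H} (hn : n ∈ N) :
    sigmaChar X (m * n) = sigmaChar X m :=
  finsum_congr fun ψ => finsum_congr fun hψ => by rw [mul_right_of_mem_IrrOver (hX hψ) m hn]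

/-- If the sets `KN` form a partition of `H`, their number is the number of parts of characters
contained in `Irr(H/N)`. -/
theorem IsSCT.ncard_subset_IrrOver {H : Type} [Group H] [Finite H] {𝒳 : Set (Set (H → ℂ))}
    {𝒦 : Set (Set H)} (h : IsSCT H 𝒳 𝒦) {N : Subgroup H} [N.Normal] (hN : CNormal 𝒦 N)
    {P : Set (Set H)} (hP : P = (fun K => {x | ∃ k ∈ K, k⁻¹ * x ∈ N}) '' 𝒦)
    (hpart : IsPartitionOf Set.univ P) :
    {X ∈ 𝒳 | X ⊆ IrrOver N}.ncard = P.ncard := by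
  have hD := h.1.isIrrFamily (Set.sep_subset 𝒳 fun X => X ⊆ IrrOver N)
  rw [← hD.finrank_span, ← finrank_constOn hpart]
  suffices hs : Submodule.span ℂ (sigmaChar '' {X ∈ 𝒳 | X ⊆ IrrOver N}) = constOn P by rw [hs]
  apply le_antisymm
  · rw [Submodule.span_le]
    rintro _ ⟨X, ⟨hX, hXN⟩, rfl⟩ p hp
    rw [hP] at hp
    obtain ⟨K, hK, rfl⟩ := hp
    rintro x ⟨k, hk, hkx⟩ y ⟨l, hl, hly⟩
    rw [← mul_inv_cancel_left k x, ← mul_inv_cancel_left l y, sigmaChar_mul_right hXN k hkx,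
      sigmaChar_mul_right hXN l hly]
    exact h.2.2.2.2 X hX K hK k hk l hl
  · intro f hf
    have hmem : ∀ K ∈ 𝒦, {x | ∃ k ∈ K, k⁻¹ * x ∈ N} ∈ P := fun K hK =>
      hP ▸ Set.mem_image_of_mem _ hK
    have hf𝒦 : f ∈ constOn 𝒦 := fun K hK x hx y hy =>
      hf _ (hmem K hK) x ⟨x, hx, by simp⟩ y ⟨y, hy, by simp⟩
    have hfN : ∀ m, ∀ n ∈ N, f (m * n) = f m := fun m n hn => by
      obtain ⟨K, hK, hm⟩ := h.2.1.exists_mem (Set.mem_univ m)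
      exact hf _ (hmem K hK) _ ⟨m, hm, by simpa using hn⟩ m ⟨m, hm, by simp⟩
    rw [h.constOn_eq_span] at hf𝒦
    have h𝒳 := h.1.isIrrFamily le_rfl
    refine hD.mem_span (h𝒳.conj_of_mem_span hf𝒦)
      (fun X hX χ hχ χ' hχ' => h𝒳.cInner_of_mem_span hf𝒦 hX.1 hχ hχ') fun χ hχ hχD => ?_
    by_contra h0
    obtain ⟨X, hX, hχX⟩ := h.1.exists_mem hχ
    exact hχD ⟨X, ⟨hX, h.subset_IrrOver hN hX hχX (mem_IrrOver_of_cInner_ne_zero hfN hχ h0)⟩, hχX⟩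

theorem exists_mem_irrOverChar {G : Type} [Group G] [Finite G] (M : Subgroup G) {χ : G → ℂ}
    (hχ : χ ∈ Irr G) : ∃ ψ ∈ Irr M, χ ∈ irrOverChar M ψ := by
  by_contra! h0
  have h1 : resChar M χ = 0 := by
    refine eq_of_cInner_Irr_eq (fun g x => Irr_conj hχ (g : G) (x : G)) (fun _ _ => rfl)
      fun ψ hψ => ?_
    rw [← cInnerLeft_apply 0, map_zero]
    by_contra hne
    exact h0 ψ hψ ⟨hχ, hne⟩
  exact Irr_one_ne_zero hχ (congrFun h1 1)

theorem mem_IrrOver_iff_of_mem_irrOverChar {G : Type} [Group G] [Finite G] {N M : Subgroup G}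
    [N.Normal] (hNM : N ≤ M) {χ : G → ℂ} {ψ : M → ℂ} (hψ : ψ ∈ Irr M)
    (hχ : χ ∈ irrOverChar M ψ) : χ ∈ IrrOver N ↔ ψ ∈ IrrOver (N.subgroupOf M) := by
  constructor
  · intro hχN
    exact mem_IrrOver_of_cInner_ne_zero (f := resChar M χ)
      (fun m n hn => mul_right_of_mem_IrrOver hχN (m : G) (Subgroup.mem_subgroupOf.1 hn)) hψ hχ.2
  · intro hψN
    have := Fintype.ofFinite N
    have := Fintype.ofFinite (N.subgroupOf M)
    by_contra hχN
    refine cInner_ne_zero_comm.1 hχ.2 (cInner_eq_zero_of_sum_coset (N.subgroupOf M)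
      (fun m n hn => mul_right_of_mem_IrrOver hψN m hn) fun m => ?_)
    rw [← sum_coset_eq_zero hχ.1 hχN (m : G)]
    exact Fintype.sum_equiv (Subgroup.subgroupOfEquivOfLe hNM).toEquiv _ _ fun n => rfl

theorem constituentsOn_sigmaChar_inflateSet {G : Type} [Group G] [Finite G] (N M : Subgroup G)
    [N.Normal] (Y : Set (G ⧸ N → ℂ)) :
    constituentsOn M (sigmaChar (inflateSet N Y)) = (fun ψ => ψ ∘ projMN M N) ''
      constituentsOn (M.map (QuotientGroup.mk' N)) (sigmaChar Y) := by
  let π := (QuotientGroup.mk' N).subgroupMap M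
  have hπ : Function.Surjective π := (QuotientGroup.mk' N).subgroupMap_surjective M
  have hker : ∀ m, π m = 1 ↔ m ∈ N.subgroupOf M := fun m => by
    rw [Subgroup.mem_subgroupOf, ← QuotientGroup.eq_one_iff, Subtype.ext_iff]
    rfl
  have hres : resChar M (sigmaChar (inflateSet N Y)) =
      resChar (M.map (QuotientGroup.mk' N)) (sigmaChar Y) ∘ π := by
    have := sigmaChar_image_comp (QuotientGroup.mk' N) (QuotientGroup.mk'_surjective N) Y
    exact funext fun m => congrFun this (m : G)
  ext ψ
  rw [constituentsOn, hres]
  constructor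
  · rintro ⟨hψ, hne⟩
    have hψN : ψ ∈ IrrOver (N.subgroupOf M) :=
      mem_IrrOver_of_cInner_ne_zero (fun m n hn => by
        rw [Function.comp_apply, map_mul, (hker n).2 hn, mul_one, Function.comp_apply]) hψ hne
    rw [IrrOver_eq_image π hπ hker] at hψN
    obtain ⟨η, hη, rfl⟩ := hψN
    exact ⟨η, ⟨hη, by rwa [← cInner_comp π hπ]⟩, rfl⟩
  · rintro ⟨η, ⟨hη, hne⟩, rfl⟩
    exact ⟨comp_mem_Irr π hπ hη, by rwa [← cInner_comp π hπ] at hne⟩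

theorem mk_mem_map_iff {G : Type} [Group G] {N M : Subgroup G} [N.Normal] (hNM : N ≤ M) (g : G) :
    (g : G ⧸ N) ∈ M.map (QuotientGroup.mk' N) ↔ g ∈ M := by
  refine ⟨?_, fun hg => ⟨g, hg, rfl⟩⟩
  rintro ⟨m, hm, hmg⟩
  have h1 : m⁻¹ * g ∈ N := QuotientGroup.eq.1 hmg
  simpa using M.mul_mem hm (hNM h1)

theorem comp_mk_injective {G : Type} [Group G] (N : Subgroup G) [N.Normal] :
    Function.Injective fun η : G ⧸ N → ℂ => η ∘ (QuotientGroup.mk : G → G ⧸ N) :=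
  (QuotientGroup.mk'_surjective N).injective_comp_right

theorem ncard_sep_add_ncard_sep_not {α : Type*} {s : Set α} (hs : s.Finite) (p : α → Prop) :
    {x ∈ s | p x}.ncard + {x ∈ s | ¬ p x}.ncard = s.ncard := by
  have hdisj : Disjoint {x ∈ s | p x} {x ∈ s | ¬ p x} :=
    Set.disjoint_left.2 fun x hx hx' => hx'.2 hx.2
  rw [← Set.ncard_union_eq hdisj (hs.subset (Set.sep_subset _ _)) (hs.subset (Set.sep_subset _ _))]
  congr 1
  ext x
  simp only [Set.mem_union, Set.mem_ofPred_eq]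
  tauto

/-- The superclasses of a theory with the wedge property are determined. -/
theorem WedgeProperty.superclasses_eq {G : Type} [Group G] [Finite G] {N M : Subgroup G} [N.Normal]
    {𝒳 : Set (Set (↥M → ℂ))} {𝒦 : Set (Set ↥M)} {𝒴 : Set (Set (G ⧸ N → ℂ))}
    {𝓛 : Set (Set (G ⧸ N))} {E : Set (Set (G → ℂ)) × Set (Set G)}
    (hE : WedgeProperty G N M 𝒳 𝒦 𝒴 𝓛 E) (hNM : N ≤ M) :
    E.2 = (wedgeFormula G N M 𝒳 𝒦 𝒴 𝓛).2 := by
  obtain ⟨-, -, rfl, -, rfl, hcoset⟩ := hE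
  have hval : ∀ J ⊆ (M : Set G), Subtype.val '' (Subtype.val ⁻¹' J : Set M) = J := fun J hJ =>
    Set.image_preimage_eq_of_subset (by simpa using hJ)
  have hmk : ∀ J ∈ E.2, ¬ J ⊆ (M : Set G) →
      (QuotientGroup.mk : G → G ⧸ N) ⁻¹' (QuotientGroup.mk '' J) = J := by
    refine fun J hJ hJM => (Set.subset_preimage_image _ _).antisymm' ?_
    rintro x ⟨g, hg, hgx⟩
    rw [← mul_inv_cancel_left g x]
    exact hcoset J hJ hJM g hg _ (QuotientGroup.eq.1 hgx)
  ext J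
  constructor
  · intro hJ
    by_cases hJM : J ⊆ (M : Set G)
    · exact Or.inl ⟨_, ⟨J, ⟨hJ, hJM⟩, rfl⟩, hval J hJM⟩
    · refine Or.inr ⟨_, ⟨⟨J, hJ, rfl⟩, fun hL => hJM fun g hg => ?_⟩, hmk J hJ hJM⟩
      exact (mk_mem_map_iff hNM g).1 (hL ⟨g, hg, rfl⟩)
  · rintro (⟨_, ⟨J, ⟨hJ, hJM⟩, rfl⟩, rfl⟩ | ⟨_, ⟨⟨J, hJ, rfl⟩, hL⟩, rfl⟩)
    · simpa only [hval J hJM] using hJ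
    · have hJM : ¬ J ⊆ (M : Set G) := fun hJM => hL (by
        rintro _ ⟨g, hg, rfl⟩
        exact ⟨g, hJM hg, rfl⟩)
      simpa only [hmk J hJ hJM] using hJ

variable {G : Type} [Group G] [Finite G] {N M : Subgroup G} [N.Normal] [hMn : M.Normal]
  {𝒳 : Set (Set (↥M → ℂ))} {𝒦 : Set (Set ↥M)}
  {𝒴 : Set (Set (G ⧸ N → ℂ))} {𝓛 : Set (Set (G ⧸ N))}

theorem WedgeHyps.sigmaChar_conjSub (h : WedgeHyps G N M 𝒳 𝒦 𝒴 𝓛) {X : Set (M → ℂ)}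
    (hX : X ∈ 𝒳) (g : G) (m : M) : sigmaChar X (conjSub hMn g m) = sigmaChar X m := by
  obtain ⟨hC, hinv, -⟩ := h
  obtain ⟨K, hK, hm⟩ := hC.2.1.exists_mem (Set.mem_univ m)
  exact hC.2.2.2.2 X hX K hK _ (hinv g K hK ▸ Set.mem_image_of_mem _ hm) m hm

theorem WedgeHyps.image_mem (h : WedgeHyps G N M 𝒳 𝒦 𝒴 𝓛) {K : Set M} (hK : K ∈ 𝒦) :
    (fun m : M => ((m : G) : G ⧸ N)) '' K ∈ 𝓛 := by
  obtain ⟨-, -, -, -, -, -, hc⟩ := h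
  exact (hc.subset (Set.mem_image_of_mem _ hK)).1

theorem WedgeHyps.exists_image_eq (h : WedgeHyps G N M 𝒳 𝒦 𝒴 𝓛) {L : Set (G ⧸ N)} (hL : L ∈ 𝓛)
    (hLM : L ⊆ M.map (QuotientGroup.mk' N)) :
    ∃ K ∈ 𝒦, (fun m : M => ((m : G) : G ⧸ N)) '' K = L := by
  obtain ⟨-, -, -, -, -, -, hc⟩ := h
  exact hc.superset ⟨hL, hLM⟩

theorem WedgeHyps.disjoint_of_not_subset (h : WedgeHyps G N M 𝒳 𝒦 𝒴 𝓛)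
    {L : Set (G ⧸ N)} (hL : L ∈ 𝓛) (hLM : ¬ L ⊆ M.map (QuotientGroup.mk' N)) {g : G}
    (hg : (g : G ⧸ N) ∈ L) : g ∉ M := by
  obtain ⟨-, -, hD, -, hb, -⟩ := h
  exact fun hgM => hLM (hb.subset_of_mem hD.2.1 hL hg ⟨g, hgM, rfl⟩)

theorem WedgeHyps.not_mem_IrrOver (h : WedgeHyps G N M 𝒳 𝒦 𝒴 𝓛) (hNM : N ≤ M)
    {X : Set (M → ℂ)} (hX : X ∈ 𝒳) (hXN : ¬ X ⊆ IrrOver (N.subgroupOf M)) {χ : G → ℂ}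
    (hχ : χ ∈ indSet M X) : χ ∉ IrrOver N := by
  obtain ⟨hC, -, -, ha, -⟩ := h
  obtain ⟨ψ, hψX, hψ⟩ := Set.mem_iUnion₂.1 hχ
  intro hχN
  exact hXN (hC.subset_IrrOver ha hX hψX
    ((mem_IrrOver_iff_of_mem_irrOverChar hNM (hC.1.2.1 X hX hψX) hψ).1 hχN))

theorem WedgeHyps.eq_of_mem_indSet (h : WedgeHyps G N M 𝒳 𝒦 𝒴 𝓛) {X X' : Set (M → ℂ)}
    (hX : X ∈ 𝒳) (hX' : X' ∈ 𝒳) {χ : G → ℂ} (hχ : χ ∈ indSet M X) (hχ' : χ ∈ indSet M X') :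
    X = X' := by
  have hC := h.1
  obtain ⟨ψ, hψX, hψ⟩ := Set.mem_iUnion₂.1 hχ
  obtain ⟨ψ', hψX', hψ'⟩ := Set.mem_iUnion₂.1 hχ'
  exact hC.1.eq_of_mem hX hX' (mem_of_common_irrOverChar (hC.1.2.1 X hX) (h.sigmaChar_conjSub hX)
    (hC.1.2.1 X hX hψX) (hC.1.2.1 X' hX' hψX') hψ hψ' hψX) hψX'

theorem WedgeHyps.indSet_nonempty (h : WedgeHyps G N M 𝒳 𝒦 𝒴 𝓛) {X : Set (M → ℂ)}
    (hX : X ∈ 𝒳) : (indSet M X).Nonempty := by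
  have hXI := h.1.1.2.1 X hX
  by_contra h0
  have h1 := congrFun (sigmaChar_indSet hXI (h.sigmaChar_conjSub hX)) 1
  rw [Set.not_nonempty_iff_eq_empty.1 h0, Pi.smul_apply, zeroExtend, dif_pos M.one_mem] at h1
  simp only [sigmaChar, Set.mem_empty_iff_false, finsum_false, finsum_zero] at h1
  exact smul_ne_zero (Nat.cast_ne_zero.2 M.index_ne_zero_of_finite)
    (sigmaChar_one_ne_zero hXI (h.1.1.nonempty hX)) h1.symm

theorem WedgeHyps.constituentsOn_indSet (h : WedgeHyps G N M 𝒳 𝒦 𝒴 𝓛) {X : Set (M → ℂ)}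
    (hX : X ∈ 𝒳) : constituentsOn M (sigmaChar (indSet M X)) = X := by
  have hXI := h.1.1.2.1 X hX
  have hres : resChar M (sigmaChar (indSet M X)) = (M.index : ℂ) • sigmaChar X := by
    rw [sigmaChar_indSet hXI (h.sigmaChar_conjSub hX)]
    funext m
    rw [resChar, Pi.smul_apply, zeroExtend, dif_pos m.2]
    rfl
  have hin : ∀ ψ ∈ Irr M, cInner M (resChar M (sigmaChar (indSet M X))) ψ ≠ 0 ↔ ψ ∈ X := by
    intro ψ hψ
    rw [hres, ← cInnerLeft_apply, map_smul, cInnerLeft_apply, cInner_sigmaChar hXI hψ]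
    split_ifs with hψX <;> simp [hψX, Irr_one_ne_zero hψ, M.index_ne_zero_of_finite]
  ext ψ
  exact ⟨fun hψ => (hin ψ hψ.1).1 hψ.2, fun hψ => ⟨hXI hψ, (hin ψ (hXI hψ)).2 hψ⟩⟩

theorem IrrOver_eq_inflateSet (N : Subgroup G) [N.Normal] :
    IrrOver N = inflateSet N (Irr (G ⧸ N)) :=
  IrrOver_eq_image (QuotientGroup.mk' N) (QuotientGroup.mk'_surjective N) fun g =>
    QuotientGroup.eq_one_iff g

theorem WedgeHyps.inflateSet_subset (h : WedgeHyps G N M 𝒳 𝒦 𝒴 𝓛) {Y : Set (G ⧸ N → ℂ)}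
    (hY : Y ∈ 𝒴) : inflateSet N Y ⊆ IrrOver N := by
  rw [IrrOver_eq_inflateSet]
  exact Set.image_mono (h.2.2.1.1.2.1 Y hY)

theorem WedgeHyps.isPartitionOf_Irr (h : WedgeHyps G N M 𝒳 𝒦 𝒴 𝓛) (hNM : N ≤ M) :
    IsPartitionOf (Irr G) (wedgeFormula G N M 𝒳 𝒦 𝒴 𝓛).1 := by
  have hC := h.1
  have hD := h.2.2.1
  refine ⟨?_, ?_, fun χ hχ => ?_⟩
  · rintro (⟨Y, hY, h0⟩ | ⟨X, hX, h0⟩)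
    · exact (hD.1.nonempty hY).ne_empty (Set.image_eq_empty.1 h0)
    · exact (h.indSet_nonempty hX.1).ne_empty h0
  · rintro _ (⟨Y, hY, rfl⟩ | ⟨X, hX, rfl⟩)
    · exact (h.inflateSet_subset hY).trans fun χ hχ => hχ.1
    · exact Set.iUnion₂_subset fun ψ _ χ hχ => hχ.1
  · by_cases hχN : χ ∈ IrrOver N
    · have hχN' := hχN
      rw [IrrOver_eq_inflateSet] at hχN'
      obtain ⟨η, hη, rfl⟩ := hχN'
      obtain ⟨Y, hY, hηY⟩ := hD.1.exists_mem hη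
      refine ⟨inflateSet N Y, ⟨Or.inl ⟨Y, hY, rfl⟩, η, hηY, rfl⟩, ?_⟩
      rintro _ ⟨⟨Y', hY', rfl⟩ | ⟨X, hX, rfl⟩, hmem⟩
      · obtain ⟨η', hη', heq⟩ := hmem
        rw [comp_mk_injective N heq] at hη'
        rw [hD.1.eq_of_mem hY hY' hηY hη']
      · exact absurd hχN (h.not_mem_IrrOver hNM hX.1 hX.2 hmem)
    · obtain ⟨ψ, hψ, hχψ⟩ := exists_mem_irrOverChar M hχ
      obtain ⟨X, hX, hψX⟩ := hC.1.exists_mem hψ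
      have hmem : χ ∈ indSet M X := Set.mem_iUnion₂.2 ⟨ψ, hψX, hχψ⟩
      refine ⟨indSet M X, ⟨Or.inr ⟨X, ⟨hX, fun hXN => hχN ?_⟩, rfl⟩, hmem⟩, ?_⟩
      · exact (mem_IrrOver_iff_of_mem_irrOverChar hNM hψ hχψ).2 (hXN hψX)
      · rintro _ ⟨⟨Y, hY, rfl⟩ | ⟨X', hX', rfl⟩, hmem'⟩
        · exact absurd (h.inflateSet_subset hY hmem') hχN
        · exact congrArg (indSet M) (h.eq_of_mem_indSet hX'.1 hX hmem' hmem)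

theorem WedgeHyps.isPartitionOf_univ (h : WedgeHyps G N M 𝒳 𝒦 𝒴 𝓛) (hNM : N ≤ M) :
    IsPartitionOf Set.univ (wedgeFormula G N M 𝒳 𝒦 𝒴 𝓛).2 := by
  have hC := h.1
  have hD := h.2.2.1
  refine ⟨?_, fun _ _ => Set.subset_univ _, fun g _ => ?_⟩
  · rintro (⟨K, hK, h0⟩ | ⟨L, hL, h0⟩)
    · exact (hC.2.1.nonempty hK).ne_empty (Set.image_eq_empty.1 h0)
    · obtain ⟨q, hq⟩ := hD.2.1.nonempty hL.1
      obtain ⟨g, rfl⟩ := QuotientGroup.mk_surjective q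
      exact (h0.subset hq).elim
  · by_cases hg : g ∈ M
    · obtain ⟨K, hK, hgK⟩ := hC.2.1.exists_mem (Set.mem_univ (⟨g, hg⟩ : M))
      refine ⟨Subtype.val '' K, ⟨Or.inl ⟨K, hK, rfl⟩, _, hgK, rfl⟩, ?_⟩
      rintro _ ⟨⟨K', hK', rfl⟩ | ⟨L, hL, rfl⟩, hmem⟩
      · obtain ⟨m, hm, rfl⟩ := hmem
        rw [hC.2.1.eq_of_mem hK hK' hgK hm]
      · exact absurd hg (h.disjoint_of_not_subset hL.1 hL.2 hmem)
    · obtain ⟨L, hL, hgL⟩ := hD.2.1.exists_mem (Set.mem_univ (g : G ⧸ N))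
      refine ⟨QuotientGroup.mk ⁻¹' L, ⟨Or.inr ⟨L, ⟨hL, fun hLM => hg ?_⟩, rfl⟩, hgL⟩, ?_⟩
      · exact (mk_mem_map_iff hNM g).1 (hLM hgL)
      · rintro _ ⟨⟨K, hK, rfl⟩ | ⟨L', hL', rfl⟩, hmem⟩
        · obtain ⟨m, hm, rfl⟩ := hmem
          exact absurd m.2 hg
        · rw [hD.2.1.eq_of_mem hL hL'.1 hgL hmem]

theorem WedgeHyps.ncard_subset_IrrOver (h : WedgeHyps G N M 𝒳 𝒦 𝒴 𝓛) :
    {X ∈ 𝒳 | X ⊆ IrrOver (N.subgroupOf M)}.ncard =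
      {L ∈ 𝓛 | L ⊆ (M.map (QuotientGroup.mk' N) : Set (G ⧸ N))}.ncard := by
  obtain ⟨hC, -, hD, ha, -, -, hc⟩ := h
  let q : M → G ⧸ N := fun m => ((m : G) : G ⧸ N)
  have hq : ∀ K : Set M, q ⁻¹' (q '' K) = {x | ∃ k ∈ K, k⁻¹ * x ∈ N.subgroupOf M} := fun K => by
    ext x
    refine exists_congr fun k => and_congr_right fun _ => ?_
    exact QuotientGroup.eq.trans (by rw [Subgroup.mem_subgroupOf]; rfl)
  have hinj : Set.InjOn (fun L => q ⁻¹' L) ((fun K => q '' K) '' 𝒦) := by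
    rintro _ ⟨K, -, rfl⟩ _ ⟨K', -, rfl⟩ heq
    have := congrArg (fun S => q '' S) heq
    simpa only [Set.image_preimage_eq_of_subset (Set.image_subset_range q _)] using this
  have hpart : IsPartitionOf Set.univ ((fun L => q ⁻¹' L) '' ((fun K => q '' K) '' 𝒦)) := by
    refine ⟨?_, fun _ _ => Set.subset_univ _, fun m _ => ?_⟩
    · rintro ⟨_, ⟨K, hK, rfl⟩, h0⟩
      obtain ⟨k, hk⟩ := hC.2.1.nonempty hK
      exact h0.subset (show k ∈ q ⁻¹' (q '' K) from ⟨k, hk, rfl⟩)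
    · obtain ⟨K, hK, hm⟩ := hC.2.1.exists_mem (Set.mem_univ m)
      refine ⟨q ⁻¹' (q '' K), ⟨⟨_, ⟨K, hK, rfl⟩, rfl⟩, m, hm, rfl⟩, ?_⟩
      rintro _ ⟨⟨_, ⟨K', hK', rfl⟩, rfl⟩, hm'⟩
      rw [hD.2.1.eq_of_mem (hc.subset ⟨K', hK', rfl⟩).1 (hc.subset ⟨K, hK, rfl⟩).1 hm' ⟨m, hm, rfl⟩]
  rw [← hc, hC.ncard_subset_IrrOver ha _ hpart, hinj.ncard_image]
  rw [Set.image_image]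
  exact Set.image_congr fun K _ => hq K

theorem WedgeHyps.ncard_eq (h : WedgeHyps G N M 𝒳 𝒦 𝒴 𝓛) (hNM : N ≤ M) :
    (wedgeFormula G N M 𝒳 𝒦 𝒴 𝓛).1.ncard = (wedgeFormula G N M 𝒳 𝒦 𝒴 𝓛).2.ncard := by
  have hC := h.1
  have hD := h.2.2.1
  have h𝒳fin := (hC.1.isIrrFamily le_rfl).finite
  have h𝒴fin := (hD.1.isIrrFamily le_rfl).finite
  have hdisj : Disjoint (inflateSet N '' 𝒴)
      ((fun X => indSet M X) '' {X ∈ 𝒳 | ¬ X ⊆ IrrOver (N.subgroupOf M)}) := by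
    rw [Set.disjoint_left]
    rintro _ ⟨Y, hY, rfl⟩ ⟨X, hX, heq⟩
    obtain ⟨χ, hχ⟩ := h.indSet_nonempty hX.1
    exact h.not_mem_IrrOver hNM hX.1 hX.2 hχ (h.inflateSet_subset hY (heq ▸ hχ))
  have hdisj' : Disjoint ((fun K => (Subtype.val '' K : Set G)) '' 𝒦)
      ((fun L => ((QuotientGroup.mk : G → G ⧸ N) ⁻¹' L)) ''
        {L ∈ 𝓛 | ¬ L ⊆ (M.map (QuotientGroup.mk' N) : Set (G ⧸ N))}) := by
    rw [Set.disjoint_left]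
    rintro _ ⟨K, hK, rfl⟩ ⟨L, hL, heq⟩
    obtain ⟨m, hm⟩ := hC.2.1.nonempty hK
    exact h.disjoint_of_not_subset hL.1 hL.2 (heq.superset ⟨m, hm, rfl⟩) m.2
  have hinfl : Function.Injective (inflateSet N) := (comp_mk_injective N).image_injective
  have hinj : Set.InjOn (fun X => indSet M X)
      {X ∈ 𝒳 | ¬ X ⊆ IrrOver (N.subgroupOf M)} := fun X hX X' hX' heq => by
    rw [← h.constituentsOn_indSet hX.1, ← h.constituentsOn_indSet hX'.1]
    exact congrArg (fun W => constituentsOn M (sigmaChar W)) heq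
  rw [wedgeFormula, Set.ncard_union_eq hdisj (h𝒴fin.image _)
      ((h𝒳fin.subset (Set.sep_subset _ _)).image _),
    Set.ncard_union_eq hdisj' (Set.toFinite _) (Set.toFinite _),
    Set.ncard_image_of_injective _ hinfl,
    Set.ncard_image_of_injective _ Subtype.val_injective.image_injective, hinj.ncard_image,
    Set.ncard_image_of_injective _ QuotientGroup.mk_surjective.preimage_injective]
  have h1 := ncard_sep_add_ncard_sep_not h𝒳fin (· ⊆ IrrOver (N.subgroupOf M))
  have h2 := ncard_sep_add_ncard_sep_not (Set.toFinite 𝓛)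
    (· ⊆ (M.map (QuotientGroup.mk' N) : Set (G ⧸ N)))
  have h3 := h.ncard_subset_IrrOver
  have h4 := hC.2.2.1
  have h5 := hD.2.2.1
  omega

theorem WedgeHyps.isSCT_wedgeFormula (h : WedgeHyps G N M 𝒳 𝒦 𝒴 𝓛) (hNM : N ≤ M) :
    IsSCT G (wedgeFormula G N M 𝒳 𝒦 𝒴 𝓛).1 (wedgeFormula G N M 𝒳 𝒦 𝒴 𝓛).2 := by
  have hC := h.1
  have hD := h.2.2.1
  refine ⟨h.isPartitionOf_Irr hNM, h.isPartitionOf_univ hNM, h.ncard_eq hNM,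
    Or.inl ⟨{1}, hC.2.2.2.1, by simp⟩, ?_⟩
  rintro _ (⟨Y, hY, rfl⟩ | ⟨X, hX, rfl⟩) J hJ
  · have hσ : sigmaChar (inflateSet N Y) = sigmaChar Y ∘ (QuotientGroup.mk : G → G ⧸ N) :=
      sigmaChar_image_comp (QuotientGroup.mk' N) (QuotientGroup.mk'_surjective N) Y
    rw [hσ]
    obtain ⟨K, hK, rfl⟩ | ⟨L, hL, rfl⟩ := hJ
    · rintro _ ⟨m, hm, rfl⟩ _ ⟨m', hm', rfl⟩
      exact hD.2.2.2.2 Y hY _ (h.image_mem hK) _ ⟨m, hm, rfl⟩ _ ⟨m', hm', rfl⟩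
    · exact fun g hg g' hg' => hD.2.2.2.2 Y hY L hL.1 _ hg _ hg'
  · intro g hg g' hg'
    change sigmaChar (indSet M X) g = sigmaChar (indSet M X) g'
    rw [sigmaChar_indSet (hC.1.2.1 X hX.1) (h.sigmaChar_conjSub hX.1), Pi.smul_apply,
      Pi.smul_apply]
    congr 1
    obtain ⟨K, hK, rfl⟩ | ⟨L, hL, rfl⟩ := hJ
    · obtain ⟨m, hm, rfl⟩ := hg
      obtain ⟨m', hm', rfl⟩ := hg'
      rw [zeroExtend, zeroExtend, dif_pos m.2, dif_pos m'.2]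
      exact hC.2.2.2.2 X hX.1 K hK m hm m' hm'
    · rw [zeroExtend, zeroExtend, dif_neg (h.disjoint_of_not_subset hL.1 hL.2 hg),
        dif_neg (h.disjoint_of_not_subset hL.1 hL.2 hg')]

theorem WedgeHyps.wedgeProperty_wedgeFormula (h : WedgeHyps G N M 𝒳 𝒦 𝒴 𝓛) (hNM : N ≤ M) :
    WedgeProperty G N M 𝒳 𝒦 𝒴 𝓛 (wedgeFormula G N M 𝒳 𝒦 𝒴 𝓛) := by
  have hC := h.1
  have hD := h.2.2.1
  obtain ⟨-, -, -, -, -, hc, -⟩ := id h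
  refine ⟨h.isSCT_wedgeFormula hNM, ?_, ?_, ?_, ?_, ?_⟩
  · rw [wedgeFormula, Set.image_union, Set.image_image, Set.image_image,
      Set.image_congr fun Y _ => constituentsOn_sigmaChar_inflateSet N M Y, ← hc,
      Set.image_congr fun X hX => h.constituentsOn_indSet hX.1, Set.image_id']
    ext X
    simp only [Set.mem_union, Set.mem_ofPred_eq]
    tauto
  · ext K
    constructor
    · rintro ⟨_, ⟨⟨K', hK', rfl⟩ | ⟨L, hL, rfl⟩, hJM⟩, rfl⟩
      · simpa only [Set.preimage_image_eq _ Subtype.val_injective] using hK'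
      · obtain ⟨q, hq⟩ := hD.2.1.nonempty hL.1
        obtain ⟨g, rfl⟩ := QuotientGroup.mk_surjective q
        exact absurd (hJM hq) (h.disjoint_of_not_subset hL.1 hL.2 hq)
    · intro hK
      refine ⟨Subtype.val '' K, ⟨Or.inl ⟨K, hK, rfl⟩, ?_⟩,
        Set.preimage_image_eq _ Subtype.val_injective⟩
      rintro _ ⟨m, -, rfl⟩
      exact m.2
  · ext W
    constructor
    · rintro ⟨⟨Y, hY, rfl⟩ | ⟨X, hX, rfl⟩, hW⟩
      · exact ⟨Y, hY, rfl⟩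
      · obtain ⟨χ, hχ⟩ := h.indSet_nonempty hX.1
        exact absurd (hW hχ) (h.not_mem_IrrOver hNM hX.1 hX.2 hχ)
    · rintro ⟨Y, hY, rfl⟩
      exact ⟨Or.inl ⟨Y, hY, rfl⟩, h.inflateSet_subset hY⟩
  · ext L
    constructor
    · rintro ⟨_, ⟨K, hK, rfl⟩ | ⟨L, hL, rfl⟩, rfl⟩
      · simpa only [Set.image_image] using h.image_mem hK
      · simpa only [Set.image_preimage_eq _ QuotientGroup.mk_surjective] using hL.1
    · intro hL
      by_cases hLM : L ⊆ (M.map (QuotientGroup.mk' N) : Set (G ⧸ N))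
      · obtain ⟨K, hK, rfl⟩ := h.exists_image_eq hL hLM
        exact ⟨Subtype.val '' K, Or.inl ⟨K, hK, rfl⟩, Set.image_image _ _ _⟩
      · exact ⟨_, Or.inr ⟨L, ⟨hL, hLM⟩, rfl⟩, Set.image_preimage_eq _ QuotientGroup.mk_surjective⟩
  · rintro _ (⟨K, hK, rfl⟩ | ⟨L, hL, rfl⟩) hJM g hg n hn
    · refine absurd ?_ hJM
      rintro _ ⟨m, -, rfl⟩
      exact m.2
    · rwa [Set.mem_preimage, QuotientGroup.mk_mul_of_mem g hn]

end WedgeProduct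

/-- Theorem 7.2, wedge products. Under the wedge-product hypotheses
there is a unique supercharacter theory `ℰ` of `G` with `ℰ_M = 𝒞`, `ℰ^{G/N} = 𝒟`, and
all superclasses outside `M` unions of `N`-cosets; it is given by the explicit wedge
formula. -/
theorem stmt16 (G : Type) [Group G] [Finite G]
    (N M : Subgroup G) [N.Normal] [M.Normal] (hNM : N ≤ M)
    (𝒳 : Set (Set (↥M → ℂ))) (𝒦 : Set (Set ↥M))
    (𝒴 : Set (Set (G ⧸ N → ℂ))) (𝓛 : Set (Set (G ⧸ N)))
    (h : WedgeHyps G N M 𝒳 𝒦 𝒴 𝓛) :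
    WedgeProperty G N M 𝒳 𝒦 𝒴 𝓛 (wedgeFormula G N M 𝒳 𝒦 𝒴 𝓛) ∧
    ∀ E : Set (Set (G → ℂ)) × Set (Set G),
      WedgeProperty G N M 𝒳 𝒦 𝒴 𝓛 E → E = wedgeFormula G N M 𝒳 𝒦 𝒴 𝓛 := by
  have hw := h.wedgeProperty_wedgeFormula hNM
  refine ⟨hw, fun E hE => ?_⟩
  have h2 := hE.superclasses_eq hNM
  exact Prod.ext (hE.1.characters_unique (h2 ▸ hw.1)) h2
end

section
/- Let G be a finite group, let 𝒞 be a supercharacter theory of G, and let N ≤ M be 𝒞-normal normal subgroups of G. Then 𝒞 is a wedge product over N and M (i.e., 𝒞 = 𝒞' ∆ 𝒟' for some G-invariant supercharacter theory 𝒞' of M and supercharacter theory 𝒟' of G/N satisfying the wedge-product hypotheses) if and only if every superclass of 𝒞 outside M is a union of N-cosets; and in that case 𝒞 = 𝒞_M ∆ 𝒞^{G/N}. -/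
open scoped Classical

namespace SuperTheory

open Representation Module
open scoped ComplexOrder

section Representations

variable {G : Type} [Group G]

theorem mem_Irr_iff [Finite G] {χ : G → ℂ} :
    χ ∈ Irr G ↔ ∃ (V : Type) (_ : AddCommGroup V) (_ : Module ℂ V) (_ : FiniteDimensional ℂ V)
      (ρ : Representation ℂ G V), finrank ℂ (IntertwiningMap ρ ρ) = 1 ∧ ρ.character = χ := by
  have := Fintype.ofFinite G
  have hne : (Nat.card G : ℂ) ≠ 0 := Nat.cast_ne_zero.2 Nat.card_pos.ne'
  have := invertibleOfNonzero hne
  have key : ∀ V : FDRep ℂ G, CategoryTheory.Simple V ↔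
      finrank ℂ (IntertwiningMap (A := ℂ) (V := V) (W := V) V.ρ V.ρ) = 1 := by
    intro V
    rw [FDRep.simple_iff_char_is_norm_one, ← Nat.cast_inj (R := ℂ),
      ← card_inv_mul_sum_char_mul_char_eq_finrank, Nat.cast_one, inv_mul_eq_one₀ hne, eq_comm]
    rfl
  constructor
  · rintro ⟨V, hV, rfl⟩
    exact ⟨V, inferInstance, inferInstance, inferInstance, V.ρ, (key V).1 hV, rfl⟩
  · rintro ⟨V, _, _, _, ρ, hρ, rfl⟩
    exact ⟨FDRep.of ρ, (key _).2 hρ, rfl⟩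

variable {V : Type} [AddCommGroup V] [Module ℂ V]

/-- The operator by which `∑ g, a g • g` acts. -/
noncomputable def actionOf [Fintype G] (ρ : Representation ℂ G V) (a : G → ℂ) : V →ₗ[ℂ] V :=
  ∑ g, a g • ρ g

theorem actionOf_comm [Fintype G] (ρ : Representation ℂ G V) {a : G → ℂ}
    (ha : ∀ g h, a (h * g * h⁻¹) = a g) (x : G) :
    actionOf ρ a ∘ₗ ρ x = ρ x ∘ₗ actionOf ρ a := by
  simp only [actionOf, ← Module.End.mul_eq_comp, Finset.sum_mul, Finset.mul_sum, smul_mul_assoc,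
    mul_smul_comm, ← map_mul]
  rw [← Equiv.sum_comp (MulAut.conj x).toEquiv]
  refine Finset.sum_congr rfl fun g _ => ?_
  have h : (MulAut.conj x).toEquiv g = x * g * x⁻¹ := rfl
  rw [h, ha, inv_mul_cancel_right]

theorem trace_actionOf [Fintype G] (ρ : Representation ℂ G V) (a : G → ℂ) :
    LinearMap.trace ℂ V (actionOf ρ a) = ∑ g, a g * ρ.character g := by
  simp [actionOf, Representation.character]

theorem sum_character_coset (N : Subgroup G) [Fintype N]
    (ρ : Representation ℂ G V) (g : G) :
    ∑ n : N, ρ.character (g * n) = LinearMap.trace ℂ V (ρ g ∘ₗ ∑ n : N, ρ n) := by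
  simp only [← Module.End.mul_eq_comp, Finset.mul_sum, ← map_mul, map_sum]
  rfl

variable [FiniteDimensional ℂ V]

theorem character_inv_eq_conj [Finite G] (ρ : Representation ℂ G V) (g : G) :
    ρ.character g⁻¹ = (starRingEnd ℂ) (ρ.character g) := by
  have := Fintype.ofFinite G
  let b := Module.finBasis ℂ V
  let A : G → Matrix _ _ ℂ := fun g => LinearMap.toMatrix b b (ρ g)
  have hmul : ∀ g h, A (g * h) = A g * A h := fun g h => by
    simp only [A, map_mul, Module.End.mul_eq_comp]
    exact LinearMap.toMatrix_comp b b b _ _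
  have hone : A 1 = 1 := by simp [A, Module.End.one_eq_id]
  have htr : ∀ g, ρ.character g = (A g).trace := fun g => by
    rw [Representation.character, LinearMap.trace_eq_matrix_trace ℂ b]
  let P := ∑ g, (A g).conjTranspose * A g
  have hP : P.PosDef := by
    have h1 : P = (A 1).conjTranspose * A 1 +
        ∑ g ∈ Finset.univ.erase 1, (A g).conjTranspose * A g :=
      (Finset.add_sum_erase _ _ (Finset.mem_univ _)).symm
    rw [h1]
    refine Matrix.PosDef.add_posSemidef ?_ ?_
    · rw [hone]; simpa using Matrix.PosDef.one
    · exact Matrix.posSemidef_sum _ fun g _ => Matrix.posSemidef_conjTranspose_mul_self _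
  have hinv : (A g).conjTranspose * P * A g = P := by
    simp only [P, Finset.mul_sum, Finset.sum_mul]
    rw [← Equiv.sum_comp (Equiv.mulRight g) (fun x => (A x).conjTranspose * A x)]
    refine Finset.sum_congr rfl fun x _ => ?_
    simp [hmul, Matrix.conjTranspose_mul, Matrix.mul_assoc]
  have hgg : A g * A g⁻¹ = 1 := by rw [← hmul, mul_inv_cancel, hone]
  have h2 : (A g).conjTranspose * P = P * A g⁻¹ := by
    calc (A g).conjTranspose * P = (A g).conjTranspose * P * (A g * A g⁻¹) := by simp [hgg]
      _ = P * A g⁻¹ := by rw [← Matrix.mul_assoc, hinv]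
  have hu : IsUnit P.det := (Matrix.isUnit_iff_isUnit_det _).1 hP.isUnit
  have h3 : A g⁻¹ = P⁻¹ * ((A g).conjTranspose * P) := by
    rw [h2, Matrix.nonsing_inv_mul_cancel_left _ _ hu]
  rw [htr, htr, h3, Matrix.trace_mul_comm, Matrix.mul_assoc, Matrix.mul_nonsing_inv _ hu,
    Matrix.mul_one, Matrix.trace_conjTranspose]
  rfl

/-- Schur's lemma for a representation with one-dimensional endomorphism algebra. -/
theorem exists_eq_smul_one {ρ : Representation ℂ G V}
    (hρ : finrank ℂ (IntertwiningMap ρ ρ) = 1) (f : V →ₗ[ℂ] V)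
    (hf : ∀ g, f ∘ₗ ρ g = ρ g ∘ₗ f) : ∃ c : ℂ, f = c • LinearMap.id := by
  obtain ⟨e, he, hspan⟩ := finrank_eq_one_iff'.1 hρ
  let i : IntertwiningMap ρ ρ := ⟨LinearMap.id, fun _ => rfl⟩
  have hi : i ≠ 0 := by
    intro h
    apply he
    ext v
    have : v = 0 := congrArg (fun j : IntertwiningMap ρ ρ => j.toLinearMap v) h
    simp [this]
  obtain ⟨c, hc⟩ := (finrank_eq_one_iff_of_nonzero' i hi).1 hρ ⟨f, hf⟩
  exact ⟨c, (congrArg IntertwiningMap.toLinearMap hc).symm⟩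

theorem finrank_pos_of_irreducible {ρ : Representation ℂ G V}
    (hρ : finrank ℂ (IntertwiningMap ρ ρ) = 1) : 0 < finrank ℂ V := by
  by_contra h
  have h0 : finrank ℂ V = 0 := by omega
  have := finrank_zero_iff.1 h0
  obtain ⟨e, he, -⟩ := finrank_eq_one_iff'.1 hρ
  exact he (by ext v; exact Subsingleton.elim _ _)

theorem actionOf_eq_smul [Fintype G] {ρ : Representation ℂ G V}
    (hρ : finrank ℂ (IntertwiningMap ρ ρ) = 1) {a : G → ℂ}
    (ha : ∀ g h, a (h * g * h⁻¹) = a g) :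
    ∃ c : ℂ, actionOf ρ a = c • LinearMap.id ∧
      ∑ g, a g * ρ.character g = c * ρ.character 1 := by
  obtain ⟨c, hc⟩ := exists_eq_smul_one hρ _ (actionOf_comm ρ ha)
  refine ⟨c, hc, ?_⟩
  rw [← trace_actionOf, hc]
  simp [Representation.character, Module.End.one_eq_id]

/-- The elements of a normal subgroup either sum to zero in an irreducible representation, or they
all act trivially. -/
theorem sum_eq_zero_or_forall_eq_one (N : Subgroup G) [N.Normal] [Fintype N]
    {ρ : Representation ℂ G V}
    (hρ : finrank ℂ (IntertwiningMap ρ ρ) = 1) :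
    ∑ n : N, ρ n = 0 ∨ ∀ n ∈ N, ρ n = 1 := by
  set e : V →ₗ[ℂ] V := ∑ n : N, ρ n with he
  have hcomm : ∀ g, e ∘ₗ ρ g = ρ g ∘ₗ e := by
    intro g
    simp only [e, ← Module.End.mul_eq_comp, Finset.sum_mul, Finset.mul_sum, ← map_mul]
    rw [← Equiv.sum_comp (MulAut.conjNormal g : N ≃* N).toEquiv]
    refine Finset.sum_congr rfl fun n _ => ?_
    have h : (((MulAut.conjNormal g : N ≃* N).toEquiv n : N) : G) = g * n * g⁻¹ := rfl
    rw [h, inv_mul_cancel_right]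
  have hfix : ∀ n ∈ N, ρ n ∘ₗ e = e := by
    intro n hn
    simp only [e, ← Module.End.mul_eq_comp, Finset.mul_sum, ← map_mul]
    exact Equiv.sum_comp (Equiv.mulLeft (⟨n, hn⟩ : N)) (fun m : N => ρ m)
  obtain ⟨c, hc⟩ := exists_eq_smul_one hρ e hcomm
  by_cases h0 : c = 0
  · left
    rw [hc, h0, zero_smul]
  · right
    intro n hn
    have h2 := hfix n hn
    rw [hc, LinearMap.comp_smul, LinearMap.comp_id] at h2
    exact smul_right_injective _ h0 h2

end Representations

section Characters

variable {G : Type} [Group G]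

theorem cInner_eq [Fintype G] (α β : G → ℂ) :
    cInner G α β = (Nat.card G : ℂ)⁻¹ * ∑ g, α g * (starRingEnd ℂ) (β g) := by
  rw [cInner, finsum_eq_sum_of_fintype]

theorem finrank_intertwiningMap_ofModule' (M : Type) [AddCommGroup M] [Module ℂ M]
    [FiniteDimensional ℂ M] [Module (MonoidAlgebra ℂ G) M] [IsScalarTower ℂ (MonoidAlgebra ℂ G) M]
    [IsSimpleModule (MonoidAlgebra ℂ G) M] :
    finrank ℂ (IntertwiningMap (ofModule' (k := ℂ) (G := G) M) (ofModule' M)) = 1 := by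
  have := IsSimpleModule.nontrivial (MonoidAlgebra ℂ G) M
  refine finrank_eq_one (⟨LinearMap.id, fun _ => rfl⟩ : IntertwiningMap _ _) ?_ ?_
  · intro h
    obtain ⟨v, hv⟩ := exists_ne (0 : M)
    exact hv (congrArg (fun j : IntertwiningMap _ _ => j.toLinearMap v) h)
  · intro f
    let F : M →ₗ[MonoidAlgebra ℂ G] M := MonoidAlgebra.equivariantOfLinearOfComm f.toLinearMap
      fun g v => f.isIntertwining _ _ g v
    obtain ⟨c, hc⟩ := (IsSimpleModule.algebraMap_end_bijective_of_isAlgClosed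
      (A := MonoidAlgebra ℂ G) (V := M) ℂ).2 F
    refine ⟨c, ?_⟩
    ext v
    exact congrArg (fun j : M →ₗ[MonoidAlgebra ℂ G] M => j v) hc

variable [Finite G]

theorem card_ne_zero (G : Type) [Group G] [Finite G] : (Nat.card G : ℂ) ≠ 0 :=
  Nat.cast_ne_zero.2 Nat.card_pos.ne'

theorem Irr_conj {χ : G → ℂ} (hχ : χ ∈ Irr G) (g h : G) : χ (h * g * h⁻¹) = χ g := by
  obtain ⟨V, _, _, _, ρ, -, rfl⟩ := mem_Irr_iff.1 hχ
  exact char_conj ρ g h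

theorem Irr_one {χ : G → ℂ} (hχ : χ ∈ Irr G) : ∃ d : ℕ, 0 < d ∧ χ 1 = d := by
  obtain ⟨V, _, _, _, ρ, hρ, rfl⟩ := mem_Irr_iff.1 hχ
  exact ⟨_, finrank_pos_of_irreducible hρ, by simp⟩

theorem Irr_one_ne_zero {χ : G → ℂ} (hχ : χ ∈ Irr G) : χ 1 ≠ 0 := by
  obtain ⟨d, hd, h⟩ := Irr_one hχ
  rw [h]
  exact_mod_cast hd.ne'

theorem cInner_self {χ : G → ℂ} (hχ : χ ∈ Irr G) : cInner G χ χ = 1 := by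
  have := Fintype.ofFinite G
  have := invertibleOfNonzero (card_ne_zero G)
  obtain ⟨V, _, _, _, ρ, hρ, rfl⟩ := mem_Irr_iff.1 hχ
  rw [cInner_eq]
  simp_rw [← character_inv_eq_conj]
  rw [card_inv_mul_sum_char_mul_char_eq_finrank, hρ, Nat.cast_one]

theorem cInner_of_ne {χ ψ : G → ℂ} (hχ : χ ∈ Irr G) (hψ : ψ ∈ Irr G) (hne : χ ≠ ψ) :
    cInner G χ ψ = 0 := by
  have := Fintype.ofFinite G
  have := invertibleOfNonzero (card_ne_zero G)
  obtain ⟨V, hV, rfl⟩ := hχ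
  obtain ⟨W, hW, rfl⟩ := hψ
  have h := FDRep.char_orthonormal V W
  rw [if_neg fun ⟨i⟩ => hne (FDRep.char_iso i)] at h
  rw [cInner_eq, ← h]
  congr 1
  refine Finset.sum_congr rfl fun g _ => ?_
  congr 1
  exact (character_inv_eq_conj (V := W) W.ρ g).symm

/-- The pairing with a fixed function on the right, as a linear functional. -/
noncomputable def cInnerLeft (β : G → ℂ) : (G → ℂ) →ₗ[ℂ] ℂ where
  toFun α := cInner G α β
  map_add' x y := by
    have := Fintype.ofFinite G
    simp [cInner_eq, add_mul, Finset.sum_add_distrib, mul_add]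
  map_smul' c x := by
    have := Fintype.ofFinite G
    simp only [cInner_eq, Pi.smul_apply, smul_eq_mul, RingHom.id_apply, mul_assoc,
      ← Finset.mul_sum]
    ring

@[simp]
theorem cInnerLeft_apply (α β : G → ℂ) : cInnerLeft β α = cInner G α β := rfl

theorem sum_single_smul_eq_zero [Fintype G] {b : G → ℂ} (hb : ∀ g h, b (h * g * h⁻¹) = b g)
    (h0 : ∀ χ ∈ Irr G, ∑ g, b g * χ g = 0) (M : Type) [AddCommGroup M] [Module ℂ M]
    [FiniteDimensional ℂ M] [Module (MonoidAlgebra ℂ G) M] [IsScalarTower ℂ (MonoidAlgebra ℂ G) M]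
    [IsSimpleModule (MonoidAlgebra ℂ G) M] (m : M) :
    (∑ g, MonoidAlgebra.single g (b g) : MonoidAlgebra ℂ G) • m = 0 := by
  have hρ := finrank_intertwiningMap_ofModule' (G := G) M
  have hmem := mem_Irr_iff.2 ⟨M, _, _, inferInstance, _, hρ, rfl⟩
  obtain ⟨c, hc, hc'⟩ := actionOf_eq_smul hρ hb
  have hc0 : c = 0 := by
    rw [h0 _ hmem] at hc'
    exact (mul_eq_zero.1 hc'.symm).resolve_right (Irr_one_ne_zero hmem)
  rw [hc0, zero_smul] at hc
  have h := congrArg (fun f : M →ₗ[ℂ] M => f m) hc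
  simp only [actionOf, LinearMap.sum_apply, LinearMap.smul_apply, LinearMap.zero_apply] at h
  rw [← h, Finset.sum_smul]
  refine Finset.sum_congr rfl fun g _ => ?_
  have h1 : MonoidAlgebra.single g (b g) = b g • MonoidAlgebra.single g (1 : ℂ) := by simp
  rw [h1, smul_assoc]
  rfl

/-- A class function orthogonal to every irreducible character vanishes. -/
theorem eq_zero_of_forall_cInner_eq_zero {a : G → ℂ} (ha : ∀ g h, a (h * g * h⁻¹) = a g)
    (h0 : ∀ χ ∈ Irr G, cInner G a χ = 0) : a = 0 := by
  have := Fintype.ofFinite G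
  let b : G → ℂ := fun g => (starRingEnd ℂ) (a g)
  let z : MonoidAlgebra ℂ G := ∑ g, MonoidAlgebra.single g (b g)
  have hb0 : ∀ χ ∈ Irr G, ∑ g, b g * χ g = 0 := by
    intro χ hχ
    have h1 := h0 χ hχ
    rw [cInner_eq, mul_eq_zero, or_iff_right (inv_ne_zero (card_ne_zero G))] at h1
    simpa [b] using congrArg (starRingEnd ℂ) h1
  have hsimple : ∀ S : Submodule (MonoidAlgebra ℂ G) (MonoidAlgebra ℂ G),
      IsSimpleModule (MonoidAlgebra ℂ G) S → ∀ s ∈ S, z * s = 0 := by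
    intro S hS s hs
    exact congrArg Subtype.val
      (sum_single_smul_eq_zero (fun g h => by simp [b, ha]) hb0 S ⟨s, hs⟩)
  have hall : ∀ x : MonoidAlgebra ℂ G, z * x = 0 := by
    intro x
    have hx : x ∈ sSup {S : Submodule (MonoidAlgebra ℂ G) (MonoidAlgebra ℂ G) |
        IsSimpleModule (MonoidAlgebra ℂ G) S} := by
      rw [IsSemisimpleModule.sSup_simples_eq_top]; trivial
    rw [sSup_eq_iSup'] at hx
    induction hx using Submodule.iSup_induction' with
    | mem S y hy => exact hsimple S.1 S.2 y hy
    | zero => simp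
    | add y y' _ _ h h' => rw [mul_add, h, h', add_zero]
  have hz := hall 1
  rw [mul_one] at hz
  funext g
  have h1 := congrArg (fun w => w.coeff g) hz
  simp only [z, MonoidAlgebra.coeff_sum, MonoidAlgebra.coeff_single, Finsupp.finsetSum_apply,
    MonoidAlgebra.coeff_zero, Finsupp.zero_apply] at h1
  rw [Finset.sum_eq_single g (by simp +contextual) (by simp)] at h1
  simpa [b] using h1

theorem eq_of_forall_cInner_eq {a b : G → ℂ} (ha : ∀ g h, a (h * g * h⁻¹) = a g)
    (hb : ∀ g h, b (h * g * h⁻¹) = b g)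
    (h : ∀ χ ∈ Irr G, cInner G a χ = cInner G b χ) : a = b := by
  rw [← sub_eq_zero]
  refine eq_zero_of_forall_cInner_eq_zero (fun g x => by simp [ha, hb]) fun χ hχ => ?_
  rw [← cInnerLeft_apply, map_sub, cInnerLeft_apply, cInnerLeft_apply, h χ hχ, sub_self]

theorem linearIndependent_Irr : LinearIndependent ℂ (fun χ : Irr G => (χ : G → ℂ)) := by
  rw [linearIndependent_iff']
  intro s c hc χ hχ
  have h := congrArg (cInnerLeft (χ : G → ℂ)) hc
  rw [map_sum, map_zero, Finset.sum_eq_single χ] at h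
  · simpa [cInner_self χ.2] using h
  · intro ψ _ hne
    simp [cInner_of_ne ψ.2 χ.2 (fun h => hne (Subtype.ext h))]
  · exact fun h => absurd hχ h

theorem Irr_finite : (Irr G).Finite :=
  have := linearIndependent_Irr (G := G).finite
  Set.toFinite _

theorem sigmaChar_eq_sum {X : Set (G → ℂ)} (hX : X ⊆ Irr G) :
    sigmaChar X = ∑ ψ ∈ (Irr_finite.subset hX).toFinset, ψ 1 • ψ := by
  funext g
  rw [sigmaChar, finsum_mem_eq_finite_toFinset_sum _ (Irr_finite.subset hX)]
  simp

theorem sigmaChar_conj {X : Set (G → ℂ)} (hX : X ⊆ Irr G) (g h : G) :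
    sigmaChar X (h * g * h⁻¹) = sigmaChar X g := by
  simp only [sigmaChar_eq_sum hX, Finset.sum_apply, Pi.smul_apply]
  refine Finset.sum_congr rfl fun ψ hψ => ?_
  rw [Irr_conj (hX ((Set.Finite.mem_toFinset _).1 hψ))]

theorem cInner_sigmaChar_of_mem {X : Set (G → ℂ)} (hX : X ⊆ Irr G) {χ : G → ℂ} (hχ : χ ∈ X) :
    cInner G (sigmaChar X) χ = χ 1 := by
  rw [← cInnerLeft_apply, sigmaChar_eq_sum hX, map_sum, Finset.sum_eq_single χ]
  · simp [cInner_self (hX hχ)]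
  · intro ψ hψ hne
    simp [cInner_of_ne (hX ((Set.Finite.mem_toFinset _).1 hψ)) (hX hχ) hne]
  · intro h
    exact absurd ((Set.Finite.mem_toFinset _).2 hχ) h

theorem cInner_sigmaChar_of_notMem {X : Set (G → ℂ)} (hX : X ⊆ Irr G) {χ : G → ℂ}
    (hχ : χ ∈ Irr G) (hχX : χ ∉ X) : cInner G (sigmaChar X) χ = 0 := by
  rw [← cInnerLeft_apply, sigmaChar_eq_sum hX, map_sum]
  refine Finset.sum_eq_zero fun ψ hψ => ?_
  have hψ' := (Set.Finite.mem_toFinset _).1 hψ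
  simp [cInner_of_ne (hX hψ') hχ (fun h => hχX (h ▸ hψ'))]

/-- An irreducible character either averages to zero over every coset of a normal subgroup or is
constant on these cosets. -/
theorem Irr_coset_dichotomy (N : Subgroup G) [N.Normal] {χ : G → ℂ} (hχ : χ ∈ Irr G) :
    (∀ g, ∑ᶠ n : N, χ (g * n) = 0) ∨ ∀ g, ∀ n ∈ N, χ (g * n) = χ g := by
  have := Fintype.ofFinite N
  obtain ⟨V, _, _, _, ρ, hρ, rfl⟩ := mem_Irr_iff.1 hχ
  rcases sum_eq_zero_or_forall_eq_one N hρ with h | h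
  · left
    intro g
    rw [finsum_eq_sum_of_fintype, sum_character_coset, h]
    simp
  · right
    intro g n hn
    simp [Representation.character, h n hn]

theorem mem_IrrOver_iff {N : Subgroup G} [N.Normal] {χ : G → ℂ} (hχ : χ ∈ Irr G) :
    χ ∈ IrrOver N ↔ ∀ g, ∀ n ∈ N, χ (g * n) = χ g := by
  refine ⟨fun h => (Irr_coset_dichotomy N hχ).resolve_left fun h0 => ?_,
    fun h => ⟨hχ, fun n hn => by simpa using h 1 n hn⟩⟩
  have h1 := h0 1
  have := Fintype.ofFinite N
  rw [finsum_eq_sum_of_fintype, Finset.sum_congr rfl fun n _ => by rw [one_mul, h.2 n n.2]] at h1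
  simp [Irr_one_ne_zero hχ] at h1

theorem sum_coset_eq_zero {N : Subgroup G} [N.Normal] {χ : G → ℂ} (hχ : χ ∈ Irr G)
    (h : χ ∉ IrrOver N) (g : G) : ∑ᶠ n : N, χ (g * n) = 0 :=
  (Irr_coset_dichotomy N hχ).resolve_right (fun h' => h ((mem_IrrOver_iff hχ).2 h')) g

/-- The multiplicity of an irreducible character in a restricted character is a natural number. -/
theorem cInner_resChar_eq_natCast (M : Subgroup G) {χ : G → ℂ} (hχ : χ ∈ Irr G) {ψ : M → ℂ}
    (hψ : ψ ∈ Irr M) : ∃ k : ℕ, cInner M (resChar M χ) ψ = k := by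
  have := Fintype.ofFinite M
  have := invertibleOfNonzero (card_ne_zero M)
  obtain ⟨V, _, _, _, ρ, hρ, rfl⟩ := mem_Irr_iff.1 hχ
  obtain ⟨W, _, _, _, σ, hσ, rfl⟩ := mem_Irr_iff.1 hψ
  refine ⟨finrank ℂ (IntertwiningMap σ (ρ.comp M.subtype : Representation ℂ M V)), ?_⟩
  rw [cInner_eq]
  simp_rw [← character_inv_eq_conj]
  exact card_inv_mul_sum_char_mul_char_eq_finrank σ (ρ.comp M.subtype)

/-- Central characters are compatible with restriction to a normal subgroup. -/
theorem central_character_restrict (M : Subgroup G) [hM : M.Normal] {χ : G → ℂ} (hχ : χ ∈ Irr G)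
    {ψ : M → ℂ} (hψ : ψ ∈ Irr M) (h : cInner M (resChar M χ) ψ ≠ 0) {a : M → ℂ}
    (ha : ∀ g m, a (conjSub hM g m) = a m) :
    (∑ᶠ m : M, a m * χ m) * ψ 1 = (∑ᶠ m : M, a m * ψ m) * χ 1 := by
  have := Fintype.ofFinite G
  have := Fintype.ofFinite M
  have := invertibleOfNonzero (card_ne_zero M)
  obtain ⟨V, _, _, _, ρ, hρ, rfl⟩ := mem_Irr_iff.1 hχ
  obtain ⟨W, _, _, _, σ, hσ, rfl⟩ := mem_Irr_iff.1 hψ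
  simp only [finsum_eq_sum_of_fintype]
  let τ : Representation ℂ M V := ρ.comp M.subtype
  have hfin : cInner M (resChar M ρ.character) σ.character =
      finrank ℂ (IntertwiningMap σ τ) := by
    rw [cInner_eq]
    simp_rw [← character_inv_eq_conj]
    exact card_inv_mul_sum_char_mul_char_eq_finrank σ τ
  obtain ⟨f, hf⟩ : ∃ f : IntertwiningMap σ τ, f ≠ 0 := by
    by_contra! hall
    have : Subsingleton (IntertwiningMap σ τ) := ⟨fun f g => by rw [hall f, hall g]⟩
    exact h (by rw [hfin, finrank_zero_of_subsingleton, Nat.cast_zero])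
  have hcomm : ∀ g, actionOf τ a ∘ₗ ρ g = ρ g ∘ₗ actionOf τ a := by
    intro g
    simp only [actionOf, τ, MonoidHom.comp_apply, ← Module.End.mul_eq_comp, Finset.sum_mul,
      Finset.mul_sum, smul_mul_assoc, mul_smul_comm, ← map_mul]
    rw [← Equiv.sum_comp (MulAut.conjNormal g : M ≃* M).toEquiv]
    refine Finset.sum_congr rfl fun m _ => ?_
    have h1 : (MulAut.conjNormal g : M ≃* M).toEquiv m = conjSub hM g m := rfl
    rw [h1, ha]
    have h2 : (M.subtype (conjSub hM g m) : G) = g * m * g⁻¹ := rfl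
    rw [h2, inv_mul_cancel_right]
    rfl
  obtain ⟨c, hc⟩ := exists_eq_smul_one hρ _ hcomm
  obtain ⟨d, hd, hd'⟩ := actionOf_eq_smul hσ (a := a)
    (fun g h => by rw [← ha (h : G) g]; rfl)
  have hc' : ∑ m : M, a m * ρ.character m = c * ρ.character 1 := by
    have h1 := trace_actionOf τ a
    rw [hc] at h1
    rw [show ∑ m : M, a m * ρ.character m = ∑ m : M, a m * τ.character m from rfl, ← h1]
    simp [Representation.character, Module.End.one_eq_id]
  have hcd : c = d := by
    have h1 : actionOf τ a ∘ₗ f.toLinearMap = f.toLinearMap ∘ₗ actionOf σ a := by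
      ext w
      simp only [actionOf, LinearMap.comp_apply, LinearMap.sum_apply, LinearMap.smul_apply,
        map_sum, map_smul]
      refine Finset.sum_congr rfl fun m _ => ?_
      congr 1
      exact (f.isIntertwining _ _ m w).symm
    rw [hc, hd, LinearMap.smul_comp, LinearMap.comp_smul, LinearMap.id_comp,
      LinearMap.comp_id] at h1
    exact smul_left_injective ℂ (m := f.toLinearMap)
      (fun h2 => hf (by ext w; exact congrArg (fun j : W →ₗ[ℂ] V => j w) h2)) h1
  rw [hc', hd', hcd]
  ring

end Characters

section Inflation

variable {G Q : Type} [Group G] [Group Q]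

theorem finrank_intertwiningMap_comp {V : Type} [AddCommGroup V] [Module ℂ V] {π : G →* Q}
    (hπ : Function.Surjective π) (ρ : Representation ℂ Q V) :
    finrank ℂ (IntertwiningMap (ρ.comp π : Representation ℂ G V) (ρ.comp π)) =
      finrank ℂ (IntertwiningMap ρ ρ) := by
  refine LinearEquiv.finrank_eq
    { toFun := fun f => ⟨f.toLinearMap, fun q => ?_⟩
      invFun := fun f => ⟨f.toLinearMap, fun g => f.isIntertwining' (π g)⟩
      map_add' := fun _ _ => rfl
      map_smul' := fun _ _ => rfl
      left_inv := fun _ => rfl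
      right_inv := fun _ => rfl }
  obtain ⟨g, rfl⟩ := hπ q
  exact f.isIntertwining' g

variable [Finite G] [Finite Q]

theorem Irr_comp {π : G →* Q} (hπ : Function.Surjective π) {η : Q → ℂ} (hη : η ∈ Irr Q) :
    η ∘ π ∈ Irr G := by
  obtain ⟨V, _, _, _, ρ, hρ, rfl⟩ := mem_Irr_iff.1 hη
  exact mem_Irr_iff.2 ⟨V, _, _, inferInstance, ρ.comp π,
    (finrank_intertwiningMap_comp hπ ρ).trans hρ, rfl⟩

theorem exists_Irr_comp_eq {π : G →* Q} (hπ : Function.Surjective π) {χ : G → ℂ}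
    (hχ : χ ∈ IrrOver π.ker) : ∃ η ∈ Irr Q, η ∘ π = χ := by
  have := Fintype.ofFinite π.ker
  have hχ' := (mem_IrrOver_iff hχ.1).1 hχ
  obtain ⟨V, _, _, _, ρ, hρ, rfl⟩ := mem_Irr_iff.1 hχ.1
  have hker : ∀ n ∈ π.ker, ρ n = 1 := by
    refine (sum_eq_zero_or_forall_eq_one π.ker hρ).resolve_left fun h => ?_
    have h1 := sum_character_coset π.ker ρ 1
    rw [h, Finset.sum_congr rfl fun (n : π.ker) _ => hχ' 1 n n.2] at h1
    simp [(finrank_pos_of_irreducible hρ).ne'] at h1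
  have hlift : ∀ g h, π g = π h → ρ g = ρ h := by
    intro g h hgh
    have h1 := hker (g⁻¹ * h) (by simp [MonoidHom.mem_ker, hgh])
    rw [← mul_one (ρ g), ← h1, ← map_mul, mul_inv_cancel_left]
  have hs := Function.surjInv_eq hπ
  let σ : Representation ℂ Q V :=
    { toFun := fun q => ρ (Function.surjInv hπ q)
      map_one' := by rw [← map_one ρ]; exact hlift _ _ (by rw [hs, map_one])
      map_mul' := fun p q => by
        rw [← map_mul ρ]
        exact hlift _ _ (by rw [map_mul, hs, hs, hs]) }
  have hσ : (σ.comp π : Representation ℂ G V) = ρ := by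
    ext1 g
    exact hlift _ _ (hs _)
  refine ⟨σ.character, mem_Irr_iff.2 ⟨V, _, _, inferInstance, σ, ?_, rfl⟩, ?_⟩
  · rw [← finrank_intertwiningMap_comp hπ σ, hσ, hρ]
  · change Representation.character (σ.comp π : Representation ℂ G V) = _
    rw [hσ]

theorem cInner_comp {π : G →* Q} (hπ : Function.Surjective π) (α β : Q → ℂ) :
    cInner G (α ∘ π) (β ∘ π) = cInner Q α β := by
  have := Fintype.ofFinite G
  have := Fintype.ofFinite Q
  have hfib : ∀ q : Q, (Finset.univ.filter fun g => π g = q).card =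
      (Finset.univ.filter fun g => π g = 1).card := fun q =>
    MonoidHom.card_fiber_eq_of_mem_range π (hπ q) (hπ 1)
  have key : ∀ f : Q → ℂ, ∑ g, f (π g) =
      ((Finset.univ.filter fun g => π g = 1).card : ℂ) * ∑ q, f q := by
    intro f
    rw [← Finset.sum_fiberwise Finset.univ π, Finset.mul_sum]
    refine Finset.sum_congr rfl fun q _ => ?_
    rw [Finset.sum_congr rfl fun g hg => by rw [(Finset.mem_filter.1 hg).2], Finset.sum_const,
      hfib, nsmul_eq_mul]
  have hcard := key 1
  simp only [Pi.one_apply, Finset.sum_const, Finset.card_univ, nsmul_eq_mul, mul_one] at hcard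
  rw [cInner_eq, cInner_eq]
  have h1 := key fun q => α q * (starRingEnd ℂ) (β q)
  simp only [Function.comp_apply, h1, Nat.card_eq_fintype_card, hcard]
  have hQ := card_ne_zero Q
  have hG := card_ne_zero G
  rw [Nat.card_eq_fintype_card] at hQ hG
  rw [hcard] at hG
  have := left_ne_zero_of_mul hG
  field_simp

end Inflation

section Partitions

variable {α : Type*} {S : Set α} {P : Set (Set α)}

theorem partition_eq (hP : IsPartitionOf S P) {p q : Set α} (hp : p ∈ P) (hq : q ∈ P) {a : α}
    (hap : a ∈ p) (haq : a ∈ q) : p = q :=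
  (hP.2.2 a (hP.2.1 p hp hap)).unique ⟨hp, hap⟩ ⟨hq, haq⟩

theorem partition_nonempty (hP : IsPartitionOf S P) {p : Set α} (hp : p ∈ P) : p.Nonempty :=
  Set.nonempty_iff_ne_empty.2 fun h => hP.1 (h ▸ hp)

theorem partition_exists (hP : IsPartitionOf S P) {a : α} (ha : a ∈ S) : ∃ p ∈ P, a ∈ p :=
  (hP.2.2 a ha).exists

theorem isPartitionOf_of (hne : ∀ p ∈ P, p.Nonempty) (hsub : ∀ p ∈ P, p ⊆ S)
    (hex : ∀ a ∈ S, ∃ p ∈ P, a ∈ p) (heq : ∀ p ∈ P, ∀ q ∈ P, ∀ a ∈ p, a ∈ q → p ⊆ q) :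
    IsPartitionOf S P := by
  refine ⟨fun h => Set.not_nonempty_empty (hne _ h), hsub, fun a ha => ?_⟩
  obtain ⟨p, hp, hap⟩ := hex a ha
  exact ⟨p, ⟨hp, hap⟩, fun q ⟨hq, haq⟩ =>
    (heq q hq p hp a haq hap).antisymm (heq p hp q hq a hap haq)⟩

end Partitions

section Spans

variable {G : Type}

/-- The functions that are constant on every part of `𝒦`. -/
def constOn (𝒦 : Set (Set G)) : Submodule ℂ (G → ℂ) where
  carrier := {a | ∀ K ∈ 𝒦, ∀ g ∈ K, ∀ h ∈ K, a g = a h}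
  add_mem' ha hb K hK g hg h hh := by
    simp only [Pi.add_apply, ha K hK g hg h hh, hb K hK g hg h hh]
  zero_mem' _ _ _ _ _ _ := rfl
  smul_mem' c a ha K hK g hg h hh := by
    simp only [Pi.smul_apply, ha K hK g hg h hh]

theorem indicator_mem_constOn {𝒦 : Set (Set G)} (h𝒦 : IsPartitionOf Set.univ 𝒦) {K : Set G}
    (hK : K ∈ 𝒦) : K.indicator (1 : G → ℂ) ∈ constOn 𝒦 := by
  intro J hJ g hg h hh
  have : g ∈ K ↔ h ∈ K :=
    ⟨fun hgK => partition_eq h𝒦 hJ hK hg hgK ▸ hh, fun hhK => partition_eq h𝒦 hJ hK hh hhK ▸ hg⟩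
  simp [Set.indicator_apply, this]

theorem finrank_constOn [Finite G] {𝒦 : Set (Set G)} (h𝒦 : IsPartitionOf Set.univ 𝒦) :
    finrank ℂ (constOn 𝒦) = 𝒦.ncard := by
  have := Fintype.ofFinite 𝒦
  choose r hr using fun K : 𝒦 => partition_nonempty h𝒦 K.2
  choose s hs hs' using fun g : G => partition_exists h𝒦 (Set.mem_univ g)
  let e : constOn 𝒦 ≃ₗ[ℂ] (𝒦 → ℂ) :=
    { toFun := fun a K => a.1 (r K)
      invFun := fun f => ⟨fun g => f ⟨s g, hs g⟩, fun K hK g hg h hh => by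
        refine congrArg f (Subtype.ext ?_)
        exact (partition_eq h𝒦 (hs g) hK (hs' g) hg).trans
          (partition_eq h𝒦 hK (hs h) hh (hs' h))⟩
      map_add' := fun _ _ => rfl
      map_smul' := fun _ _ => rfl
      left_inv := fun a => by
        ext g
        exact a.2 (s g) (hs g) _ (hr ⟨s g, hs g⟩) _ (hs' g)
      right_inv := fun f => by
        funext K
        change f _ = f _
        congr 1
        exact Subtype.ext (partition_eq h𝒦 (hs _) K.2 (hs' _) (hr K)) }
  rw [e.finrank_eq, finrank_fintype_fun_eq_card, ← Nat.card_eq_fintype_card,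
    Nat.card_coe_set_eq]

variable [Group G]

theorem subset_of_mem_CNormal {𝒦 : Set (Set G)} (h𝒦 : IsPartitionOf Set.univ 𝒦) {N : Subgroup G}
    (hN : CNormal 𝒦 N) {K : Set G} (hK : K ∈ 𝒦) {g : G} (hg : g ∈ K) (hgN : g ∈ N) :
    K ⊆ N := by
  obtain ⟨T, hT, hNT⟩ := hN
  have hgN' : g ∈ (N : Set G) := hgN
  rw [hNT] at hgN'
  obtain ⟨J, hJ, hgJ⟩ := hgN'
  rw [partition_eq h𝒦 hK (hT hJ) hg hgJ, hNT]
  exact Set.subset_sUnion_of_mem hJ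

theorem indicator_CNormal_mem_constOn {𝒦 : Set (Set G)}
    (h𝒦 : IsPartitionOf Set.univ 𝒦) {N : Subgroup G} (hN : CNormal 𝒦 N) :
    (N : Set G).indicator (1 : G → ℂ) ∈ constOn 𝒦 := by
  intro K hK g hg h hh
  have : g ∈ N ↔ h ∈ N :=
    ⟨fun h1 => subset_of_mem_CNormal h𝒦 hN hK hg h1 hh,
      fun h1 => subset_of_mem_CNormal h𝒦 hN hK hh h1 hg⟩
  simp [Set.indicator_apply, this]

theorem zeroExtend_mem_constOn {𝒦 : Set (Set G)} (h𝒦 : IsPartitionOf Set.univ 𝒦)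
    {M : Subgroup G} (hM : CNormal 𝒦 M) {b : M → ℂ}
    (hb : b ∈ constOn ((fun K => (Subtype.val ⁻¹' K : Set M)) '' {K ∈ 𝒦 | K ⊆ (M : Set G)})) :
    zeroExtend M b ∈ constOn 𝒦 := by
  intro K hK g hg h hh
  by_cases hgM : g ∈ M
  · have hKM := subset_of_mem_CNormal h𝒦 hM hK hg hgM
    have hhM : h ∈ M := hKM hh
    simp only [zeroExtend, hgM, hhM, dif_pos]
    exact hb _ ⟨K, ⟨hK, hKM⟩, rfl⟩ _ hg _ hh
  · have hhM : h ∉ M := fun hhM => hgM (subset_of_mem_CNormal h𝒦 hM hK hh hhM hg)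
    simp only [zeroExtend, hgM, hhM, dif_neg, not_false_eq_true]

variable [Finite G]

theorem linearIndependent_sigmaChar {𝒳 : Set (Set (G → ℂ))} (h𝒳 : IsPartitionOf (Irr G) 𝒳) :
    LinearIndependent ℂ (fun X : 𝒳 => sigmaChar (X : Set (G → ℂ))) := by
  rw [linearIndependent_iff']
  intro s c hc X hX
  obtain ⟨χ, hχ⟩ := partition_nonempty h𝒳 X.2
  have h := congrArg (cInnerLeft χ) hc
  rw [map_sum, map_zero, Finset.sum_eq_single X] at h
  · simpa [cInner_sigmaChar_of_mem (h𝒳.2.1 X X.2) hχ,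
      Irr_one_ne_zero (h𝒳.2.1 X X.2 hχ)] using h
  · intro Y _ hne
    rw [map_smul, cInnerLeft_apply, cInner_sigmaChar_of_notMem (h𝒳.2.1 Y Y.2)
      (h𝒳.2.1 X X.2 hχ) (fun h => hne (Subtype.ext (partition_eq h𝒳 Y.2 X.2 h hχ))), smul_zero]
  · exact fun h => absurd hX h

theorem parts_finite {𝒳 : Set (Set (G → ℂ))} (h𝒳 : IsPartitionOf (Irr G) 𝒳) : 𝒳.Finite :=
  Irr_finite.finite_subsets.subset h𝒳.2.1

theorem finrank_span_sigmaChar {𝒳 : Set (Set (G → ℂ))} (h𝒳 : IsPartitionOf (Irr G) 𝒳) :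
    finrank ℂ (Submodule.span ℂ (sigmaChar '' 𝒳)) = 𝒳.ncard := by
  have := (parts_finite h𝒳).fintype
  rw [Set.image_eq_range, finrank_span_eq_card (linearIndependent_sigmaChar h𝒳),
    ← Nat.card_eq_fintype_card, Nat.card_coe_set_eq]

theorem constOn_eq_span {𝒳 : Set (Set (G → ℂ))} {𝒦 : Set (Set G)} (h : IsSCT G 𝒳 𝒦) :
    constOn 𝒦 = Submodule.span ℂ (sigmaChar '' 𝒳) := by
  obtain ⟨h𝒳, h𝒦, hcard, -, hσ⟩ := h
  refine (Submodule.eq_of_le_of_finrank_eq (Submodule.span_le.2 ?_) ?_).symm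
  · rintro _ ⟨X, hX, rfl⟩
    exact hσ X hX
  · rw [finrank_constOn h𝒦, finrank_span_sigmaChar h𝒳, hcard]

theorem isSCT_of_constOn_le {𝒳 : Set (Set (G → ℂ))} {𝒦 : Set (Set G)}
    (h𝒳 : IsPartitionOf (Irr G) 𝒳) (h𝒦 : IsPartitionOf Set.univ 𝒦) (h1 : {1} ∈ 𝒦)
    (hσ : ∀ X ∈ 𝒳, sigmaChar X ∈ constOn 𝒦)
    (hle : constOn 𝒦 ≤ Submodule.span ℂ (sigmaChar '' 𝒳)) : IsSCT G 𝒳 𝒦 := by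
  refine ⟨h𝒳, h𝒦, ?_, h1, hσ⟩
  rw [← finrank_constOn h𝒦, ← finrank_span_sigmaChar h𝒳, hle.antisymm (Submodule.span_le.2 _)]
  rintro _ ⟨X, hX, rfl⟩
  exact hσ X hX

theorem constOn_conj {𝒳 : Set (Set (G → ℂ))} {𝒦 : Set (Set G)} (h : IsSCT G 𝒳 𝒦) {a : G → ℂ}
    (ha : a ∈ constOn 𝒦) (g x : G) : a (x * g * x⁻¹) = a g := by
  rw [constOn_eq_span h] at ha
  induction ha using Submodule.span_induction with
  | mem a ha =>
    obtain ⟨X, hX, rfl⟩ := ha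
    exact sigmaChar_conj (h.1.2.1 X hX) g x
  | zero => rfl
  | add a b _ _ ha hb => simp [ha, hb]
  | smul c a _ ha => simp [ha]

theorem constOn_ratio {𝒳 : Set (Set (G → ℂ))} {𝒦 : Set (Set G)} (h : IsSCT G 𝒳 𝒦) {a : G → ℂ}
    (ha : a ∈ constOn 𝒦) {X : Set (G → ℂ)} (hX : X ∈ 𝒳) {χ χ' : G → ℂ} (hχ : χ ∈ X)
    (hχ' : χ' ∈ X) : cInner G a χ * χ' 1 = cInner G a χ' * χ 1 := by
  rw [constOn_eq_span h] at ha
  simp only [← cInnerLeft_apply]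
  induction ha using Submodule.span_induction with
  | mem a ha =>
    obtain ⟨Y, hY, rfl⟩ := ha
    simp only [cInnerLeft_apply]
    by_cases hXY : X = Y
    · subst hXY
      rw [cInner_sigmaChar_of_mem (h.1.2.1 X hX) hχ, cInner_sigmaChar_of_mem (h.1.2.1 X hX) hχ',
        mul_comm]
    · rw [cInner_sigmaChar_of_notMem (h.1.2.1 Y hY) (h.1.2.1 X hX hχ)
          fun h' => hXY (partition_eq h.1 hX hY hχ h'),
        cInner_sigmaChar_of_notMem (h.1.2.1 Y hY) (h.1.2.1 X hX hχ')
          fun h' => hXY (partition_eq h.1 hX hY hχ' h'), zero_mul, zero_mul]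
  | zero => rw [map_zero, map_zero, zero_mul, zero_mul]
  | add a b _ _ ha hb => rw [map_add, map_add, add_mul, add_mul, ha, hb]
  | smul c a _ ha => rw [map_smul, map_smul, smul_mul_assoc, smul_mul_assoc, ha]

theorem mem_span_of_ratio {𝒳 : Set (Set (G → ℂ))} (h𝒳 : IsPartitionOf (Irr G) 𝒳) {a : G → ℂ}
    (ha : ∀ g x, a (x * g * x⁻¹) = a g)
    (hr : ∀ X ∈ 𝒳, ∀ χ ∈ X, ∀ χ' ∈ X, cInner G a χ * χ' 1 = cInner G a χ' * χ 1) :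
    a ∈ Submodule.span ℂ (sigmaChar '' 𝒳) := by
  have := (parts_finite h𝒳).fintype
  choose r hr' using fun X : 𝒳 => partition_nonempty h𝒳 X.2
  have key : a = ∑ X : 𝒳, (cInner G a (r X) / r X 1) • sigmaChar (X : Set (G → ℂ)) := by
    refine eq_of_forall_cInner_eq ha (fun g x => ?_) fun χ hχ => ?_
    · simp only [Finset.sum_apply, Pi.smul_apply, sigmaChar_conj (h𝒳.2.1 _ (Subtype.coe_prop _))]
    · obtain ⟨X, hX, hχX⟩ := partition_exists h𝒳 hχ
      rw [← cInnerLeft_apply (∑ X : 𝒳, _), map_sum, Finset.sum_eq_single ⟨X, hX⟩]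
      · rw [map_smul, cInnerLeft_apply, cInner_sigmaChar_of_mem (h𝒳.2.1 X hX) hχX, smul_eq_mul,
          div_mul_eq_mul_div, eq_div_iff (Irr_one_ne_zero (h𝒳.2.1 X hX (hr' ⟨X, hX⟩)))]
        exact hr X hX _ hχX _ (hr' ⟨X, hX⟩)
      · intro Y _ hne
        rw [map_smul, cInnerLeft_apply, cInner_sigmaChar_of_notMem (h𝒳.2.1 Y Y.2) hχ
          (fun h => hne (Subtype.ext (partition_eq h𝒳 Y.2 hX h hχX))), smul_zero]
      · simp
  rw [key]
  exact Submodule.sum_mem _ fun X _ =>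
    Submodule.smul_mem _ _ (Submodule.subset_span ⟨X, X.2, rfl⟩)

theorem sigmaChar_mem_constOn {𝒳 : Set (Set (G → ℂ))} {𝒦 : Set (Set G)} (h : IsSCT G 𝒳 𝒦)
    {X : Set (G → ℂ)} (hX : X ∈ 𝒳) : sigmaChar X ∈ constOn 𝒦 :=
  h.2.2.2.2 X hX

theorem sigmaChar_one_ne_zero {X : Set (G → ℂ)} (hX : X ⊆ Irr G) (hne : X.Nonempty) :
    sigmaChar X 1 ≠ 0 := by
  have hnn : ∀ χ ∈ Irr G, 0 < χ 1 * χ 1 := by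
    intro χ hχ
    obtain ⟨d, hd, h⟩ := Irr_one hχ
    rw [h]
    exact_mod_cast Nat.mul_pos hd hd
  rw [sigmaChar_eq_sum hX, Finset.sum_apply]
  refine (Finset.sum_pos (fun χ hχ => hnn χ (hX ((Set.Finite.mem_toFinset _).1 hχ))) ?_).ne'
  obtain ⟨χ, hχ⟩ := hne
  exact ⟨χ, (Set.Finite.mem_toFinset _).2 hχ⟩

end Spans

section Restriction

variable {G : Type} [Group G] {𝒳 : Set (Set (G → ℂ))} {𝒦 : Set (Set G)}
  {M : Subgroup G}

theorem resChar_mem_constOn {a : G → ℂ} (ha : a ∈ constOn 𝒦) :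
    resChar M a ∈
      constOn ((fun K => (Subtype.val ⁻¹' K : Set M)) '' {K ∈ 𝒦 | K ⊆ (M : Set G)}) := by
  rintro _ ⟨K, ⟨hK, -⟩, rfl⟩ g hg h hh
  exact ha K hK _ hg _ hh

theorem resChar_conj {a : G → ℂ} (ha : ∀ g x, a (x * g * x⁻¹) = a g) (g x : M) :
    resChar M a (x * g * x⁻¹) = resChar M a g :=
  ha g x

theorem constituentsOn_subset_Irr (θ : G → ℂ) : constituentsOn M θ ⊆ Irr M := fun _ h => h.1

variable [Finite G]

theorem cInner_zeroExtend (M : Subgroup G) (b : M → ℂ) (χ : G → ℂ) :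
    (Nat.card G : ℂ) * cInner G (zeroExtend M b) χ =
      Nat.card M * cInner M b (resChar M χ) := by
  have := Fintype.ofFinite G
  have := Fintype.ofFinite M
  rw [cInner_eq, cInner_eq, mul_inv_cancel_left₀ (card_ne_zero G),
    mul_inv_cancel_left₀ (card_ne_zero M)]
  symm
  refine Finset.sum_of_injOn Subtype.val Subtype.val_injective.injOn (by simp) ?_ ?_
  · intro g _ hg
    have hgM : g ∉ M := fun h => hg ⟨⟨g, h⟩, by simp, rfl⟩
    simp [zeroExtend, hgM]
  · intro m _
    simp [zeroExtend, resChar]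

theorem cInner_conj_symm (α β : G → ℂ) :
    (starRingEnd ℂ) (Nat.card G * cInner G α β) =
      ∑ᶠ g : G, (starRingEnd ℂ) (α g) * β g := by
  have := Fintype.ofFinite G
  rw [cInner_eq, mul_inv_cancel_left₀ (card_ne_zero G), finsum_eq_sum_of_fintype]
  simp

theorem conj_Irr_one {χ : G → ℂ} (hχ : χ ∈ Irr G) : (starRingEnd ℂ) (χ 1) = χ 1 := by
  obtain ⟨d, -, h⟩ := Irr_one hχ
  simp [h]

theorem cInner_resChar_mul [hM : M.Normal] {χ : G → ℂ} (hχ : χ ∈ Irr G) {ψ : M → ℂ}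
    (hψ : ψ ∈ Irr M) (h : cInner M (resChar M χ) ψ ≠ 0) {b : M → ℂ}
    (hb : ∀ g x, zeroExtend M b (x * g * x⁻¹) = zeroExtend M b g) :
    cInner M b ψ * χ 1 = cInner M b (resChar M χ) * ψ 1 := by
  have hb' : ∀ g m, b (conjSub hM g m) = b m := by
    intro g m
    have h1 := hb m g
    have h2 : g * m * g⁻¹ ∈ M := (conjSub hM g m).2
    simp only [zeroExtend, h2, m.2, dif_pos] at h1
    exact h1
  have key := central_character_restrict M hχ hψ h (a := fun m => (starRingEnd ℂ) (b m))
    (fun g m => by rw [hb'])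
  have key' : (∑ᶠ m : M, (starRingEnd ℂ) (b m) * resChar M χ m) * ψ 1 =
    (∑ᶠ m : M, (starRingEnd ℂ) (b m) * ψ m) * χ 1 := key
  rw [← cInner_conj_symm, ← cInner_conj_symm, ← conj_Irr_one hψ, ← conj_Irr_one hχ, ← map_mul,
    ← map_mul] at key'
  have := (starRingEnd ℂ).injective key'
  rw [mul_assoc, mul_assoc] at this
  exact (mul_left_cancel₀ (card_ne_zero M) this).symm

theorem mem_constituentsOn_sigmaChar {X : Set (G → ℂ)} (hX : X ⊆ Irr G) {ψ : M → ℂ} :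
    ψ ∈ constituentsOn M (sigmaChar X) ↔
      ψ ∈ Irr M ∧ ∃ χ ∈ X, cInner M (resChar M χ) ψ ≠ 0 := by
  refine and_congr_right fun hψ => ?_
  have hfin := Irr_finite.subset hX
  have h1 : cInner M (resChar M (sigmaChar X)) ψ =
      ∑ χ ∈ hfin.toFinset, χ 1 * cInner M (resChar M χ) ψ := by
    have h2 : resChar M (sigmaChar X) = ∑ χ ∈ hfin.toFinset, χ 1 • resChar M χ := by
      funext m
      simp [resChar, sigmaChar_eq_sum hX]
    rw [h2, ← cInnerLeft_apply, map_sum]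
    simp
  have hnn : ∀ χ ∈ hfin.toFinset, 0 ≤ χ 1 * cInner M (resChar M χ) ψ := by
    intro χ hχ
    have hχ' := hX (hfin.mem_toFinset.1 hχ)
    obtain ⟨d, -, hd⟩ := Irr_one hχ'
    obtain ⟨k, hk⟩ := cInner_resChar_eq_natCast M hχ' hψ
    rw [hd, hk]
    exact_mod_cast Nat.zero_le _
  rw [h1, ne_eq, Finset.sum_eq_zero_iff_of_nonneg hnn]
  push Not
  simp only [Set.Finite.mem_toFinset]
  refine exists_congr fun χ => and_congr_right fun hχ => ?_
  simp [Irr_one_ne_zero (hX hχ)]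

theorem constOn_ratio_constituents (h : IsSCT G 𝒳 𝒦) [M.Normal] (hM : CNormal 𝒦 M) {b : M → ℂ}
    (hb : b ∈ constOn ((fun K => (Subtype.val ⁻¹' K : Set M)) '' {K ∈ 𝒦 | K ⊆ (M : Set G)}))
    {X : Set (G → ℂ)} (hX : X ∈ 𝒳) {ψ ψ' : M → ℂ} (hψ : ψ ∈ constituentsOn M (sigmaChar X))
    (hψ' : ψ' ∈ constituentsOn M (sigmaChar X)) :
    cInner M b ψ * ψ' 1 = cInner M b ψ' * ψ 1 := by
  have hXI := h.1.2.1 X hX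
  obtain ⟨hψI, χ, hχ, hχψ⟩ := (mem_constituentsOn_sigmaChar hXI).1 hψ
  obtain ⟨hψI', χ', hχ', hχψ'⟩ := (mem_constituentsOn_sigmaChar hXI).1 hψ'
  have hz := zeroExtend_mem_constOn h.2.1 hM hb
  have hconj := constOn_conj h hz
  have h1 := cInner_resChar_mul (hXI hχ) hψI hχψ hconj
  have h2 := cInner_resChar_mul (hXI hχ') hψI' hχψ' hconj
  have h3 := congrArg (fun z => (Nat.card G : ℂ) * z) (constOn_ratio h hz hX hχ hχ')
  simp only [← mul_assoc, cInner_zeroExtend] at h3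
  simp only [mul_assoc] at h3
  have h4 := mul_left_cancel₀ (card_ne_zero M) h3
  have hne := mul_ne_zero (Irr_one_ne_zero (hXI hχ)) (Irr_one_ne_zero (hXI hχ'))
  refine mul_right_cancel₀ hne ?_
  linear_combination (χ' 1 * ψ' 1) * h1 - (χ 1 * ψ 1) * h2 + (ψ 1 * ψ' 1) * h4

theorem constituentsOn_subset (h : IsSCT G 𝒳 𝒦) [M.Normal] (hM : CNormal 𝒦 M)
    {X Y : Set (G → ℂ)} (hX : X ∈ 𝒳) (hY : Y ∈ 𝒳) {ψ : M → ℂ}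
    (hψX : ψ ∈ constituentsOn M (sigmaChar X)) (hψY : ψ ∈ constituentsOn M (sigmaChar Y)) :
    constituentsOn M (sigmaChar X) ⊆ constituentsOn M (sigmaChar Y) := by
  intro ψ' hψ'
  refine ⟨hψ'.1, fun h0 => ?_⟩
  have h1 := constOn_ratio_constituents h hM
    (resChar_mem_constOn (sigmaChar_mem_constOn h hY)) hX hψX hψ'
  rw [h0, zero_mul] at h1
  exact mul_ne_zero hψY.2 (Irr_one_ne_zero hψ'.1) h1

theorem exists_mem_constituentsOn (h : IsSCT G 𝒳 𝒦) {ψ : M → ℂ} (hψ : ψ ∈ Irr M) :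
    ∃ X ∈ 𝒳, ψ ∈ constituentsOn M (sigmaChar X) := by
  by_contra! hno
  have hall : ∀ a ∈ constOn 𝒦, cInner M (resChar M a) ψ = 0 := by
    intro a ha
    let L : (G → ℂ) →ₗ[ℂ] ℂ :=
      (cInnerLeft ψ).comp (LinearMap.funLeft ℂ ℂ (Subtype.val : M → G))
    have hle : constOn 𝒦 ≤ LinearMap.ker L := by
      rw [constOn_eq_span h, Submodule.span_le]
      rintro _ ⟨X, hX, rfl⟩
      by_contra h0
      exact hno X hX ⟨hψ, h0⟩
    exact hle ha
  have h1 := hall _ (indicator_mem_constOn h.2.1 h.2.2.2.1)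
  have := Fintype.ofFinite M
  rw [cInner_eq, mul_eq_zero, or_iff_right (inv_ne_zero (card_ne_zero M)),
    Finset.sum_eq_single 1 _ (by simp)] at h1
  · simp [resChar, Irr_one_ne_zero hψ] at h1
  · intro m _ hm
    simp [resChar, hm]

theorem constituentsOn_nonempty (h𝒳 : IsPartitionOf (Irr G) 𝒳) (M : Subgroup G)
    {X : Set (G → ℂ)} (hX : X ∈ 𝒳) : (constituentsOn M (sigmaChar X)).Nonempty := by
  by_contra hne
  have hXI := h𝒳.2.1 X hX
  have h0 := eq_zero_of_forall_cInner_eq_zero (resChar_conj (M := M) (sigmaChar_conj hXI))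
    fun ψ hψ => by
      by_contra h1
      exact hne ⟨ψ, hψ, h1⟩
  exact sigmaChar_one_ne_zero hXI (partition_nonempty h𝒳 hX) (congrFun h0 1)

theorem resChar_sigmaChar (h : IsSCT G 𝒳 𝒦) [M.Normal] (hM : CNormal 𝒦 M) {X : Set (G → ℂ)}
    (hX : X ∈ 𝒳) : ∃ c : ℂ, c ≠ 0 ∧
      resChar M (sigmaChar X) = c • sigmaChar (constituentsOn M (sigmaChar X)) := by
  have hXI := h.1.2.1 X hX
  obtain ⟨ψ₀, hψ₀⟩ := constituentsOn_nonempty h.1 M hX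
  have h1 := Irr_one_ne_zero hψ₀.1
  refine ⟨cInner M (resChar M (sigmaChar X)) ψ₀ / ψ₀ 1, div_ne_zero hψ₀.2 h1, ?_⟩
  refine eq_of_forall_cInner_eq (resChar_conj (sigmaChar_conj hXI))
    (fun g x => by simp [sigmaChar_conj (constituentsOn_subset_Irr _)]) fun ψ hψ => ?_
  rw [← cInnerLeft_apply (_ • _), map_smul, cInnerLeft_apply, smul_eq_mul]
  by_cases hψX : ψ ∈ constituentsOn M (sigmaChar X)
  · rw [cInner_sigmaChar_of_mem (constituentsOn_subset_Irr _) hψX, div_mul_eq_mul_div,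
      eq_div_iff h1]
    exact constOn_ratio_constituents h hM (resChar_mem_constOn (sigmaChar_mem_constOn h hX)) hX
      hψX hψ₀
  · rw [cInner_sigmaChar_of_notMem (constituentsOn_subset_Irr _) hψ hψX, mul_zero]
    by_contra h0
    exact hψX ⟨hψ, h0⟩

/-- The restriction of a supercharacter theory to a normal subgroup that is a union of
superclasses. -/
theorem isSCT_restrict (h : IsSCT G 𝒳 𝒦) [M.Normal] (hM : CNormal 𝒦 M) :
    IsSCT M ((fun X => constituentsOn M (sigmaChar X)) '' 𝒳)
      ((fun K => (Subtype.val ⁻¹' K : Set M)) '' {K ∈ 𝒦 | K ⊆ (M : Set G)}) := by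
  have h𝒳' : IsPartitionOf (Irr M) ((fun X => constituentsOn M (sigmaChar X)) '' 𝒳) := by
    refine isPartitionOf_of ?_ ?_ ?_ ?_
    · rintro _ ⟨X, hX, rfl⟩
      exact constituentsOn_nonempty h.1 M hX
    · rintro _ ⟨X, hX, rfl⟩
      exact constituentsOn_subset_Irr _
    · intro ψ hψ
      obtain ⟨X, hX, hψX⟩ := exists_mem_constituentsOn h hψ
      exact ⟨_, ⟨X, hX, rfl⟩, hψX⟩
    · rintro _ ⟨X, hX, rfl⟩ _ ⟨Y, hY, rfl⟩ ψ hψX hψY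
      exact constituentsOn_subset h hM hX hY hψX hψY
  refine isSCT_of_constOn_le h𝒳' (isPartitionOf_of ?_ ?_ ?_ ?_) ?_ ?_ ?_
  · rintro _ ⟨K, ⟨hK, hKM⟩, rfl⟩
    obtain ⟨g, hg⟩ := partition_nonempty h.2.1 hK
    exact ⟨⟨g, hKM hg⟩, hg⟩
  · exact fun _ _ => Set.subset_univ _
  · intro m _
    obtain ⟨K, hK, hmK⟩ := partition_exists h.2.1 (Set.mem_univ (m : G))
    exact ⟨_, ⟨K, ⟨hK, subset_of_mem_CNormal h.2.1 hM hK hmK m.2⟩, rfl⟩, hmK⟩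
  · rintro _ ⟨K, ⟨hK, -⟩, rfl⟩ _ ⟨J, ⟨hJ, -⟩, rfl⟩ m hmK hmJ
    rw [partition_eq h.2.1 hK hJ hmK hmJ]
  · refine ⟨{1}, ⟨h.2.2.2.1, by simp⟩, ?_⟩
    ext m
    simp
  · rintro _ ⟨X, hX, rfl⟩
    obtain ⟨c, hc, hcX⟩ := resChar_sigmaChar h hM hX
    have := Submodule.smul_mem _ c⁻¹ (resChar_mem_constOn (M := M) (sigmaChar_mem_constOn h hX))
    rwa [hcX, inv_smul_smul₀ hc] at this
  · intro b hb
    refine mem_span_of_ratio h𝒳' (fun g x => ?_) ?_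
    · have h1 := constOn_conj h (zeroExtend_mem_constOn h.2.1 hM hb) g x
      have h2 : (x : G) * g * (x : G)⁻¹ ∈ M := (x * g * x⁻¹).2
      simp only [zeroExtend, h2, g.2, dif_pos] at h1
      exact h1
    · rintro _ ⟨X, hX, rfl⟩ ψ hψ ψ' hψ'
      exact constOn_ratio_constituents h hM hb hX hψ hψ'

end Restriction

section CosetInvariance

variable {G : Type} [Group G] [Finite G] {N : Subgroup G} [N.Normal]

/-- A function constant on the cosets of `N` is orthogonal to the irreducible characters whose
kernel does not contain `N`. -/
theorem cInner_eq_zero_of_notMem_IrrOver {a : G → ℂ} (ha : ∀ g, ∀ n ∈ N, a (g * n) = a g)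
    {χ : G → ℂ} (hχ : χ ∈ Irr G) (hχN : χ ∉ IrrOver N) : cInner G a χ = 0 := by
  have := Fintype.ofFinite G
  have := Fintype.ofFinite N
  rw [cInner_eq, mul_eq_zero, or_iff_right (inv_ne_zero (card_ne_zero G))]
  have h1 : ∀ n : N, ∑ g, a g * (starRingEnd ℂ) (χ g) =
      ∑ g, a g * (starRingEnd ℂ) (χ (g * n)) := by
    intro n
    rw [← Equiv.sum_comp (Equiv.mulRight (n : G))]
    refine Finset.sum_congr rfl fun g _ => ?_
    simp [ha g n n.2]
  have h2 : (Nat.card N : ℂ) * ∑ g, a g * (starRingEnd ℂ) (χ g) = 0 := by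
    calc (Nat.card N : ℂ) * ∑ g, a g * (starRingEnd ℂ) (χ g)
        = ∑ n : N, ∑ g, a g * (starRingEnd ℂ) (χ (g * n)) := by
          rw [← Finset.sum_congr rfl fun n _ => h1 n, Finset.sum_const, Finset.card_univ,
            nsmul_eq_mul, Nat.card_eq_fintype_card]
      _ = ∑ g, a g * (starRingEnd ℂ) (∑ᶠ n : N, χ (g * n)) := by
          rw [Finset.sum_comm]
          simp only [finsum_eq_sum_of_fintype, map_sum, Finset.mul_sum]
      _ = 0 := by simp [sum_coset_eq_zero hχ hχN]
  exact (mul_eq_zero.1 h2).resolve_left (card_ne_zero N)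

theorem sigmaChar_mul_mem {X : Set (G → ℂ)} (hX : X ⊆ IrrOver N) (g : G) {n : G} (hn : n ∈ N) :
    sigmaChar X (g * n) = sigmaChar X g := by
  refine finsum_mem_congr rfl fun χ hχ => ?_
  rw [(mem_IrrOver_iff (hX hχ).1).1 (hX hχ) g n hn]

theorem sum_coset_sigmaChar_eq_zero [Fintype N] {X : Set (G → ℂ)} (hX : X ⊆ Irr G)
    (hXN : ∀ χ ∈ X, χ ∉ IrrOver N) (g : G) : ∑ n : N, sigmaChar X (g * n) = 0 := by
  simp only [sigmaChar_eq_sum hX, Finset.sum_apply, Pi.smul_apply]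
  rw [Finset.sum_comm]
  refine Finset.sum_eq_zero fun χ hχ => ?_
  have hχX := (Set.Finite.mem_toFinset _).1 hχ
  rw [← Finset.smul_sum, ← finsum_eq_sum_of_fintype, sum_coset_eq_zero (hX hχX) (hXN χ hχX),
    smul_zero]

variable {𝒳 : Set (Set (G → ℂ))} {𝒦 : Set (Set G)}

theorem subset_IrrOver_of_mem (h : IsSCT G 𝒳 𝒦) (hN : CNormal 𝒦 N) {X : Set (G → ℂ)}
    (hX : X ∈ 𝒳) {χ : G → ℂ} (hχ : χ ∈ X) (hχN : χ ∈ IrrOver N) : X ⊆ IrrOver N := by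
  intro χ' hχ'
  by_contra hno
  have hI := h.1.2.1 X hX
  have h1 := constOn_ratio h (indicator_CNormal_mem_constOn h.2.1 hN) hX hχ hχ'
  rw [cInner_eq_zero_of_notMem_IrrOver (fun g n hn => by
    simp [Set.indicator_apply, N.mul_mem_cancel_right hn]) (hI hχ') hno, zero_mul, mul_eq_zero,
    or_iff_left (Irr_one_ne_zero (hI hχ'))] at h1
  have := Fintype.ofFinite G
  have := Fintype.ofFinite N
  rw [cInner_eq, mul_eq_zero, or_iff_right (inv_ne_zero (card_ne_zero G))] at h1
  have h2 : ∀ g, (N : Set G).indicator (1 : G → ℂ) g * (starRingEnd ℂ) (χ g) =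
      (N : Set G).indicator (1 : G → ℂ) g * (starRingEnd ℂ) (χ 1) := by
    intro g
    by_cases hg : g ∈ N
    · rw [hχN.2 g hg]
    · simp [hg]
  rw [Finset.sum_congr rfl fun g _ => h2 g, ← Finset.sum_mul, mul_eq_zero, or_iff_left
    (by simpa using Irr_one_ne_zero (hI hχ))] at h1
  have h3 : ∀ g ∈ Finset.univ, 0 ≤ (N : Set G).indicator (1 : G → ℂ) g := fun g _ =>
    Set.indicator_nonneg (fun _ _ => zero_le_one) g
  have h4 := (Finset.sum_eq_zero_iff_of_nonneg h3).1 h1 1 (Finset.mem_univ _)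
  simp [N.one_mem] at h4

/-- Summation over the cosets of `N`. -/
noncomputable def cosetSum (N : Subgroup G) : (G → ℂ) →ₗ[ℂ] (G → ℂ) where
  toFun a g := ∑ᶠ n : N, a (g * n)
  map_add' a b := by
    have := Fintype.ofFinite N
    funext g
    simp [finsum_eq_sum_of_fintype, Finset.sum_add_distrib]
  map_smul' c a := by
    have := Fintype.ofFinite N
    funext g
    simp [finsum_eq_sum_of_fintype, Finset.mul_sum]

theorem cosetSum_mem_constOn (h : IsSCT G 𝒳 𝒦) (hN : CNormal 𝒦 N) {a : G → ℂ}
    (ha : a ∈ constOn 𝒦) : cosetSum N a ∈ constOn 𝒦 := by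
  have := Fintype.ofFinite N
  have hle : constOn 𝒦 ≤ (constOn 𝒦).comap (cosetSum N) := by
    conv_lhs => rw [constOn_eq_span h]
    rw [Submodule.span_le]
    rintro _ ⟨X, hX, rfl⟩
    change cosetSum N (sigmaChar X) ∈ constOn 𝒦
    by_cases hXN : X ⊆ IrrOver N
    · have : cosetSum N (sigmaChar X) = (Fintype.card N : ℂ) • sigmaChar X := by
        funext g
        change ∑ᶠ n : N, sigmaChar X (g * n) = _
        rw [finsum_eq_sum_of_fintype, Finset.sum_congr rfl fun (n : N) _ =>
          sigmaChar_mul_mem hXN g n.2]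
        simp
      rw [this]
      exact Submodule.smul_mem _ _ (sigmaChar_mem_constOn h hX)
    · have : cosetSum N (sigmaChar X) = 0 := by
        funext g
        change ∑ᶠ n : N, sigmaChar X (g * n) = _
        rw [finsum_eq_sum_of_fintype]
        exact sum_coset_sigmaChar_eq_zero (h.1.2.1 X hX)
          (fun χ hχ hχN => hXN (subset_IrrOver_of_mem h hN hX hχ hχN)) g
      rw [this]
      exact Submodule.zero_mem _
  exact hle ha

theorem exists_mul_mem_of_exists (h : IsSCT G 𝒳 𝒦) (hN : CNormal 𝒦 N) {J K : Set G}
    (hJ : J ∈ 𝒦) (hK : K ∈ 𝒦) {g : G} (hg : g ∈ J) (hgK : ∃ n ∈ N, g * n ∈ K) {x : G}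
    (hx : x ∈ J) : ∃ n ∈ N, x * n ∈ K := by
  have := Fintype.ofFinite N
  have h1 := cosetSum_mem_constOn h hN (indicator_mem_constOn h.2.1 hK) J hJ x hx g hg
  change ∑ᶠ n : N, K.indicator (1 : G → ℂ) (x * n) = ∑ᶠ n : N, K.indicator (1 : G → ℂ) (g * n)
    at h1
  rw [finsum_eq_sum_of_fintype, finsum_eq_sum_of_fintype] at h1
  by_contra! hno
  rw [Finset.sum_eq_zero fun (n : N) _ => by simp [hno n n.2]] at h1
  have h2 := (Finset.sum_eq_zero_iff_of_nonneg fun (n : N) _ =>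
    Set.indicator_nonneg (fun _ _ => zero_le_one) (g * n)).1 h1.symm
  obtain ⟨n, hn, hnK⟩ := hgK
  simpa [hnK] using h2 ⟨n, hn⟩ (Finset.mem_univ _)

end CosetInvariance

section Quotient

variable {G : Type} [Group G]

theorem image_val_preimage_val {M : Subgroup G} {K : Set G} (hK : K ⊆ (M : Set G)) :
    (Subtype.val '' (Subtype.val ⁻¹' K : Set M) : Set G) = K :=
  Set.image_preimage_eq_of_subset fun g hg => ⟨⟨g, hK hg⟩, rfl⟩

theorem preimage_image_mk_eq {N : Subgroup G} {K : Set G}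
    (hK : ∀ g ∈ K, ∀ n ∈ N, g * n ∈ K) :
    (QuotientGroup.mk : G → G ⧸ N) ⁻¹' (QuotientGroup.mk '' K) = K := by
  refine Set.Subset.antisymm ?_ (Set.subset_preimage_image _ _)
  rintro g ⟨k, hk, hkg⟩
  simpa using hK k hk _ (QuotientGroup.eq.1 hkg)

variable {N : Subgroup G} [N.Normal]

theorem sigmaChar_image_comp {Q : Type} [Group Q] {π : G →* Q} (hπ : Function.Surjective π)
    (Y : Set (Q → ℂ)) : sigmaChar ((fun η => η ∘ π) '' Y) = sigmaChar Y ∘ π := by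
  funext g
  simp only [sigmaChar, Function.comp_apply]
  rw [finsum_mem_image hπ.injective_comp_right.injOn]
  simp

theorem mk_mem_iff {M : Subgroup G} (hNM : N ≤ M) {g : G} :
    (g : G ⧸ N) ∈ M.map (QuotientGroup.mk' N) ↔ g ∈ M := by
  refine ⟨?_, fun hg => ⟨g, hg, rfl⟩⟩
  rintro ⟨m, hm, hmg⟩
  have h1 : m⁻¹ * g ∈ M := hNM (QuotientGroup.eq.1 hmg)
  exact (M.mul_mem_cancel_left (M.inv_mem hm)).1 h1

theorem image_mk_subset_iff {M : Subgroup G} (hNM : N ≤ M) {K : Set G} :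
    (QuotientGroup.mk : G → G ⧸ N) '' K ⊆ (M.map (QuotientGroup.mk' N) : Set (G ⧸ N)) ↔
      K ⊆ (M : Set G) := by
  rw [Set.image_subset_iff]
  exact forall_congr' fun g => imp_congr_right fun _ => mk_mem_iff hNM

theorem mul_mem_of_eq_wedgeFormula {M : Subgroup G} {𝒳' : Set (Set (M → ℂ))} {𝒦' : Set (Set M)}
    {𝒴 : Set (Set (G ⧸ N → ℂ))} {𝓛 : Set (Set (G ⧸ N))}
    {𝒳 : Set (Set (G → ℂ))} {𝒦 : Set (Set G)}
    (h : (𝒳, 𝒦) = wedgeFormula G N M 𝒳' 𝒦' 𝒴 𝓛) {K : Set G} (hK : K ∈ 𝒦)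
    (hKM : ¬ K ⊆ (M : Set G)) {g : G} (hg : g ∈ K) {n : G} (hn : n ∈ N) : g * n ∈ K := by
  have hK' : K ∈ (wedgeFormula G N M 𝒳' 𝒦' 𝒴 𝓛).2 := h ▸ hK
  rcases hK' with ⟨J, -, rfl⟩ | ⟨L, -, rfl⟩
  · refine absurd ?_ hKM
    rintro _ ⟨m, -, rfl⟩
    exact m.2
  · change ((g * n : G) : G ⧸ N) ∈ L
    rwa [QuotientGroup.mk_mul_of_mem g hn]

variable [Finite G]

theorem deflate_comp_mk {χ : G → ℂ} (hχ : χ ∈ IrrOver N) :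
    (fun q : G ⧸ N => χ (Quotient.out q)) ∘ (QuotientGroup.mk : G → G ⧸ N) = χ := by
  funext g
  obtain ⟨n, hn⟩ := QuotientGroup.mk_out_eq_mul N g
  change χ (Quotient.out (g : G ⧸ N)) = χ g
  rw [hn, (mem_IrrOver_iff hχ.1).1 hχ g n n.2]

theorem comp_mk_mem_IrrOver {η : G ⧸ N → ℂ} (hη : η ∈ Irr (G ⧸ N)) :
    η ∘ (QuotientGroup.mk : G → G ⧸ N) ∈ IrrOver N := by
  refine ⟨Irr_comp (QuotientGroup.mk'_surjective N) hη, fun n hn => ?_⟩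
  have h1 : (n : G ⧸ N) = 1 := (QuotientGroup.eq_one_iff n).2 hn
  simp [h1]

theorem deflate_mem_Irr {χ : G → ℂ} (hχ : χ ∈ IrrOver N) :
    (fun q : G ⧸ N => χ (Quotient.out q)) ∈ Irr (G ⧸ N) := by
  have hχ' : χ ∈ IrrOver (QuotientGroup.mk' N).ker := by rwa [QuotientGroup.ker_mk']
  obtain ⟨η, hη, hηχ⟩ := exists_Irr_comp_eq (QuotientGroup.mk'_surjective N) hχ'
  have h1 := (deflate_comp_mk hχ).trans hηχ.symm
  rwa [(QuotientGroup.mk'_surjective N).injective_comp_right h1]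

theorem inflateSet_deflate {X : Set (G → ℂ)} (hX : X ⊆ IrrOver N) :
    inflateSet N (deflate N X) = X := by
  rw [inflateSet, deflate, Set.image_image]
  conv_rhs => rw [← Set.image_id' X]
  exact Set.image_congr fun χ hχ => deflate_comp_mk (hX hχ)

theorem mem_deflate_iff {X : Set (G → ℂ)} (hX : X ⊆ IrrOver N) {η : G ⧸ N → ℂ} :
    η ∈ deflate N X ↔ η ∘ (QuotientGroup.mk : G → G ⧸ N) ∈ X := by
  conv_rhs => rw [← inflateSet_deflate hX]
  exact ((QuotientGroup.mk'_surjective N).injective_comp_right.mem_set_image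
    (s := deflate N X)).symm

theorem sigmaChar_deflate_comp_mk {X : Set (G → ℂ)} (hX : X ⊆ IrrOver N) :
    sigmaChar (deflate N X) ∘ (QuotientGroup.mk : G → G ⧸ N) = sigmaChar X := by
  conv_rhs => rw [← inflateSet_deflate hX]
  exact (sigmaChar_image_comp (QuotientGroup.mk'_surjective N) _).symm

variable {𝒳 : Set (Set (G → ℂ))} {𝒦 : Set (Set G)}

/-- The quotient of a supercharacter theory by a normal subgroup that is a union of
superclasses. -/
theorem isSCT_quotient (h : IsSCT G 𝒳 𝒦) (hN : CNormal 𝒦 N) :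
    IsSCT (G ⧸ N) (deflate N '' {X ∈ 𝒳 | X ⊆ IrrOver N})
      ((fun K => ((QuotientGroup.mk : G → G ⧸ N) '' K)) '' 𝒦) := by
  have h𝒴 : IsPartitionOf (Irr (G ⧸ N)) (deflate N '' {X ∈ 𝒳 | X ⊆ IrrOver N}) := by
    refine isPartitionOf_of ?_ ?_ ?_ ?_
    · rintro _ ⟨X, ⟨hX, -⟩, rfl⟩
      exact (partition_nonempty h.1 hX).image _
    · rintro _ ⟨X, ⟨-, hXN⟩, rfl⟩ _ ⟨χ, hχ, rfl⟩
      exact deflate_mem_Irr (hXN hχ)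
    · intro η hη
      have hη' := comp_mk_mem_IrrOver hη
      obtain ⟨X, hX, hηX⟩ := partition_exists h.1 hη'.1
      have hXN := subset_IrrOver_of_mem h hN hX hηX hη'
      exact ⟨_, ⟨X, ⟨hX, hXN⟩, rfl⟩, (mem_deflate_iff hXN).2 hηX⟩
    · rintro _ ⟨X, ⟨hX, hXN⟩, rfl⟩ _ ⟨Y, ⟨hY, hYN⟩, rfl⟩ η hηX hηY
      rw [partition_eq h.1 hX hY ((mem_deflate_iff hXN).1 hηX) ((mem_deflate_iff hYN).1 hηY)]
  refine isSCT_of_constOn_le h𝒴 (isPartitionOf_of ?_ ?_ ?_ ?_) ?_ ?_ ?_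
  · rintro _ ⟨K, hK, rfl⟩
    exact (partition_nonempty h.2.1 hK).image _
  · exact fun _ _ => Set.subset_univ _
  · intro q _
    obtain ⟨g, rfl⟩ := QuotientGroup.mk_surjective q
    obtain ⟨K, hK, hgK⟩ := partition_exists h.2.1 (Set.mem_univ g)
    exact ⟨_, ⟨K, hK, rfl⟩, g, hgK, rfl⟩
  · rintro _ ⟨J, hJ, rfl⟩ _ ⟨K, hK, rfl⟩ _ ⟨g, hg, rfl⟩ ⟨k, hk, hkg⟩ _ ⟨x, hx, rfl⟩
    have hgk : g⁻¹ * k ∈ N := QuotientGroup.eq.1 hkg.symm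
    obtain ⟨n, hn, hnK⟩ := exists_mul_mem_of_exists h hN hJ hK hg
      ⟨_, hgk, by rwa [mul_inv_cancel_left]⟩ hx
    exact ⟨_, hnK, QuotientGroup.mk_mul_of_mem x hn⟩
  · exact ⟨{1}, h.2.2.2.1, by simp⟩
  · rintro _ ⟨X, ⟨hX, hXN⟩, rfl⟩ _ ⟨K, hK, rfl⟩ _ ⟨g, hg, rfl⟩ _ ⟨x, hx, rfl⟩
    have h1 := sigmaChar_mem_constOn h hX K hK g hg x hx
    rwa [← sigmaChar_deflate_comp_mk hXN] at h1
  · intro a ha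
    have ha' : a ∘ (QuotientGroup.mk : G → G ⧸ N) ∈ constOn 𝒦 := fun K hK g hg x hx =>
      ha _ ⟨K, hK, rfl⟩ _ ⟨g, hg, rfl⟩ _ ⟨x, hx, rfl⟩
    refine mem_span_of_ratio h𝒴 (fun p q => ?_) ?_
    · obtain ⟨g, rfl⟩ := QuotientGroup.mk_surjective p
      obtain ⟨x, rfl⟩ := QuotientGroup.mk_surjective q
      exact constOn_conj h ha' g x
    · rintro _ ⟨X, ⟨hX, hXN⟩, rfl⟩ η hη η' hη'
      have h1 := constOn_ratio h ha' hX ((mem_deflate_iff hXN).1 hη) ((mem_deflate_iff hXN).1 hη')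
      have hc := fun η => cInner_comp (QuotientGroup.mk'_surjective N) a η
      simp only [QuotientGroup.coe_mk'] at hc
      rw [hc, hc] at h1
      exact h1

end Quotient

section Wedge

variable {G : Type} [Group G] [Finite G] {𝒳 : Set (Set (G → ℂ))} {𝒦 : Set (Set G)}
  {N M : Subgroup G} [N.Normal]

/-- The constituents of an inflated function are the inflations of its constituents. -/
theorem image_comp_constituents {H Q : Type} [Group H] [Finite H] [Group Q] [Finite Q]
    {π : H →* Q} (hπ : Function.Surjective π) (θ : Q → ℂ) :
    (fun η => η ∘ π) '' {η ∈ Irr Q | cInner Q θ η ≠ 0} =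
      {ψ ∈ Irr H | cInner H (θ ∘ π) ψ ≠ 0} := by
  ext ψ
  constructor
  · rintro ⟨η, ⟨hη, h0⟩, rfl⟩
    exact ⟨Irr_comp hπ hη, by rwa [cInner_comp hπ]⟩
  · rintro ⟨hψ, h0⟩
    have hker : ψ ∈ IrrOver π.ker := by
      by_contra hno
      refine h0 (cInner_eq_zero_of_notMem_IrrOver (fun g n hn => ?_) hψ hno)
      simp [MonoidHom.mem_ker.1 hn]
    obtain ⟨η, hη, rfl⟩ := exists_Irr_comp_eq hπ hker
    exact ⟨η, ⟨hη, by rwa [cInner_comp hπ] at h0⟩, rfl⟩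

theorem image_constituentsOn_deflate {X : Set (G → ℂ)} (hX : X ⊆ IrrOver N) :
    (fun ψ => ψ ∘ projMN M N) ''
      constituentsOn (M.map (QuotientGroup.mk' N)) (sigmaChar (deflate N X)) =
      constituentsOn M (sigmaChar X) := by
  let π : M →* M.map (QuotientGroup.mk' N) :=
    { toFun := projMN M N
      map_one' := rfl
      map_mul' := fun _ _ => rfl }
  have hπ : Function.Surjective π := by
    rintro ⟨_, m, hm, rfl⟩
    exact ⟨⟨m, hm⟩, rfl⟩
  have h1 : resChar (M.map (QuotientGroup.mk' N)) (sigmaChar (deflate N X)) ∘ π =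
      resChar M (sigmaChar X) := by
    rw [← sigmaChar_deflate_comp_mk hX]
    rfl
  have h2 := image_comp_constituents hπ
    (resChar (M.map (QuotientGroup.mk' N)) (sigmaChar (deflate N X)))
  rw [h1] at h2
  exact h2

/-- If the superclasses outside `M` are unions of `N`-cosets, then the supercharacters not lying
over `G / N` vanish outside `M`. -/
theorem sigmaChar_eq_zero_of_notMem (h : IsSCT G 𝒳 𝒦) (hN : CNormal 𝒦 N)
    (hcos : ∀ K ∈ 𝒦, ¬ K ⊆ (M : Set G) → ∀ g ∈ K, ∀ n ∈ N, g * n ∈ K) {X : Set (G → ℂ)}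
    (hX : X ∈ 𝒳) (hXN : ¬ X ⊆ IrrOver N) {g : G} (hg : g ∉ M) : sigmaChar X g = 0 := by
  have hXI := h.1.2.1 X hX
  obtain ⟨K, hK, hgK⟩ := partition_exists h.2.1 (Set.mem_univ g)
  have hKcos := hcos K hK fun hKM => hg (hKM hgK)
  have := Fintype.ofFinite N
  have h0 := sum_coset_sigmaChar_eq_zero hXI
    (fun χ hχ hχN => hXN (subset_IrrOver_of_mem h hN hX hχ hχN)) g
  rw [Finset.sum_congr rfl fun (n : N) _ =>
    sigmaChar_mem_constOn h hX K hK _ (hKcos g hgK n n.2) g hgK] at h0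
  simpa using h0

variable [hMn : M.Normal]

theorem constituentsOn_subset_IrrOver_iff (h : IsSCT G 𝒳 𝒦) (hNM : N ≤ M) (hN : CNormal 𝒦 N)
    (hM : CNormal 𝒦 M) {X : Set (G → ℂ)} (hX : X ∈ 𝒳) :
    constituentsOn M (sigmaChar X) ⊆ IrrOver (N.subgroupOf M) ↔ X ⊆ IrrOver N := by
  have hXI := h.1.2.1 X hX
  constructor
  · intro hsub
    by_contra hno
    have := Fintype.ofFinite N
    have h0 := sum_coset_sigmaChar_eq_zero hXI
      (fun χ hχ hχN => hno (subset_IrrOver_of_mem h hN hX hχ hχN)) 1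
    obtain ⟨c, -, hcX⟩ := resChar_sigmaChar h hM hX
    have h1 : ∀ n : N, sigmaChar X (1 * n) = sigmaChar X 1 := by
      intro n
      rw [one_mul]
      have h2 := congrFun hcX ⟨n, hNM n.2⟩
      have h3 := sigmaChar_mul_mem hsub 1 (n := ⟨n, hNM n.2⟩) (Subgroup.mem_subgroupOf.2 n.2)
      rw [one_mul] at h3
      rw [Pi.smul_apply, h3, ← Pi.smul_apply, ← hcX] at h2
      exact h2
    rw [Finset.sum_congr rfl fun n _ => h1 n] at h0
    simp [sigmaChar_one_ne_zero hXI (partition_nonempty h.1 hX)] at h0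
  · intro hsub ψ hψ
    by_contra hno
    refine hψ.2 (cInner_eq_zero_of_notMem_IrrOver (fun g n hn => ?_) hψ.1 hno)
    exact sigmaChar_mul_mem hsub g (Subgroup.mem_subgroupOf.1 hn)

theorem wedgeHyps_restrict_quotient (h : IsSCT G 𝒳 𝒦) (hNM : N ≤ M) (hN : CNormal 𝒦 N)
    (hM : CNormal 𝒦 M) :
    WedgeHyps G N M ((fun X => constituentsOn M (sigmaChar X)) '' 𝒳)
      ((fun K => (Subtype.val ⁻¹' K : Set ↥M)) '' {K ∈ 𝒦 | K ⊆ (M : Set G)})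
      (deflate N '' {X ∈ 𝒳 | X ⊆ IrrOver N})
      ((fun K => ((QuotientGroup.mk : G → G ⧸ N) '' K)) '' 𝒦) := by
  refine ⟨isSCT_restrict h hM, ?_, isSCT_quotient h hN, ?_, ?_, ?_, ?_⟩
  · have hconj : ∀ K ∈ 𝒦, ∀ g x, x * g * x⁻¹ ∈ K ↔ g ∈ K := by
      intro K hK g x
      have h1 := constOn_conj h (indicator_mem_constOn h.2.1 hK) g x
      by_cases h2 : x * g * x⁻¹ ∈ K <;> by_cases h3 : g ∈ K <;> simp_all
    rintro g _ ⟨K, ⟨hK, -⟩, rfl⟩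
    ext m
    constructor
    · rintro ⟨m, hm, rfl⟩
      exact (hconj K hK m g).2 hm
    · intro hm
      refine ⟨conjSub hMn g⁻¹ m, (hconj K hK m g⁻¹).2 hm, Subtype.ext ?_⟩
      simp [conjSub, mul_assoc]
  · obtain ⟨T, hT, hNT⟩ := hN
    refine ⟨(fun K => (Subtype.val ⁻¹' K : Set M)) '' T, ?_, ?_⟩
    · rintro _ ⟨K, hK, rfl⟩
      refine ⟨K, ⟨hT hK, fun g hg => hNM ?_⟩, rfl⟩
      exact hNT.symm.subset ⟨K, hK, hg⟩
    · rw [Set.sUnion_image, ← Set.preimage_iUnion₂, ← Set.sUnion_eq_biUnion, ← hNT]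
      rfl
  · obtain ⟨T, hT, hMT⟩ := hM
    refine ⟨(fun K => ((QuotientGroup.mk : G → G ⧸ N) '' K)) '' T, Set.image_mono hT, ?_⟩
    rw [Set.sUnion_image, ← Set.image_iUnion₂, ← Set.sUnion_eq_biUnion, ← hMT]
    rfl
  · ext Z
    constructor
    · rintro ⟨⟨X, hX, rfl⟩, hZ⟩
      have hXN := (constituentsOn_subset_IrrOver_iff h hNM hN hM hX).1 hZ
      exact ⟨_, ⟨X, ⟨hX, hXN⟩, rfl⟩, image_constituentsOn_deflate hXN⟩
    · rintro ⟨_, ⟨X, ⟨hX, hXN⟩, rfl⟩, rfl⟩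
      simp only [image_constituentsOn_deflate hXN]
      exact ⟨⟨X, hX, rfl⟩, (constituentsOn_subset_IrrOver_iff h hNM hN hM hX).2 hXN⟩
  · have himg : ∀ K : Set G, K ⊆ (M : Set G) →
        (fun m : M => ((m : G) : G ⧸ N)) '' (Subtype.val ⁻¹' K) =
          (QuotientGroup.mk : G → G ⧸ N) '' K := by
      intro K hK
      rw [← Set.image_image (QuotientGroup.mk : G → G ⧸ N) Subtype.val,
        image_val_preimage_val hK]
    ext L
    constructor
    · rintro ⟨_, ⟨K, ⟨hK, hKM⟩, rfl⟩, rfl⟩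
      simp only [himg K hKM]
      exact ⟨⟨K, hK, rfl⟩, (image_mk_subset_iff hNM).2 hKM⟩
    · rintro ⟨⟨K, hK, rfl⟩, hL⟩
      have hKM := (image_mk_subset_iff hNM).1 hL
      exact ⟨_, ⟨K, ⟨hK, hKM⟩, rfl⟩, himg K hKM⟩

theorem indSet_constituentsOn (h : IsSCT G 𝒳 𝒦) (hNM : N ≤ M) (hN : CNormal 𝒦 N)
    (hM : CNormal 𝒦 M)
    (hcos : ∀ K ∈ 𝒦, ¬ K ⊆ (M : Set G) → ∀ g ∈ K, ∀ n ∈ N, g * n ∈ K) {X : Set (G → ℂ)}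
    (hX : X ∈ 𝒳) (hXN : ¬ X ⊆ IrrOver N) :
    indSet M (constituentsOn M (sigmaChar X)) = X := by
  have hXI := h.1.2.1 X hX
  ext χ
  simp only [indSet, Set.mem_iUnion, irrOverChar, exists_prop, Set.mem_ofPred_eq]
  constructor
  · rintro ⟨ψ, hψ, hχ, hχψ⟩
    obtain ⟨Y, hY, hχY⟩ := partition_exists h.1 hχ
    have hψY := (mem_constituentsOn_sigmaChar (h.1.2.1 Y hY)).2 ⟨hψ.1, χ, hχY, hχψ⟩
    have heq := (constituentsOn_subset h hM hX hY hψ hψY).antisymm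
      (constituentsOn_subset h hM hY hX hψY hψ)
    have hYN : ¬ Y ⊆ IrrOver N := by
      rwa [← constituentsOn_subset_IrrOver_iff h hNM hN hM hY, ← heq,
        constituentsOn_subset_IrrOver_iff h hNM hN hM hX]
    obtain ⟨c, hc, hcX⟩ := resChar_sigmaChar h hM hX
    obtain ⟨d, hd, hdY⟩ := resChar_sigmaChar h hM hY
    rw [← heq] at hdY
    have hprop : sigmaChar Y = (d / c) • sigmaChar X := by
      funext g
      by_cases hg : g ∈ M
      · have h1 : sigmaChar X g = c * sigmaChar (constituentsOn M (sigmaChar X)) ⟨g, hg⟩ :=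
          congrFun hcX ⟨g, hg⟩
        have h2 : sigmaChar Y g = d * sigmaChar (constituentsOn M (sigmaChar X)) ⟨g, hg⟩ :=
          congrFun hdY ⟨g, hg⟩
        rw [Pi.smul_apply, h1, h2, smul_eq_mul]
        field_simp
      · rw [Pi.smul_apply, sigmaChar_eq_zero_of_notMem h hN hcos hX hXN hg,
          sigmaChar_eq_zero_of_notMem h hN hcos hY hYN hg, smul_zero]
    by_contra hχX
    have h3 := cInner_sigmaChar_of_mem (h.1.2.1 Y hY) hχY
    rw [hprop, ← cInnerLeft_apply, map_smul, cInnerLeft_apply,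
      cInner_sigmaChar_of_notMem hXI hχ hχX, smul_zero] at h3
    exact Irr_one_ne_zero hχ h3.symm
  · intro hχ
    obtain ⟨ψ, hψ, h0⟩ : ∃ ψ ∈ Irr M, cInner M (resChar M χ) ψ ≠ 0 := by
      by_contra! hall
      have h0 := eq_zero_of_forall_cInner_eq_zero
        (resChar_conj (M := M) (Irr_conj (hXI hχ))) hall
      exact Irr_one_ne_zero (hXI hχ) (congrFun h0 1)
    exact ⟨ψ, (mem_constituentsOn_sigmaChar hXI).2 ⟨hψ, χ, hχ, h0⟩, hXI hχ, h0⟩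

theorem eq_wedgeFormula_restrict_quotient (h : IsSCT G 𝒳 𝒦) (hNM : N ≤ M) (hN : CNormal 𝒦 N)
    (hM : CNormal 𝒦 M)
    (hcos : ∀ K ∈ 𝒦, ¬ K ⊆ (M : Set G) → ∀ g ∈ K, ∀ n ∈ N, g * n ∈ K) :
    (𝒳, 𝒦) = wedgeFormula G N M ((fun X => constituentsOn M (sigmaChar X)) '' 𝒳)
      ((fun K => (Subtype.val ⁻¹' K : Set ↥M)) '' {K ∈ 𝒦 | K ⊆ (M : Set G)})
      (deflate N '' {X ∈ 𝒳 | X ⊆ IrrOver N})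
      ((fun K => ((QuotientGroup.mk : G → G ⧸ N) '' K)) '' 𝒦) := by
  refine Prod.ext (Set.Subset.antisymm ?_ ?_) (Set.Subset.antisymm ?_ ?_)
  · intro X hX
    by_cases hXN : X ⊆ IrrOver N
    · exact Or.inl ⟨_, ⟨X, ⟨hX, hXN⟩, rfl⟩, inflateSet_deflate hXN⟩
    · refine Or.inr ⟨_, ⟨⟨X, hX, rfl⟩, ?_⟩, indSet_constituentsOn h hNM hN hM hcos hX hXN⟩
      rwa [constituentsOn_subset_IrrOver_iff h hNM hN hM hX]
  · rintro _ (⟨_, ⟨X, ⟨hX, hXN⟩, rfl⟩, rfl⟩ | ⟨_, ⟨⟨X, hX, rfl⟩, hXN⟩, rfl⟩)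
    · rwa [inflateSet_deflate hXN]
    · rw [constituentsOn_subset_IrrOver_iff h hNM hN hM hX] at hXN
      simpa only [indSet_constituentsOn h hNM hN hM hcos hX hXN] using hX
  · intro K hK
    by_cases hKM : K ⊆ (M : Set G)
    · exact Or.inl ⟨_, ⟨K, ⟨hK, hKM⟩, rfl⟩, image_val_preimage_val hKM⟩
    · refine Or.inr ⟨_, ⟨⟨K, hK, rfl⟩, ?_⟩, preimage_image_mk_eq (hcos K hK hKM)⟩
      rwa [image_mk_subset_iff hNM]
  · rintro _ (⟨_, ⟨K, ⟨hK, hKM⟩, rfl⟩, rfl⟩ | ⟨_, ⟨⟨K, hK, rfl⟩, hKM⟩, rfl⟩)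
    · simpa only [image_val_preimage_val hKM] using hK
    · rw [image_mk_subset_iff hNM] at hKM
      simpa only [preimage_image_mk_eq (hcos K hK hKM)] using hK

end Wedge

end SuperTheory

/-- Proposition 7.3. Let `N ≤ M` be `𝒞`-normal normal subgroups of
`G`. Then `𝒞` is a wedge product over `N` and `M` iff every superclass of `𝒞` outside
`M` is a union of `N`-cosets, in which case `𝒞 = 𝒞_M ∆ 𝒞^{G/N}`. -/
theorem stmt17 (G : Type) [Group G] [Finite G]
    (𝒳 : Set (Set (G → ℂ))) (𝒦 : Set (Set G)) (hSCT : IsSCT G 𝒳 𝒦)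
    (N M : Subgroup G) [N.Normal] [M.Normal] (hNM : N ≤ M)
    (hN : CNormal 𝒦 N) (hM : CNormal 𝒦 M) :
    ((∃ (𝒳' : Set (Set (↥M → ℂ))) (𝒦' : Set (Set ↥M))
        (𝒴' : Set (Set (G ⧸ N → ℂ))) (𝓛' : Set (Set (G ⧸ N))),
        WedgeHyps G N M 𝒳' 𝒦' 𝒴' 𝓛' ∧
          (𝒳, 𝒦) = wedgeFormula G N M 𝒳' 𝒦' 𝒴' 𝓛') ↔
      (∀ K ∈ 𝒦, ¬ K ⊆ (M : Set G) → ∀ g ∈ K, ∀ n ∈ N, g * n ∈ K)) ∧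
    ((∀ K ∈ 𝒦, ¬ K ⊆ (M : Set G) → ∀ g ∈ K, ∀ n ∈ N, g * n ∈ K) →
      (𝒳, 𝒦) = wedgeFormula G N M
        ((fun X => constituentsOn M (sigmaChar X)) '' 𝒳)
        ((fun K => (Subtype.val ⁻¹' K : Set ↥M)) '' {K ∈ 𝒦 | K ⊆ (M : Set G)})
        (deflate N '' {X ∈ 𝒳 | X ⊆ IrrOver N})
        ((fun K => ((QuotientGroup.mk : G → G ⧸ N) '' K)) '' 𝒦)) := by
  have hwedge := SuperTheory.eq_wedgeFormula_restrict_quotient hSCT hNM hN hM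
  refine ⟨⟨?_, fun hcos => ?_⟩, hwedge⟩
  · rintro ⟨𝒳', 𝒦', 𝒴', 𝓛', -, heq⟩ K hK hKM g hg n hn
    exact SuperTheory.mul_mem_of_eq_wedgeFormula heq hK hKM hg hn
  · exact ⟨_, _, _, _, SuperTheory.wedgeHyps_restrict_quotient hSCT hNM hN hM, hwedge hcos⟩
end
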